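/- There exists a constant C > 0 such that for every integer n > 1, every r ∈ (0,1], and every C² real-valued function φ on the Riemann sphere ℙ¹, | ∫_ℂ A_{n,r}(λ)·(2π)^{−1}·Δφ(λ) dA(λ) + ((d−1)·ν(n)/d)·φ(∞) − ν(n)·⟨T_f, φ⟩ | ≤ (sup_{ℙ¹} |ddᶜφ/ω|)·((2 log d)·σ₁(n) + C·σ₀(n)), where A_{n,r}(λ) := (1/n)·Σ_{z : Φ_n(λ,z)=0} log max{ r, |(f_λ^n)′(z)| } (sum over the roots of Φ_n(λ,·) counted with multiplicity); here ∫_ℂ A_{n,r}(λ)·(2π)^{−1}·Δφ(λ) dA(λ) + ((d−1)·ν(n)/d)·φ(∞) is the pairing of φ with the average over θ ∈ [0,2π] of the divisors Per*_f(n, r·e^{iθ}) of parameters admitting a cycle of formally exact period n and multiplier r·e^{iθ}. -/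

import Mathlib

open MeasureTheory Real Polynomial

/- STATEMENT 19:
There exists a constant C > 0 such that for every n > 1, every r ∈ (0,1], and every C²
real-valued function φ on ℙ¹,
|∫_ℂ A_{n,r}(λ)·(2π)^{−1}·Δφ(λ) dA(λ) + ((d−1)·ν(n)/d)·φ(∞) − ν(n)·⟨T_f, φ⟩|
  ≤ (sup_{ℙ¹}|ddᶜφ/ω|)·((2 log d)·σ₁(n) + C·σ₀(n)),
where A_{n,r}(λ) := (1/n)·Σ_{z : Φ_n(λ,z)=0} log max{r, |(f_λ^n)′(z)|} (sum over the roots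
of Φ_n(λ,·) with multiplicity), ⟨T_f, φ⟩ := ((d−1)/d)·(φ(∞) + ∫_ℂ g_I·(2π)^{−1}·Δφ dA),
and ddᶜφ/ω equals (1+|λ|²)²·Δφ(λ)/2 on ℂ. The dynatomic polynomial Φ_n is encoded as
Φ : (ℂ[λ])[z] with the defining product identity and monicity; a C² function φ on ℙ¹ is
encoded by φ : ℂ → ℝ (C² on ℂ), its value φ∞ at ∞, and the requirement that w ↦ φ(1/w)
(extended by φ∞ at 0) is C² at 0; the sup of |ddᶜφ/ω| over ℙ¹ is encoded by an arbitrary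
pointwise bound K on ℂ. -/

noncomputable def fc (d : ℕ) (lam z : ℂ) : ℂ := z ^ d + lam

noncomputable def nu (d n : ℕ) : ℤ :=
  ∑ m ∈ n.divisors, ArithmeticFunction.moebius (n / m) * (d : ℤ) ^ m

/-- The Laplacian Δφ = ∂²φ/∂x² + ∂²φ/∂y² of a function `φ : ℂ → ℝ`. -/
noncomputable def lap (φ : ℂ → ℝ) (z : ℂ) : ℝ :=
  iteratedFDeriv ℝ 2 φ z ![1, 1] + iteratedFDeriv ℝ 2 φ z ![Complex.I, Complex.I]




/-! ### Basic orbit estimates -/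

/-- critical orbit -/
noncomputable def orb (d : ℕ) (lam : ℂ) (k : ℕ) : ℂ := (fc d lam)^[k] 0

lemma orb_zero (d : ℕ) (lam : ℂ) : orb d lam 0 = 0 := rfl

lemma orb_succ (d : ℕ) (lam : ℂ) (k : ℕ) : orb d lam (k + 1) = orb d lam k ^ d + lam := by
  simp only [orb, Function.iterate_succ_apply', fc]

lemma orb_one {d : ℕ} (hd : 1 < d) (lam : ℂ) : orb d lam 1 = lam := by
  rw [orb_succ, orb_zero, zero_pow (by omega), zero_add]

lemma orb_add (d : ℕ) (lam : ℂ) (j k : ℕ) :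
    orb d lam (j + k) = (fc d lam)^[j] (orb d lam k) := by
  simp only [orb, Function.iterate_add_apply]

lemma esc_step {d : ℕ} (hd : 1 < d) {lam z : ℂ} (h1 : ‖lam‖ ≤ ‖z‖) (h2 : 2 ≤ ‖z‖ ^ (d - 1)) :
    ‖z‖ ≤ ‖fc d lam z‖ := by
  have e : ‖z ^ d‖ = ‖z‖ ^ (d - 1) * ‖z‖ := by
    rw [norm_pow, ← pow_succ]; congr 1; omega
  have : ‖z ^ d‖ - ‖lam‖ ≤ ‖fc d lam z‖ := by
    have := norm_sub_norm_le (z ^ d) (-lam)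
    simpa [fc] using this
  nlinarith [norm_nonneg z]

lemma esc_iter {d : ℕ} (hd : 1 < d) {lam z : ℂ} (h1 : ‖lam‖ ≤ ‖z‖) (h2 : 2 ≤ ‖z‖ ^ (d - 1))
    (j : ℕ) : ‖z‖ ≤ ‖(fc d lam)^[j] z‖ := by
  induction j with
  | zero => simp
  | succ k ih =>
    rw [Function.iterate_succ_apply']
    refine ih.trans (esc_step hd (h1.trans ih) (h2.trans ?_))
    gcongr

lemma one_le_of_two_le_pow {k : ℕ} {x : ℝ} (hx : 0 ≤ x) (h : 2 ≤ x ^ k) : 1 ≤ x := by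
  by_contra hlt
  have := pow_le_one₀ hx (le_of_lt (not_le.1 hlt)) (n := k)
  linarith

lemma orb_bound {d : ℕ} (hd : 1 < d) {lam : ℂ} {m : ℕ} (hm : 1 ≤ m) (h : ‖orb d lam m‖ < 1) :
    ‖lam‖ ^ (d - 1) < 2 ∧ ∀ j ≤ m, ‖orb d lam j‖ ^ (d - 1) < 2 := by
  have hl : ‖lam‖ ^ (d - 1) < 2 := by
    by_contra hc
    push Not at hc
    have h3 := esc_iter hd (le_refl ‖lam‖) hc (m - 1)
    have h4 : orb d lam m = (fc d lam)^[m - 1] lam := by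
      have := orb_add d lam (m - 1) 1
      rw [orb_one hd, Nat.sub_add_cancel hm] at this
      exact this
    rw [← h4] at h3
    have := one_le_of_two_le_pow (norm_nonneg _) hc
    linarith
  refine ⟨hl, fun j hj => ?_⟩
  by_contra hc
  push Not at hc
  have h5 : ‖lam‖ ≤ ‖orb d lam j‖ := by
    by_contra hlt
    push Not at hlt
    have : ‖orb d lam j‖ ^ (d - 1) ≤ ‖lam‖ ^ (d - 1) := by gcongr
    linarith
  have h3 := esc_iter hd h5 hc (m - j)
  rw [← orb_add, Nat.sub_add_cancel hj] at h3
  have := one_le_of_two_le_pow (norm_nonneg _) hc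
  linarith

lemma norm_le_two_of_pow_lt {d : ℕ} (hd : 1 < d) {x : ℝ} (hx : 0 ≤ x) (h : x ^ (d - 1) < 2) :
    x < 2 := by
  by_contra hc
  push Not at hc
  have : x ^ 1 ≤ x ^ (d - 1) := pow_le_pow_right₀ (by linarith) (by omega)
  linarith

lemma big_step {d : ℕ} (hd : 1 < d) {lam z : ℂ} (h1 : ‖lam‖ ≤ ‖z‖) (h3 : 3 ≤ ‖z‖) :
    2 * ‖z‖ ≤ ‖fc d lam z‖ := by
  have e : ‖z‖ ^ 2 ≤ ‖z ^ d‖ := by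
    rw [norm_pow]; exact pow_le_pow_right₀ (by linarith) (by omega)
  have : ‖z ^ d‖ - ‖lam‖ ≤ ‖fc d lam z‖ := by
    have := norm_sub_norm_le (z ^ d) (-lam)
    simpa [fc] using this
  nlinarith [norm_nonneg z]

lemma big_orb {d : ℕ} (hd : 1 < d) {lam : ℂ} (h3 : 3 ≤ ‖lam‖) (k : ℕ) :
    2 ^ k * ‖lam‖ ≤ ‖orb d lam (k + 1)‖ := by
  induction k with
  | zero => simp [orb_one hd]
  | succ k ih =>
    have h5 : (1:ℝ) ≤ 2 ^ k := one_le_pow₀ (by norm_num)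
    have h6 : ‖lam‖ ≤ ‖orb d lam (k + 1)‖ := by nlinarith
    have := big_step hd h6 (h3.trans h6)
    rw [orb_succ, pow_succ]
    simp only [fc] at this
    linarith

/-- the general escape radius -/
lemma esc_general {d : ℕ} (hd : 1 < d) {lam z : ℂ} (h : 2 + ‖lam‖ ≤ ‖z‖) (k : ℕ) :
    2 ^ k * ‖z‖ ≤ ‖(fc d lam)^[k] z‖ := by
  induction k with
  | zero => simp
  | succ k ih =>
    rw [Function.iterate_succ_apply']
    set y := (fc d lam)^[k] z
    have h5 : (1:ℝ) ≤ 2 ^ k := one_le_pow₀ (by norm_num)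
    have h0 := norm_nonneg lam
    have h6 : 2 + ‖lam‖ ≤ ‖y‖ := by nlinarith
    have e : ‖y‖ ^ 2 ≤ ‖y ^ d‖ := by
      rw [norm_pow]; exact pow_le_pow_right₀ (by linarith) (by omega)
    have : ‖y ^ d‖ - ‖lam‖ ≤ ‖fc d lam y‖ := by
      have := norm_sub_norm_le (y ^ d) (-lam)
      simpa [fc] using this
    rw [pow_succ]
    nlinarith

/-! ### The potential -/

noncomputable def ell (d : ℕ) (lam : ℂ) (k : ℕ) : ℝ := (1 / 2) * Real.log (1 + ‖orb d lam k‖ ^ 2)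

noncomputable def C0 (d : ℕ) : ℝ := Real.log (21 * 2 ^ d)

lemma C0_pos (d : ℕ) : 0 < C0 d := by
  apply Real.log_pos
  have : (1:ℝ) ≤ 2 ^ d := one_le_pow₀ (by norm_num)
  linarith

lemma one_add_pow_le (d : ℕ) {t : ℝ} (ht : 0 ≤ t) : (1 + t) ^ d ≤ 2 ^ d * (1 + t ^ d) := by
  rcases le_total t 1 with h | h
  · calc (1 + t) ^ d ≤ 2 ^ d := by gcongr; linarith
      _ ≤ _ := by nlinarith [pow_nonneg ht d, pow_pos (show (0:ℝ) < 2 by norm_num) d]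
  · calc (1 + t) ^ d ≤ (2 * t) ^ d := by gcongr; linarith
      _ ≤ _ := by rw [mul_pow]; nlinarith [pow_nonneg ht d, pow_pos (show (0:ℝ) < 2 by norm_num) d]

lemma pow_le_one_add_pow {d : ℕ} (hd : 1 < d) {t : ℝ} (ht : 0 ≤ t) : 1 + t ^ d ≤ (1 + t) ^ d := by
  have := pow_add_pow_le (zero_le_one) ht (n := d) (by omega)
  simpa using this

lemma log_compare {d : ℕ} {a b : ℝ} (ha : 1 ≤ a) (hb : 1 ≤ b) (h1 : a ≤ 21 * 2 ^ d * b)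
    (h2 : b ≤ 21 * 2 ^ d * a) : |1 / 2 * Real.log a - 1 / 2 * Real.log b| ≤ C0 d := by
  have hc : (0:ℝ) < 21 * 2 ^ d := by positivity
  have h3 : Real.log a ≤ C0 d + Real.log b := by
    rw [C0, ← Real.log_mul hc.ne' (by positivity)]
    exact Real.log_le_log (by positivity) h1
  have h4 : Real.log b ≤ C0 d + Real.log a := by
    rw [C0, ← Real.log_mul hc.ne' (by positivity)]
    exact Real.log_le_log (by positivity) h2
  have := C0_pos d
  rw [abs_le]; constructor <;> linarith

lemma ell_step {d : ℕ} (hd : 1 < d) (lam : ℂ) {k : ℕ} (hk : 1 ≤ k) :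
    |ell d lam (k + 1) - d * ell d lam k| ≤ C0 d := by
  set z := orb d lam k with hz
  set w := orb d lam (k + 1) with hw
  have hwz : w = z ^ d + lam := orb_succ d lam k
  have e : ell d lam (k + 1) - d * ell d lam k =
      1 / 2 * Real.log (1 + ‖w‖ ^ 2) - 1 / 2 * Real.log ((1 + ‖z‖ ^ 2) ^ d) := by
    rw [Real.log_pow]; simp only [ell, ← hz, ← hw]; ring
  rw [e]
  have hA : (1:ℝ) ≤ 2 ^ d := one_le_pow₀ (by norm_num)
  have u1 := one_add_pow_le d (sq_nonneg ‖z‖)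
  have u2 := pow_le_one_add_pow hd (sq_nonneg ‖z‖)
  have e2 : (‖z‖ ^ 2) ^ d = ‖z ^ d‖ ^ 2 := by rw [norm_pow]; ring
  rw [e2] at u1 u2
  have t1 : ‖w‖ ≤ ‖z ^ d‖ + ‖lam‖ := by rw [hwz]; exact norm_add_le _ _
  have t2 : ‖z ^ d‖ ≤ ‖w‖ + ‖lam‖ := by
    have := norm_sub_le w lam
    rwa [hwz, add_sub_cancel_right, ← hwz] at this
  have n1 := norm_nonneg w
  have n2 := norm_nonneg (z ^ d)
  have n3 := norm_nonneg lam
  have key : 1 + ‖w‖ ^ 2 ≤ 21 * (1 + ‖z ^ d‖ ^ 2) ∧ 1 + ‖z ^ d‖ ^ 2 ≤ 21 * (1 + ‖w‖ ^ 2) := by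
    rcases le_total ‖lam‖ 3 with h3 | h3
    · constructor
      · nlinarith [sq_nonneg (‖z ^ d‖ - ‖lam‖)]
      · nlinarith [sq_nonneg (‖w‖ - ‖lam‖)]
    · have hb : ‖lam‖ ≤ ‖z‖ := by
        have := big_orb hd h3 (k - 1)
        rw [Nat.sub_add_cancel hk] at this
        have h5 : (1:ℝ) ≤ 2 ^ (k - 1) := one_le_pow₀ (by norm_num)
        nlinarith
      have h6 : 3 * ‖lam‖ ≤ ‖z ^ d‖ := by
        have : ‖z‖ ^ 2 ≤ ‖z ^ d‖ := by
          rw [norm_pow]; exact pow_le_pow_right₀ (by linarith) (by omega)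
        nlinarith
      constructor
      · nlinarith
      · nlinarith
  have h1 : (1:ℝ) ≤ (1 + ‖z‖ ^ 2) ^ d := one_le_pow₀ (by nlinarith [sq_nonneg ‖z‖])
  apply log_compare (by nlinarith [sq_nonneg ‖w‖]) h1
  · nlinarith [sq_nonneg ‖z‖, key.1]
  · nlinarith [key.2]

lemma ell_iter {d : ℕ} (hd : 1 < d) (lam : ℂ) {k : ℕ} (hk : 1 ≤ k) (j : ℕ) :
    |ell d lam (k + j) - d ^ j * ell d lam k| ≤ C0 d * (d ^ j - 1) := by
  induction j with
  | zero => simp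
  | succ j ih =>
    have h1 := ell_step hd lam (k := k + j) (by omega)
    have h2 : (2:ℝ) ≤ d := by exact_mod_cast hd
    have h0 := C0_pos d
    have e : ell d lam (k + (j + 1)) - d ^ (j + 1) * ell d lam k =
      (ell d lam (k + j + 1) - d * ell d lam (k + j)) +
        d * (ell d lam (k + j) - d ^ j * ell d lam k) := by
      rw [← add_assoc]; ring
    rw [e]
    refine (abs_add_le _ _).trans ?_
    rw [abs_mul, Nat.abs_cast]
    have h3 : (d:ℝ) * |ell d lam (k + j) - d ^ j * ell d lam k| ≤ d * (C0 d * (d ^ j - 1)) := by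
      gcongr
    rw [pow_succ]
    nlinarith

/-- the hypothesis on `gI` -/
def IsGreen (d : ℕ) (gI : ℂ → ℝ) : Prop := ∀ lam : ℂ, Filter.Tendsto
      (fun k : ℕ => (1 / 2) * Real.log (1 + ‖(fc d lam)^[k] 0‖ ^ 2) / (d : ℝ) ^ (k - 1))
      Filter.atTop (nhds (gI lam))

lemma IsGreen.ell_sub {d : ℕ} (hd : 1 < d) {gI : ℂ → ℝ} (hg : IsGreen d gI) (lam : ℂ) {k : ℕ}
    (hk : 1 ≤ k) : |ell d lam k - d ^ (k - 1) * gI lam| ≤ C0 d := by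
  have hd0 : (0:ℝ) < d := by exact_mod_cast (by omega : 0 < d)
  have h1 : Filter.Tendsto (fun j : ℕ => |ell d lam k -
      d ^ (k - 1) * ((1 / 2) * Real.log (1 + ‖(fc d lam)^[j + k] 0‖ ^ 2) / (d : ℝ) ^ (j + k - 1))|)
      Filter.atTop (nhds |ell d lam k - d ^ (k - 1) * gI lam|) := by
    apply Filter.Tendsto.abs
    apply Filter.Tendsto.sub tendsto_const_nhds
    apply Filter.Tendsto.const_mul
    exact (Filter.tendsto_add_atTop_iff_nat k).2 (hg lam)
  refine le_of_tendsto h1 (Filter.Eventually.of_forall fun j => ?_)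
  have h2 := ell_iter hd lam hk j
  have h3 : ell d lam k - d ^ (k - 1) * ((1 / 2) * Real.log (1 + ‖(fc d lam)^[j + k] 0‖ ^ 2) /
      (d : ℝ) ^ (j + k - 1)) = - (ell d lam (k + j) - d ^ j * ell d lam k) / d ^ j := by
    have e1 : (1 / 2) * Real.log (1 + ‖(fc d lam)^[j + k] 0‖ ^ 2) = ell d lam (k + j) := by
      rw [add_comm j k]; rfl
    have e2 : (d:ℝ) ^ (j + k - 1) = d ^ j * d ^ (k - 1) := by
      rw [← pow_add]; congr 1; omega
    rw [e1, e2]; field_simp; ring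
  rw [h3, abs_div, abs_neg, abs_of_pos (pow_pos hd0 j), div_le_iff₀ (pow_pos hd0 j)]
  nlinarith [C0_pos d]

lemma ell_nonneg (d : ℕ) (lam : ℂ) (k : ℕ) : 0 ≤ ell d lam k := by
  unfold ell
  have : 0 ≤ Real.log (1 + ‖orb d lam k‖ ^ 2) := Real.log_nonneg (by nlinarith [sq_nonneg ‖orb d lam k‖])
  linarith

lemma IsGreen.nonneg {d : ℕ} {gI : ℂ → ℝ} (hg : IsGreen d gI) (lam : ℂ) :
    0 ≤ gI lam := by
  refine ge_of_tendsto (hg lam) (Filter.Eventually.of_forall fun k => ?_)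
  have := ell_nonneg d lam k
  simp only [ell, orb] at this
  positivity

lemma orb_continuous (d k : ℕ) : Continuous fun lam => orb d lam k := by
  induction k with
  | zero => simp only [orb_zero]; exact continuous_const
  | succ k ih => simp only [orb_succ]; fun_prop

lemma ell_continuous (d k : ℕ) : Continuous fun lam => ell d lam k := by
  unfold ell
  have := orb_continuous d k
  apply Continuous.mul continuous_const
  apply Continuous.log (by fun_prop)
  intro x
  positivity

lemma IsGreen.continuous {d : ℕ} (hd : 1 < d) {gI : ℂ → ℝ} (hg : IsGreen d gI) :
    Continuous gI := by
  have hd0 : (0:ℝ) < d := by exact_mod_cast (by omega : 0 < d)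
  have hd1 : (1:ℝ) < d := by exact_mod_cast hd
  have : TendstoUniformly (fun (k : ℕ) lam => ell d lam (k + 1) / (d:ℝ) ^ k) gI Filter.atTop := by
    rw [Metric.tendstoUniformly_iff]
    intro ε hε
    have h1 : Filter.Tendsto (fun k : ℕ => C0 d * ((d:ℝ)⁻¹) ^ k) Filter.atTop (nhds (C0 d * 0)) :=
      (tendsto_pow_atTop_nhds_zero_of_lt_one (by positivity) (inv_lt_one_of_one_lt₀ hd1)).const_mul _
    rw [mul_zero] at h1
    filter_upwards [h1.eventually (gt_mem_nhds hε)] with k hk lam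
    rw [dist_comm, Real.dist_eq]
    have h2 := hg.ell_sub hd lam (k := k + 1) (by omega)
    rw [Nat.add_sub_cancel] at h2
    have h3 : ell d lam (k + 1) / (d:ℝ) ^ k - gI lam =
       (ell d lam (k + 1) - d ^ k * gI lam) / d ^ k := by field_simp
    rw [h3, abs_div, abs_of_pos (pow_pos hd0 k)]
    refine lt_of_le_of_lt ?_ hk
    rw [inv_pow, ← div_eq_mul_inv]
    gcongr
  refine this.continuous (Filter.Frequently.of_forall fun k => ?_)
  exact (ell_continuous d (k + 1)).div_const _

lemma IsGreen.le {d : ℕ} (hd : 1 < d) {gI : ℂ → ℝ} (hg : IsGreen d gI) (lam : ℂ) :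
    gI lam ≤ 1 / 2 * Real.log (1 + ‖lam‖ ^ 2) + C0 d := by
  have := hg.ell_sub hd lam (k := 1) le_rfl
  simp only [ell, orb_one hd] at this
  rw [abs_le] at this
  simp at this
  linarith [this.1]

lemma IsGreen.ge {d : ℕ} (hd : 1 < d) {gI : ℂ → ℝ} (hg : IsGreen d gI) (lam : ℂ) :
    1 / 2 * Real.log (1 + ‖lam‖ ^ 2) - C0 d ≤ gI lam := by
  have := hg.ell_sub hd lam (k := 1) le_rfl
  simp only [ell, orb_one hd] at this
  rw [abs_le] at this
  simp at this
  linarith [this.2]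

lemma IsGreen.eq_zero {d : ℕ} (hd : 1 < d) {gI : ℂ → ℝ} (hg : IsGreen d gI) {lam : ℂ}
    {R : ℝ} (hb : ∀ k, ‖orb d lam k‖ ≤ R) : gI lam = 0 := by
  have hd0 : (0:ℝ) < d := by exact_mod_cast (by omega : 0 < d)
  have hd1 : (1:ℝ) < d := by exact_mod_cast hd
  refine tendsto_nhds_unique (hg lam) ?_
  rw [← Filter.tendsto_add_atTop_iff_nat 1]
  have h1 : Filter.Tendsto (fun k : ℕ => (1/2 * Real.log (1 + R ^ 2)) * ((d:ℝ)⁻¹) ^ k) Filter.atTop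
     (nhds ((1/2 * Real.log (1 + R ^ 2)) * 0)) :=
      (tendsto_pow_atTop_nhds_zero_of_lt_one (by positivity) (inv_lt_one_of_one_lt₀ hd1)).const_mul _
  rw [mul_zero] at h1
  refine squeeze_zero (fun k => ?_) (fun k => ?_) h1
  · have := ell_nonneg d lam (k + 1)
    simp only [ell, orb] at this
    positivity
  · rw [inv_pow, ← div_eq_mul_inv, Nat.add_sub_cancel]
    have := hb (k + 1)
    simp only [orb] at this
    gcongr

lemma IsGreen.unbounded {d : ℕ} (hd : 1 < d) {gI : ℂ → ℝ} (hg : IsGreen d gI) {lam : ℂ}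
    (h : gI lam ≠ 0) (R : ℝ) : ∃ k, R < ‖orb d lam k‖ := by
  by_contra hc
  push Not at hc
  exact h (hg.eq_zero hd hc)




/-! ### The integral of a Laplacian -/

lemma lap_eq (φ : ℂ → ℝ) (hφ : ContDiff ℝ 2 φ) (z : ℂ) :
    lap φ z = fderiv ℝ (fun x => fderiv ℝ φ x 1) z 1 +
      fderiv ℝ (fun x => fderiv ℝ φ x Complex.I) z Complex.I := by
  have h : Differentiable ℝ (fderiv ℝ φ) :=
    (hφ.fderiv_right (m := 1) (by norm_num)).differentiable (by norm_num)
  have key : ∀ v : ℂ, fderiv ℝ (fun x => fderiv ℝ φ x v) z = (fderiv ℝ (fderiv ℝ φ) z).flip v := by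
    intro v
    rw [fderiv_clm_apply (h z) (differentiableAt_const v)]
    ext; simp
  rw [lap, iteratedFDeriv_two_apply, iteratedFDeriv_two_apply, key, key]
  simp

lemma lap_continuous (φ : ℂ → ℝ) (hφ : ContDiff ℝ 2 φ) : Continuous (lap φ) := by
  have h := hφ.continuous_iteratedFDeriv (m := 2) (by norm_num)
  unfold lap
  fun_prop

lemma ibp_dir (χ ψ : ℂ → ℝ) (hχ : ContDiff ℝ 2 χ) (hψ : ContDiff ℝ 2 ψ) (hc : HasCompactSupport χ)
    (v : ℂ) : ∫ x, χ x * fderiv ℝ (fun y => fderiv ℝ ψ y v) x v =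
      ∫ x, fderiv ℝ (fun y => fderiv ℝ χ y v) x v * ψ x := by
  have h1 : ContDiff ℝ 1 (fun y => fderiv ℝ ψ y v) :=
    (hψ.fderiv_right (m := 1) (by norm_num)).clm_apply contDiff_const
  have h2 : ContDiff ℝ 1 (fun y => fderiv ℝ χ y v) :=
    (hχ.fderiv_right (m := 1) (by norm_num)).clm_apply contDiff_const
  have c1 : Continuous (fun x => fderiv ℝ (fun y => fderiv ℝ ψ y v) x v) :=
    (h1.continuous_fderiv (by norm_num)).clm_apply continuous_const
  have c2 : Continuous (fun x => fderiv ℝ (fun y => fderiv ℝ χ y v) x v) :=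
    (h2.continuous_fderiv (by norm_num)).clm_apply continuous_const
  have s2 : HasCompactSupport (fun y => fderiv ℝ χ y v) := hc.fderiv_apply (𝕜 := ℝ) v
  have s3 : HasCompactSupport (fun x => fderiv ℝ (fun y => fderiv ℝ χ y v) x v) :=
    s2.fderiv_apply (𝕜 := ℝ) v
  have i1 : Integrable (fun x => fderiv ℝ χ x v * fderiv ℝ ψ x v) :=
    (h2.continuous.mul h1.continuous).integrable_of_hasCompactSupport s2.mul_right
  rw [integral_mul_fderiv_eq_neg_fderiv_mul_of_integrable i1
    ((hχ.continuous.mul c1).integrable_of_hasCompactSupport hc.mul_right)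
    ((hχ.continuous.mul h1.continuous).integrable_of_hasCompactSupport hc.mul_right)
    (fun x _ => hχ.differentiable (by norm_num) x) (fun x _ => h1.differentiable (by norm_num) x)]
  rw [integral_mul_fderiv_eq_neg_fderiv_mul_of_integrable
    ((c2.mul hψ.continuous).integrable_of_hasCompactSupport s3.mul_right) i1
    ((h2.continuous.mul hψ.continuous).integrable_of_hasCompactSupport s2.mul_right)
    (fun x _ => h2.differentiable (by norm_num) x) (fun x _ => hψ.differentiable (by norm_num) x)]
  simp

lemma green_lap (χ ψ : ℂ → ℝ) (hχ : ContDiff ℝ 2 χ) (hψ : ContDiff ℝ 2 ψ)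
    (hc : HasCompactSupport χ) : ∫ x, χ x * lap ψ x = ∫ x, lap χ x * ψ x := by
  have key : ∀ v : ℂ, Integrable (fun x => χ x * fderiv ℝ (fun y => fderiv ℝ ψ y v) x v) ∧
      Integrable (fun x => fderiv ℝ (fun y => fderiv ℝ χ y v) x v * ψ x) := by
    intro v
    have h1 : ContDiff ℝ 1 (fun y => fderiv ℝ ψ y v) :=
      (hψ.fderiv_right (m := 1) (by norm_num)).clm_apply contDiff_const
    have h2 : ContDiff ℝ 1 (fun y => fderiv ℝ χ y v) :=
      (hχ.fderiv_right (m := 1) (by norm_num)).clm_apply contDiff_const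
    have c1 : Continuous (fun x => fderiv ℝ (fun y => fderiv ℝ ψ y v) x v) :=
      (h1.continuous_fderiv (by norm_num)).clm_apply continuous_const
    have c2 : Continuous (fun x => fderiv ℝ (fun y => fderiv ℝ χ y v) x v) :=
      (h2.continuous_fderiv (by norm_num)).clm_apply continuous_const
    have s2 : HasCompactSupport (fun y => fderiv ℝ χ y v) := hc.fderiv_apply (𝕜 := ℝ) v
    have s3 : HasCompactSupport (fun x => fderiv ℝ (fun y => fderiv ℝ χ y v) x v) :=
      s2.fderiv_apply (𝕜 := ℝ) v
    exact ⟨(hχ.continuous.mul c1).integrable_of_hasCompactSupport hc.mul_right,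
      (c2.mul hψ.continuous).integrable_of_hasCompactSupport s3.mul_right⟩
  simp only [lap_eq ψ hψ, lap_eq χ hχ, mul_add, add_mul]
  rw [integral_add (key 1).1 (key Complex.I).1, integral_add (key 1).2 (key Complex.I).2,
    ibp_dir χ ψ hχ hψ hc, ibp_dir χ ψ hχ hψ hc]

lemma lap_scale (φ : ℂ → ℝ) (hφ : ContDiff ℝ 2 φ) (R : ℝ) (z : ℂ) :
    lap (fun x => φ (R • x)) z = R ^ 2 * lap φ (R • z) := by
  unfold lap
  rw [iteratedFDeriv_comp_const_smul R hφ]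
  simp [mul_add]

lemma lap_sub_const (φ : ℂ → ℝ) (hφ : ContDiff ℝ 2 φ) (c : ℝ) (z : ℂ) :
    lap (fun x => φ x - c) z = lap φ z := by
  rw [lap_eq φ hφ, lap_eq _ (hφ.sub contDiff_const)]
  simp [fderiv_sub_const]

lemma integral_lap_zero (φ : ℂ → ℝ) (c : ℝ) (hφ : ContDiff ℝ 2 φ)
    (hinf : Filter.Tendsto φ (Filter.cocompact ℂ) (nhds c)) (hIntg : Integrable (lap φ)) :
    ∫ z, lap φ z = 0 := by
  let b : ContDiffBump (0 : ℂ) := ⟨1, 2, by norm_num, by norm_num⟩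
  have hb : ContDiff ℝ 2 (b : ℂ → ℝ) := b.contDiff
  have hbc : HasCompactSupport (b : ℂ → ℝ) := b.hasCompactSupport
  have hR0 : ∀ n : ℕ, (0:ℝ) < (n:ℝ) + 1 := fun n => by positivity
  have hRtop : Filter.Tendsto (fun n : ℕ => (n:ℝ) + 1) Filter.atTop Filter.atTop :=
    Filter.tendsto_atTop_add_const_right _ _ tendsto_natCast_atTop_atTop
  have e : ∀ n : ℕ, ∫ x, b (((n:ℝ) + 1)⁻¹ • x) * lap φ x =
      ∫ x, lap b x * (φ (((n:ℝ) + 1) • x) - c) := by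
    intro n
    set R : ℝ := (n:ℝ) + 1
    have hR := hR0 n
    have h2 : ContDiff ℝ 2 (fun x => φ (R • x) - c) :=
      (hφ.comp (contDiff_const_smul R)).sub contDiff_const
    rw [← green_lap b _ hb h2 hbc]
    have h3 : ∀ x, lap (fun x => φ (R • x) - c) x = R ^ 2 * lap φ (R • x) := by
      intro x
      rw [lap_sub_const (fun x => φ (R • x)) (hφ.comp (contDiff_const_smul R)), lap_scale φ hφ]
    simp only [h3]
    have h4 := Measure.integral_comp_smul_of_nonneg volume
      (fun x => b (R⁻¹ • x) * lap φ x) R (hR := hR.le)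
    rw [Complex.finrank_real_complex, smul_eq_mul] at h4
    have h5 : ∫ x, b (R⁻¹ • x) * lap φ x =
      R ^ 2 * ∫ x : ℂ, b (R⁻¹ • R • x) * lap φ (R • x) := by
      rw [h4, ← mul_assoc, mul_inv_cancel₀ (pow_ne_zero 2 (hR0 n).ne'), one_mul]
    rw [h5, ← integral_const_mul]
    congr 1; ext x
    rw [smul_smul, inv_mul_cancel₀ hR.ne', one_smul]; ring
  have l1 : Filter.Tendsto (fun n : ℕ => ∫ x, b (((n:ℝ) + 1)⁻¹ • x) * lap φ x) Filter.atTop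
      (nhds (∫ x, lap φ x)) := by
    refine tendsto_integral_of_dominated_convergence (fun x => |lap φ x|) (fun n => ?_) hIntg.abs
      (fun n => ?_) ?_
    · have := lap_continuous φ hφ
      have h2 := hb.continuous
      apply Continuous.aestronglyMeasurable
      exact (h2.comp (continuous_const_smul _)).mul this
    · refine Filter.Eventually.of_forall fun x => ?_
      rw [norm_mul, Real.norm_eq_abs, Real.norm_eq_abs]
      have h1 : |b (((n:ℝ) + 1)⁻¹ • x)| ≤ 1 := by
        rw [abs_of_nonneg b.nonneg]; exact b.le_one
      nlinarith [abs_nonneg (lap φ x)]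
    · refine Filter.Eventually.of_forall fun x => ?_
      apply tendsto_const_nhds.congr'
      filter_upwards [hRtop.eventually (Filter.eventually_ge_atTop ‖x‖)] with n hn
      rw [b.one_of_mem_closedBall, one_mul]
      rw [mem_closedBall_zero_iff, norm_smul, norm_inv, Real.norm_eq_abs, abs_of_pos (hR0 n)]
      rw [inv_mul_le_iff₀ (hR0 n)]
      simpa [b] using hn
  obtain ⟨M, hM⟩ : ∃ M, ∀ x, |φ x - c| ≤ M := by
    have h1 : Filter.Tendsto (fun x => |φ x - c|) (Filter.cocompact ℂ) (nhds 0) := by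
      have := (hinf.sub_const c).abs
      simpa using this
    have h2 := h1.eventually (gt_mem_nhds (zero_lt_one))
    obtain ⟨s, hs, hs2⟩ := Filter.mem_cocompact.1 h2
    obtain ⟨M, hM⟩ := hs.exists_bound_of_continuousOn (f := fun x => φ x - c)
      (hφ.continuous.sub continuous_const).continuousOn
    refine ⟨max M 1, fun x => ?_⟩
    by_cases hx : x ∈ s
    · exact (hM x hx).trans (le_max_left _ _)
    · have : |φ x - c| < 1 := hs2 hx
      exact this.le.trans (le_max_right _ _)
  have l2 : Filter.Tendsto (fun n : ℕ => ∫ x, lap b x * (φ (((n:ℝ) + 1) • x) - c)) Filter.atTop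
      (nhds (∫ x : ℂ, (0:ℝ))) := by
    have hs : HasCompactSupport (lap b) := by
      have h := hbc.iteratedFDeriv (𝕜 := ℝ) 2
      refine h.mono' ?_
      refine subset_trans ?_ (subset_tsupport _)
      intro x hx hx2
      apply hx
      simp only [lap, hx2]; simp
    have hli : Integrable (lap b) := (lap_continuous b hb).integrable_of_hasCompactSupport hs
    refine tendsto_integral_of_dominated_convergence (fun x => |lap b x| * M) (fun n => ?_)
      (hli.abs.mul_const M) (fun n => ?_) ?_
    · have := lap_continuous b hb
      have h2 := hφ.continuous
      apply Continuous.aestronglyMeasurable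
      exact this.mul ((h2.comp (continuous_const_smul _)).sub continuous_const)
    · refine Filter.Eventually.of_forall fun x => ?_
      rw [norm_mul, Real.norm_eq_abs, Real.norm_eq_abs]
      have := hM (((n:ℝ) + 1) • x)
      gcongr
    · have : ∀ᵐ x : ℂ, x ≠ 0 := by simp [ae_iff, measure_singleton]
      filter_upwards [this] with x hx
      have h3 : Filter.Tendsto (fun n : ℕ => ((n:ℝ) + 1) • x) Filter.atTop (Filter.cocompact ℂ) := by
        rw [← Metric.cobounded_eq_cocompact, ← tendsto_norm_atTop_iff_cobounded]
        simp only [norm_smul]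
        apply Filter.Tendsto.atTop_mul_const (norm_pos_iff.2 hx)
        exact tendsto_norm_atTop_atTop.comp hRtop
      have := ((hinf.comp h3).sub_const c).const_mul (lap b x)
      simpa using this
  simp only [← e] at l2
  have := tendsto_nhds_unique l1 l2
  simpa using this

/-- a `C²` function on the sphere tends to its value at infinity -/
lemma tendsto_inf_of_contDiffAt (φ : ℂ → ℝ) (c : ℝ)
    (h : ContDiffAt ℝ 2 (fun w : ℂ => if w = 0 then c else φ w⁻¹) 0) :
    Filter.Tendsto φ (Filter.cocompact ℂ) (nhds c) := by
  have h1 := h.continuousAt.tendsto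
  simp only [if_true] at h1
  have h2 : Filter.Tendsto (fun w : ℂ => w⁻¹) (Filter.cocompact ℂ) (nhds 0) := by
    rw [← Metric.cobounded_eq_cocompact]
    exact Filter.tendsto_inv₀_cobounded
  have h3 := h1.comp h2
  refine h3.congr' ?_
  have h4 : ∀ᶠ x in Filter.cocompact ℂ, x ≠ 0 := by
    have := (isCompact_singleton (x := (0:ℂ))).compl_mem_cocompact
    filter_upwards [this] with x hx using hx
  filter_upwards [h4] with x hx
  simp [hx]



/-! ### Fatou: no attracting cycles when the critical orbit is unbounded -/

lemma fc_iter_differentiable (d : ℕ) (lam : ℂ) (k : ℕ) : Differentiable ℂ ((fc d lam)^[k]) := by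
  have : Differentiable ℂ (fc d lam) := by unfold fc; fun_prop
  exact this.iterate k

lemma exists_root_lift {z : ℂ} {δ : ℝ} (hδ : 0 < δ) {h : ℂ → ℂ}
    (hh : DifferentiableOn ℂ h (Metric.ball z δ)) (h0 : ∀ x ∈ Metric.ball z δ, h x ≠ 0) {d : ℕ}
    (hd : 0 < d) {y : ℂ} (hy : y ^ d = h z) :
    ∃ g : ℂ → ℂ, DifferentiableOn ℂ g (Metric.ball z δ) ∧ g z = y ∧
      ∀ x ∈ Metric.ball z δ, g x ^ d = h x := by
  have hz : z ∈ Metric.ball z δ := Metric.mem_ball_self hδ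
  have hdh : DifferentiableOn ℂ (fun x => deriv h x / h x) (Metric.ball z δ) :=
    (hh.deriv Metric.isOpen_ball).div hh h0
  obtain ⟨p, hp⟩ := hdh.isExactOn_ball
  have hp' : ∀ x ∈ Metric.ball z δ, HasDerivAt p (deriv h x / h x) x := fun x hx => hp x hx
  have hpd : DifferentiableOn ℂ p (Metric.ball z δ) :=
    fun x hx => (hp' x hx).differentiableAt.differentiableWithinAt
  have hconst : ∀ x ∈ Metric.ball z δ, h x * Complex.exp (-p x) = h z * Complex.exp (-p z) := by
    intro x hx
    have hG : ∀ x ∈ Metric.ball z δ, HasDerivAt (fun x => h x * Complex.exp (-p x)) 0 x := by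
      intro x hx
      have h1 : HasDerivAt h (deriv h x) x :=
        ((hh x hx).differentiableAt (Metric.isOpen_ball.mem_nhds hx)).hasDerivAt
      have h2 := h1.mul (hp' x hx).neg.cexp
      refine h2.congr_deriv ?_
      have h3 : h x * (deriv h x / h x) = deriv h x := mul_div_cancel₀ _ (h0 x hx)
      linear_combination -Complex.exp (-p x) * h3
    refine IsOpen.is_const_of_deriv_eq_zero (f := fun x => h x * Complex.exp (-p x))
      Metric.isOpen_ball (convex_ball z δ).isPreconnected ?_ ?_ hx hz
    · exact fun x hx => (hG x hx).differentiableAt.differentiableWithinAt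
    · exact fun x hx => (hG x hx).deriv
  refine ⟨fun x => y * Complex.exp ((p x - p z) / d), ?_, by simp, ?_⟩
  · fun_prop
  · intro x hx
    have hd' : (d : ℂ) ≠ 0 := by exact_mod_cast hd.ne'
    rw [mul_pow, hy, ← Complex.exp_nat_mul, mul_div_cancel₀ _ hd']
    have := hconst x hx
    have e1 : Complex.exp (p x - p z) = Complex.exp (p x) * Complex.exp (-p z) := by
      rw [← Complex.exp_add]; ring_nf
    have e2 : Complex.exp (p x) * Complex.exp (-p x) = 1 := by
      rw [← Complex.exp_add]; simp
    rw [e1]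
    calc h z * (Complex.exp (p x) * Complex.exp (-p z))
        = Complex.exp (p x) * (h z * Complex.exp (-p z)) := by ring
      _ = Complex.exp (p x) * (h x * Complex.exp (-p x)) := by rw [this]
      _ = h x * (Complex.exp (p x) * Complex.exp (-p x)) := by ring
      _ = h x := by rw [e2, mul_one]

lemma exists_backward {d : ℕ} (hd : 1 < d) {lam z : ℂ} {δ : ℝ} (hδ : 0 < δ)
    (horb : ∀ j, orb d lam j ∉ Metric.ball z δ) (y : ℕ → ℂ) (hy0 : y 0 = z)
    (hy : ∀ k, fc d lam (y (k + 1)) = y k) (k : ℕ) :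
    ∃ g : ℂ → ℂ, DifferentiableOn ℂ g (Metric.ball z δ) ∧ g z = y k ∧
      ∀ x ∈ Metric.ball z δ, (fc d lam)^[k] (g x) = x := by
  induction k with
  | zero => exact ⟨id, differentiableOn_id, hy0.symm, fun x _ => rfl⟩
  | succ k ih =>
    obtain ⟨g, hg, hgz, hgx⟩ := ih
    have h0 : ∀ x ∈ Metric.ball z δ, g x - lam ≠ 0 := by
      intro x hx hc
      have h1 : g x = lam := sub_eq_zero.1 hc
      have h2 := hgx x hx
      have h3 := orb_add d lam k 1
      rw [h1] at h2
      rw [orb_one hd, h2] at h3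
      exact horb (k + 1) (h3 ▸ hx)
    obtain ⟨g', hg', hgz', hgx'⟩ := exists_root_lift hδ (hg.sub_const lam) h0
      (by omega : 0 < d) (y := y (k + 1)) (by
        have := hy k
        simp only [fc] at this
        rw [hgz, ← this]; ring)
    refine ⟨g', hg', hgz', fun x hx => ?_⟩
    rw [Function.iterate_succ_apply]
    have : fc d lam (g' x) = g x := by
      simp only [fc, hgx' x hx]; ring
    rw [this, hgx x hx]

theorem fatou {d : ℕ} (hd : 1 < d) {lam z : ℂ} {n : ℕ} (hn : 1 ≤ n)
    (hz : (fc d lam)^[n] z = z) (hub : ∀ R : ℝ, ∃ k, R < ‖orb d lam k‖) :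
    1 ≤ ‖deriv ((fc d lam)^[n]) z‖ := by
  by_contra hlt
  push Not at hlt
  set w := deriv ((fc d lam)^[n]) z with hw
  have hder : HasDerivAt ((fc d lam)^[n]) w z := (fc_iter_differentiable d lam n z).hasDerivAt
  obtain ⟨δ, hδ, hmap⟩ : ∃ δ > 0, ∀ x ∈ Metric.ball z δ, (fc d lam)^[n] x ∈ Metric.ball z δ := by
    have h1 := (hasDerivAt_iff_isLittleO.1 hder).bound (show 0 < 1 - ‖w‖ by linarith)
    rw [Metric.eventually_nhds_iff_ball] at h1
    obtain ⟨δ, hδ, h2⟩ := h1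
    refine ⟨δ, hδ, fun x hx => ?_⟩
    have h3 := h2 x hx
    rw [hz] at h3
    rw [Metric.mem_ball, dist_eq_norm] at hx ⊢
    have h4 : (fc d lam)^[n] x - z = ((fc d lam)^[n] x - z - (x - z) • w) + (x - z) * w := by
      simp
    rw [h4]
    refine lt_of_le_of_lt (norm_add_le _ _) ?_
    rw [norm_mul]
    nlinarith [norm_nonneg (x - z)]
  have hiter : ∀ k, ∀ x ∈ Metric.ball z δ, (fc d lam)^[n * k] x ∈ Metric.ball z δ := by
    intro k
    induction k with
    | zero => intro x hx; simpa using hx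
    | succ k ih =>
      intro x hx
      rw [Nat.mul_succ, Function.iterate_add_apply]
      exact ih _ (hmap x hx)
  have hnb : ∀ x ∈ Metric.ball z δ, ‖x‖ < ‖z‖ + δ := by
    intro x hx
    rw [Metric.mem_ball, dist_eq_norm] at hx
    have := norm_add_le (x - z) z
    simp only [sub_add_cancel] at this
    linarith
  have horb : ∀ j, orb d lam j ∉ Metric.ball z δ := by
    intro j hj
    obtain ⟨i, hi⟩ := hub (max (2 + ‖lam‖) (‖z‖ + δ))
    have h1 := hnb _ (hiter i _ hj)
    rw [← orb_add] at h1
    have h2 : i ≤ n * i + j := by nlinarith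
    obtain ⟨l, hl⟩ := Nat.exists_eq_add_of_le h2
    rw [hl, add_comm i l, orb_add] at h1
    have h3 := esc_general hd (le_of_lt (lt_of_le_of_lt (le_max_left _ _) hi)) l
    have h4 := lt_of_le_of_lt (le_max_right _ _) hi
    have h5 : (1:ℝ) ≤ 2 ^ l := one_le_pow₀ (by norm_num)
    nlinarith [norm_nonneg (orb d lam i)]
  have hper : ∀ k, (fc d lam)^[n * k] z = z := by
    intro k
    rw [Function.iterate_mul]
    exact Function.iterate_fixed hz k
  have hback := exists_backward hd hδ horb (fun k => (fc d lam)^[(n - 1) * k] z) (by simp) (by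
    intro k
    rw [← Function.iterate_succ_apply' (fc d lam)]
    have : ((n - 1) * (k + 1)).succ = (n - 1) * k + n := by
      have : n = (n - 1) + 1 := by omega
      rw [Nat.mul_succ]; omega
    rw [this, Function.iterate_add_apply, hz])
  set R := 2 + ‖lam‖ + ‖z‖ + δ with hR
  have main : ∀ j : ℕ, 1 ≤ ‖w‖ ^ j * (R / (δ / 2)) := by
    intro j
    obtain ⟨g, hg, hgz, hgx⟩ := hback (n * j)
    have hgz' : g z = z := by
      rw [hgz, show (n - 1) * (n * j) = n * ((n - 1) * j) by ring, hper]
    have hgR : ∀ x ∈ Metric.ball z δ, ‖g x‖ ≤ R := by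
      intro x hx
      by_contra hc
      push Not at hc
      have h1 := esc_general hd (lam := lam) (z := g x)
        (by have := norm_nonneg z; linarith) (n * j)
      rw [hgx x hx] at h1
      have h2 := hnb x hx
      have h5 : (1:ℝ) ≤ 2 ^ (n * j) := one_le_pow₀ (by norm_num)
      have := norm_nonneg lam
      have h6 : 1 * ‖g x‖ ≤ 2 ^ (n * j) * ‖g x‖ := by gcongr
      linarith
    have hzb : z ∈ Metric.ball z δ := Metric.mem_ball_self hδ
    have hgd : HasDerivAt g (deriv g z) z :=
      ((hg z hzb).differentiableAt (Metric.isOpen_ball.mem_nhds hzb)).hasDerivAt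
    have h1 : HasDerivAt ((fc d lam)^[n * j]) (w ^ j) (g z) := by
      rw [hgz', Function.iterate_mul]
      exact HasDerivAt.iterate z hder hz j
    have h2 : HasDerivAt (fun x => (fc d lam)^[n * j] (g x)) (w ^ j * deriv g z) z := h1.comp z hgd
    have h3 : HasDerivAt (fun x => (fc d lam)^[n * j] (g x)) 1 z := by
      refine (hasDerivAt_id z).congr_of_eventuallyEq ?_
      filter_upwards [Metric.isOpen_ball.mem_nhds hzb] with x hx
      exact hgx x hx
    have h4 := h2.unique h3
    have hsub : Metric.closedBall z (δ / 2) ⊆ Metric.ball z δ :=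
      Metric.closedBall_subset_ball (by linarith)
    have h5 : ‖deriv g z‖ ≤ R / (δ / 2) := by
      refine Complex.norm_deriv_le_of_forall_mem_sphere_norm_le (by linarith) ?_ ?_
      · apply DifferentiableOn.diffContOnCl
        rw [closure_ball _ (by linarith)]
        exact hg.mono hsub
      · intro x hx
        exact hgR x (hsub (Metric.sphere_subset_closedBall hx))
    calc (1:ℝ) = ‖w ^ j * deriv g z‖ := by rw [h4]; simp
      _ = ‖w‖ ^ j * ‖deriv g z‖ := by rw [norm_mul, norm_pow]
      _ ≤ _ := by gcongr
  have hlim : Filter.Tendsto (fun j : ℕ => ‖w‖ ^ j * (R / (δ / 2))) Filter.atTop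
      (nhds (0 * (R / (δ / 2)))) :=
    (tendsto_pow_atTop_nhds_zero_of_lt_one (norm_nonneg w) hlt).mul_const _
  rw [zero_mul] at hlim
  have := ge_of_tendsto' hlim main
  linarith




/-! ### Multipliers and the dynatomic polynomial -/

lemma deriv_fc_iter (d : ℕ) (lam z : ℂ) (n : ℕ) : deriv ((fc d lam)^[n]) z =
    ∏ k ∈ Finset.range n, ((d : ℂ) * ((fc d lam)^[k] z) ^ (d - 1)) := by
  induction n with
  | zero => simp
  | succ n ih =>
    have h1 : HasDerivAt ((fc d lam)^[n]) (deriv ((fc d lam)^[n]) z) z :=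
      (fc_iter_differentiable d lam n z).hasDerivAt
    have h2 : HasDerivAt (fc d lam) ((d : ℂ) * ((fc d lam)^[n] z) ^ (d - 1)) ((fc d lam)^[n] z) := by
      unfold fc
      exact (hasDerivAt_pow d _).add_const lam
    have h3 := h2.comp z h1
    rw [Function.iterate_succ', h3.deriv, ih, Finset.prod_range_succ, mul_comm]

/-- the polynomial `f_λ^m` -/
noncomputable def itp (d : ℕ) (lam : ℂ) : ℕ → ℂ[X]
  | 0 => X
  | (m + 1) => (itp d lam m) ^ d + C lam

lemma itp_eval (d : ℕ) (lam z : ℂ) (m : ℕ) : (itp d lam m).eval z = (fc d lam)^[m] z := by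
  induction m with
  | zero => simp [itp]
  | succ m ih => simp [itp, ih, Function.iterate_succ_apply', fc]

lemma itp_comp (d : ℕ) (lam : ℂ) (m : ℕ) :
    (itp d lam m).comp (X ^ d + C lam) = itp d lam (m + 1) := by
  apply Polynomial.funext
  intro z
  rw [eval_comp, itp_eval, itp_eval, Function.iterate_succ_apply]
  simp [fc]

lemma rootMultiplicity_comp_le {P q : ℂ[X]} (hP : P ≠ 0) {z : ℂ}
    (hq : q.derivative.eval z ≠ 0) :
    rootMultiplicity z (P.comp q) ≤ rootMultiplicity (q.eval z) P := by
  set a := q.eval z with ha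
  obtain ⟨h, hh, hnd⟩ := exists_eq_pow_rootMultiplicity_mul_and_not_dvd P hP a
  set e := rootMultiplicity a P
  have h1 : (X - C z) ∣ q - C a := by
    rw [dvd_iff_isRoot]; simp [ha]
  obtain ⟨s, hs⟩ := h1
  have hs0 : s.eval z ≠ 0 := by
    have := congrArg (fun p => p.derivative.eval z) hs
    simp at this
    rwa [← this]
  have hha : h.eval a ≠ 0 := by
    intro hc
    exact hnd (dvd_iff_isRoot.2 hc)
  set T := s ^ e * h.comp q with hT
  have hTz : T.eval z ≠ 0 := by
    simp only [hT, eval_mul, eval_pow, eval_comp]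
    exact mul_ne_zero (pow_ne_zero _ hs0) hha
  have hT0 : T ≠ 0 := by
    intro hc; rw [hc] at hTz; simp at hTz
  have hcomp : P.comp q = T * (X - C z) ^ e := by
    conv_lhs => rw [hh]
    rw [mul_comp, pow_comp, sub_comp, X_comp, C_comp, hs, hT, mul_pow]
    ring
  rw [hcomp, rootMultiplicity_mul_X_sub_C_pow hT0, rootMultiplicity_eq_zero hTz]
  simp

lemma itp_sub_X_ne_zero {d : ℕ} (hd : 1 < d) (lam : ℂ) {m : ℕ} (hm : 1 ≤ m) :
    itp d lam m - X ≠ 0 := by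
  intro hc
  have h1 := congrArg (fun p => p.eval ((2 + ‖lam‖ : ℝ) : ℂ)) hc
  simp only [eval_sub, itp_eval, eval_X, eval_zero] at h1
  have h0 : ‖((2 + ‖lam‖ : ℝ) : ℂ)‖ = 2 + ‖lam‖ := by
    rw [Complex.norm_real, Real.norm_eq_abs, abs_of_nonneg (by positivity)]
  have h2 := esc_general hd (lam := lam) (z := ((2 + ‖lam‖ : ℝ) : ℂ)) (by rw [h0]) m
  rw [sub_eq_zero.1 h1, h0] at h2
  have h5 : (2:ℝ) ≤ 2 ^ m := by
    calc (2:ℝ) = 2 ^ 1 := by norm_num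
      _ ≤ 2 ^ m := pow_le_pow_right₀ (by norm_num) hm
  nlinarith [norm_nonneg lam]

lemma mult_step {d : ℕ} (hd : 1 < d) (lam : ℂ) {m : ℕ} (hm : 1 ≤ m) {z : ℂ} (hz : z ≠ 0) :
    rootMultiplicity z (itp d lam m - X) ≤ rootMultiplicity (fc d lam z) (itp d lam m - X) := by
  have hP := itp_sub_X_ne_zero hd lam hm
  have hq : (X ^ d + C lam : ℂ[X]).derivative.eval z ≠ 0 := by
    have hd0 : (d : ℂ) ≠ 0 := by exact_mod_cast (by omega : d ≠ 0)
    have : (X ^ d + C lam : ℂ[X]).derivative.eval z = d * z ^ (d - 1) := by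
      rw [derivative_add, derivative_X_pow, derivative_C]; simp
    rw [this]
    exact mul_ne_zero hd0 (pow_ne_zero _ hz)
  have h1 := rootMultiplicity_comp_le hP hq
  have h2 : (X ^ d + C lam : ℂ[X]).eval z = fc d lam z := by simp [fc]
  rw [h2] at h1
  refine le_trans ?_ h1
  have hdvd : (itp d lam m - X) ∣ (itp d lam m - X).comp (X ^ d + C lam) := by
    rw [sub_comp, itp_comp, X_comp, itp]
    have : itp d lam m ^ d + C lam - (X ^ d + C lam) = itp d lam m ^ d - X ^ d := by ring
    rw [this]
    exact sub_dvd_pow_sub_pow _ _ d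
  refine rootMultiplicity_le_rootMultiplicity_of_dvd ?_ hdvd z
  rw [sub_comp, itp_comp, X_comp, itp]
  intro hc
  have e : itp d lam m ^ d + C lam - (X ^ d + C lam) = itp d lam m ^ d - X ^ d := by ring
  rw [e] at hc
  have h1 := congrArg (fun p => p.eval ((2 + ‖lam‖ : ℝ) : ℂ)) hc
  simp only [eval_sub, eval_pow, itp_eval, eval_X, eval_zero] at h1
  have h0 : ‖((2 + ‖lam‖ : ℝ) : ℂ)‖ = 2 + ‖lam‖ := by
    rw [Complex.norm_real, Real.norm_eq_abs, abs_of_nonneg (by positivity)]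
  have h2 := esc_general hd (lam := lam) (z := ((2 + ‖lam‖ : ℝ) : ℂ)) (by rw [h0]) m
  have h3 := congrArg norm (sub_eq_zero.1 h1)
  rw [norm_pow, norm_pow] at h3
  have h4 := (pow_left_inj₀ (norm_nonneg _) (norm_nonneg _) (by omega : d ≠ 0)).1 h3
  rw [h4, h0] at h2
  have h5 : (2:ℝ) ≤ 2 ^ m := by
    calc (2:ℝ) = 2 ^ 1 := by norm_num
      _ ≤ 2 ^ m := pow_le_pow_right₀ (by norm_num) hm
  nlinarith [norm_nonneg lam]

lemma orb_zero_of_dvd {d : ℕ} {lam : ℂ} {m n : ℕ} (hmn : m ∣ n) (h : orb d lam m = 0) :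
    orb d lam n = 0 := by
  obtain ⟨k, rfl⟩ := hmn
  simp only [orb] at h ⊢
  rw [Function.iterate_mul]
  exact Function.iterate_fixed h k

/-- a periodic orbit does not meet `0` -/
lemma periodic_ne_zero {d : ℕ} {lam : ℂ} {n : ℕ} (h0 : orb d lam n ≠ 0) {z : ℂ}
    (hz : (fc d lam)^[n] z = z) (k : ℕ) : (fc d lam)^[k] z ≠ 0 := by
  intro hc
  have h1 : (fc d lam)^[n] ((fc d lam)^[k] z) = (fc d lam)^[k] z := by
    rw [← Function.iterate_add_apply, add_comm, Function.iterate_add_apply, hz]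
  rw [hc] at h1
  exact h0 h1

lemma mult_invariant {d : ℕ} (hd : 1 < d) {lam : ℂ} {n : ℕ} (hn : 1 ≤ n) (h0 : orb d lam n ≠ 0)
    {z : ℂ} (hz : (fc d lam)^[n] z = z) {m : ℕ} (hm : 1 ≤ m) :
    rootMultiplicity (fc d lam z) (itp d lam m - X) = rootMultiplicity z (itp d lam m - X) := by
  apply le_antisymm _ (mult_step hd lam hm (periodic_ne_zero h0 hz 0))
  have key : ∀ k, rootMultiplicity (fc d lam z) (itp d lam m - X) ≤
      rootMultiplicity ((fc d lam)^[k + 1] z) (itp d lam m - X) := by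
    intro k
    induction k with
    | zero => simp
    | succ k ih =>
      rw [Function.iterate_succ_apply' _ (k + 1)]
      exact ih.trans (mult_step hd lam hm (periodic_ne_zero h0 hz (k + 1)))
  have := key (n - 1)
  rwa [Nat.sub_add_cancel hn, hz] at this

structure IsDyn (d n : ℕ) (lam : ℂ) (p : ℂ[X]) : Prop where
  prod : ∀ z : ℂ,
        (∏ m ∈ n.divisors.filter fun m => ArithmeticFunction.moebius (n / m) = 1,
            ((fc d lam)^[m] z - z)) =
          p.eval z *
            ∏ m ∈ n.divisors.filter fun m => ArithmeticFunction.moebius (n / m) = -1,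
              ((fc d lam)^[m] z - z)
  monic : p.Monic
  deg : (p.natDegree : ℤ) = nu d n

lemma rootMultiplicity_finset_prod {ι : Type*} (s : Finset ι) (P : ι → ℂ[X])
    (h : ∀ i ∈ s, P i ≠ 0) (z : ℂ) :
    rootMultiplicity z (∏ i ∈ s, P i) = ∑ i ∈ s, rootMultiplicity z (P i) := by
  classical
  induction s using Finset.induction_on with
  | empty =>
    simp only [Finset.prod_empty, Finset.sum_empty]
    exact rootMultiplicity_eq_zero (by simp)
  | insert a s ha ih =>
    rw [Finset.prod_insert ha, Finset.sum_insert ha, rootMultiplicity_mul, ih]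
    · exact fun i hi => h i (Finset.mem_insert_of_mem hi)
    · refine mul_ne_zero (h a (Finset.mem_insert_self _ _)) (Finset.prod_ne_zero_iff.2 ?_)
      exact fun i hi => h i (Finset.mem_insert_of_mem hi)

lemma IsDyn.poly_eq {d n : ℕ} {lam : ℂ} {p : ℂ[X]} (H : IsDyn d n lam p) :
    (∏ m ∈ n.divisors.filter fun m => ArithmeticFunction.moebius (n / m) = 1, (itp d lam m - X)) =
      p * ∏ m ∈ n.divisors.filter fun m => ArithmeticFunction.moebius (n / m) = -1,
        (itp d lam m - X) := by
  apply Polynomial.funext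
  intro z
  rw [eval_prod, eval_mul, eval_prod]
  simp only [eval_sub, itp_eval, eval_X]
  exact H.prod z

lemma IsDyn.periodic {d n : ℕ} {lam : ℂ} {p : ℂ[X]} (H : IsDyn d n lam p) {z : ℂ}
    (hz : p.eval z = 0) : (fc d lam)^[n] z = z := by
  have h1 := H.prod z
  rw [hz, zero_mul, Finset.prod_eq_zero_iff] at h1
  obtain ⟨m, hm, h2⟩ := h1
  have h3 : m ∣ n := Nat.dvd_of_mem_divisors (Finset.mem_filter.1 hm).1
  obtain ⟨k, rfl⟩ := h3
  rw [Function.iterate_mul]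
  exact Function.iterate_fixed (sub_eq_zero.1 h2) k

lemma IsDyn.mult_eq {d n : ℕ} (hd : 1 < d) (hn : 1 ≤ n) {lam : ℂ} {p : ℂ[X]} (H : IsDyn d n lam p)
    (h0 : orb d lam n ≠ 0) {z : ℂ} (hz : (fc d lam)^[n] z = z) :
    rootMultiplicity (fc d lam z) p = rootMultiplicity z p := by
  have hm : ∀ s : ℤ, ∀ m ∈ n.divisors.filter (fun m => ArithmeticFunction.moebius (n / m) = s),
      itp d lam m - X ≠ 0 ∧ 1 ≤ m := by
    intro s m hm
    have : 1 ≤ m := Nat.pos_of_mem_divisors (Finset.mem_filter.1 hm).1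
    exact ⟨itp_sub_X_ne_zero hd lam this, this⟩
  have key : ∀ x : ℂ, ∑ m ∈ n.divisors.filter (fun m => ArithmeticFunction.moebius (n / m) = 1),
      rootMultiplicity x (itp d lam m - X) = rootMultiplicity x p +
      ∑ m ∈ n.divisors.filter (fun m => ArithmeticFunction.moebius (n / m) = -1),
      rootMultiplicity x (itp d lam m - X) := by
    intro x
    rw [← rootMultiplicity_finset_prod _ _ (fun m h => (hm 1 m h).1),
      ← rootMultiplicity_finset_prod _ _ (fun m h => (hm (-1) m h).1), H.poly_eq,
      rootMultiplicity_mul]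
    refine mul_ne_zero H.monic.ne_zero (Finset.prod_ne_zero_iff.2 fun m h => (hm (-1) m h).1)
  have k1 := key z
  have k2 := key (fc d lam z)
  rw [Finset.sum_congr rfl (fun m h => mult_invariant hd hn h0 hz (hm 1 m h).2),
    Finset.sum_congr (s₁ := n.divisors.filter (fun m => ArithmeticFunction.moebius (n / m) = -1)) rfl
      (fun m h => mult_invariant hd hn h0 hz (hm (-1) m h).2)] at k2
  omega

lemma IsDyn.sum_comp {d n : ℕ} (hd : 1 < d) (hn : 1 ≤ n) {lam : ℂ} {p : ℂ[X]} (H : IsDyn d n lam p)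
    (h0 : orb d lam n ≠ 0) (g : ℂ → ℝ) :
    (p.roots.map (fun z => g (fc d lam z))).sum = (p.roots.map g).sum := by
  have hp0 := H.monic.ne_zero
  have hper : ∀ z ∈ p.roots.toFinset, (fc d lam)^[n] z = z := by
    intro z hz
    rw [Multiset.mem_toFinset, mem_roots hp0] at hz
    exact H.periodic hz
  have hstep : ∀ z ∈ p.roots.toFinset, fc d lam z ∈ p.roots.toFinset := by
    intro z hz
    have h1 := H.mult_eq hd hn h0 (hper z hz)
    rw [Multiset.mem_toFinset, ← Multiset.count_pos, count_roots] at hz ⊢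
    omega
  have hiter : ∀ k, ∀ z ∈ p.roots.toFinset, (fc d lam)^[k] z ∈ p.roots.toFinset := by
    intro k z hz
    induction k with
    | zero => exact hz
    | succ k ih => rw [Function.iterate_succ_apply']; exact hstep _ ih
  rw [Finset.sum_multiset_map_count, Finset.sum_multiset_map_count]
  refine Finset.sum_nbij (fc d lam) hstep ?_ ?_ ?_
  · intro x hx y hy hxy
    have h1 := hper x hx
    have h2 := hper y hy
    obtain ⟨k, rfl⟩ : ∃ k, n = k + 1 := ⟨n - 1, by omega⟩
    rw [Function.iterate_succ_apply] at h1 h2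
    rw [← h1, ← h2]
    exact congrArg _ hxy
  · intro x hx
    refine ⟨(fc d lam)^[n - 1] x, hiter _ x hx, ?_⟩
    rw [← Function.iterate_succ_apply' (fc d lam), Nat.succ_eq_add_one, Nat.sub_add_cancel hn]
    exact hper x hx
  · intro x hx
    rw [count_roots, count_roots, H.mult_eq hd hn h0 (hper x hx)]

lemma IsDyn.sum_iter {d n : ℕ} (hd : 1 < d) (hn : 1 ≤ n) {lam : ℂ} {p : ℂ[X]} (H : IsDyn d n lam p)
    (h0 : orb d lam n ≠ 0) (g : ℂ → ℝ) (k : ℕ) :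
    (p.roots.map (fun z => g ((fc d lam)^[k] z))).sum = (p.roots.map g).sum := by
  induction k with
  | zero => rfl
  | succ k ih =>
    rw [← ih, ← H.sum_comp hd hn h0 (fun z => g ((fc d lam)^[k] z))]
    rfl

lemma log_norm_multiset_prod (s : Multiset ℂ) (g : ℂ → ℂ) (h : ∀ z ∈ s, g z ≠ 0) :
    Real.log ‖(s.map g).prod‖ = (s.map (fun z => Real.log ‖g z‖)).sum := by
  induction s using Multiset.induction_on with
  | empty => simp
  | cons a s ih =>
    have h1 : ∀ z ∈ s, g z ≠ 0 := fun z hz => h z (Multiset.mem_cons_of_mem hz)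
    have h2 : (s.map g).prod ≠ 0 := by
      apply Multiset.prod_ne_zero
      intro hc
      obtain ⟨z, hz, h3⟩ := Multiset.mem_map.1 hc
      exact h1 z hz h3
    rw [Multiset.map_cons, Multiset.prod_cons, norm_mul, Real.log_mul, ih h1, Multiset.map_cons,
      Multiset.sum_cons]
    · exact norm_ne_zero_iff.2 (h a (Multiset.mem_cons_self a s))
    · exact norm_ne_zero_iff.2 h2

lemma moebius_log_aux (n : ℕ) (x : ℕ → ℝ) (hx : ∀ m ∈ n.divisors, x m ≠ 0) :
    ∑ m ∈ n.divisors, (ArithmeticFunction.moebius (n / m) : ℝ) * Real.log (x m) =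
      Real.log (∏ m ∈ n.divisors.filter fun m => ArithmeticFunction.moebius (n / m) = 1, x m) -
      Real.log (∏ m ∈ n.divisors.filter fun m => ArithmeticFunction.moebius (n / m) = -1, x m) := by
  rw [Real.log_prod (fun m hm => hx m (Finset.mem_filter.1 hm).1),
    Real.log_prod (fun m hm => hx m (Finset.mem_filter.1 hm).1), Finset.sum_filter,
    Finset.sum_filter, ← Finset.sum_sub_distrib]
  refine Finset.sum_congr rfl fun m hm => ?_
  rcases ArithmeticFunction.moebius_eq_or (n / m) with h | h | h <;> simp [h]

lemma IsDyn.card_roots {d n : ℕ} {lam : ℂ} {p : ℂ[X]} (H : IsDyn d n lam p) :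
    (p.roots.card : ℝ) = (nu d n : ℝ) := by
  have h1 := (IsAlgClosed.splits p).natDegree_eq_card_roots
  have h2 := H.deg
  rw [h1] at h2
  exact_mod_cast h2

theorem IsDyn.formula {d n : ℕ} (hd : 1 < d) (hn : 1 ≤ n) {lam : ℂ} {p : ℂ[X]}
    (H : IsDyn d n lam p) (h0 : orb d lam n ≠ 0) :
    (p.roots.map (fun z => Real.log ‖deriv ((fc d lam)^[n]) z‖)).sum =
      n * ((nu d n : ℝ) * Real.log d + ((d:ℝ) - 1) *
        ∑ m ∈ n.divisors, (ArithmeticFunction.moebius (n / m) : ℝ) * Real.log ‖orb d lam m‖) := by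
  have hp0 := H.monic.ne_zero
  have hd0 : (d:ℝ) ≠ 0 := by positivity
  have hne : ∀ z ∈ p.roots, ∀ k, (fc d lam)^[k] z ≠ 0 := by
    intro z hz k
    exact periodic_ne_zero h0 (H.periodic ((mem_roots hp0).1 hz)) k
  have h1 : ∀ z ∈ p.roots, Real.log ‖deriv ((fc d lam)^[n]) z‖ =
      n * Real.log d + ((d:ℝ) - 1) * ∑ k ∈ Finset.range n, Real.log ‖(fc d lam)^[k] z‖ := by
    intro z hz
    rw [deriv_fc_iter, norm_prod, Real.log_prod]
    · have : ∀ k ∈ Finset.range n, Real.log ‖(d:ℂ) * ((fc d lam)^[k] z) ^ (d - 1)‖ =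
          Real.log d + ((d:ℝ) - 1) * Real.log ‖(fc d lam)^[k] z‖ := by
        intro k _
        rw [norm_mul, norm_pow, Real.log_mul, Real.log_pow, Complex.norm_natCast,
          Nat.cast_sub (by omega), Nat.cast_one]
        · simpa using hd0
        · exact pow_ne_zero _ (norm_ne_zero_iff.2 (hne z hz k))
      rw [Finset.sum_congr rfl this, Finset.sum_add_distrib, Finset.sum_const, Finset.card_range,
        nsmul_eq_mul, Finset.mul_sum]
    · intro k _
      rw [norm_ne_zero_iff]
      exact mul_ne_zero (by exact_mod_cast hd0) (pow_ne_zero _ (hne z hz k))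
  rw [Multiset.map_congr rfl h1, Multiset.sum_map_add, Multiset.map_const', Multiset.sum_replicate,
    nsmul_eq_mul, H.card_roots, Multiset.sum_map_mul_left]
  have h2 : (p.roots.map (fun z => ∑ k ∈ Finset.range n, Real.log ‖(fc d lam)^[k] z‖)).sum =
      n * (p.roots.map (fun z => Real.log ‖z‖)).sum := by
    have : ∀ N : ℕ, (p.roots.map (fun z => ∑ k ∈ Finset.range N, Real.log ‖(fc d lam)^[k] z‖)).sum =
        N * (p.roots.map (fun z => Real.log ‖z‖)).sum := by
      intro N
      induction N with
      | zero => simp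
      | succ N ih =>
        simp only [Finset.sum_range_succ]
        rw [Multiset.sum_map_add, ih, H.sum_iter hd hn h0 (fun z => Real.log ‖z‖) N]
        push_cast; ring
    exact this n
  have h3 : (p.roots.map (fun z => Real.log ‖z‖)).sum =
      ∑ m ∈ n.divisors, (ArithmeticFunction.moebius (n / m) : ℝ) * Real.log ‖orb d lam m‖ := by
    have hx : ∀ m ∈ n.divisors, ‖orb d lam m‖ ≠ 0 := by
      intro m hm
      rw [norm_ne_zero_iff]
      exact fun hc => h0 (orb_zero_of_dvd (Nat.dvd_of_mem_divisors hm) hc)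
    rw [moebius_log_aux n _ hx, ← norm_prod, ← norm_prod]
    have h4 := H.prod 0
    simp only [sub_zero] at h4
    simp only [orb]
    rw [h4, norm_mul, Real.log_mul, add_sub_cancel_right]
    · rw [(IsAlgClosed.splits p).eval_eq_prod_roots_of_monic H.monic, log_norm_multiset_prod]
      · simp
      · intro z hz
        simpa using hne z hz 0
    · rw [norm_ne_zero_iff]
      intro hc
      exact periodic_ne_zero h0 (H.periodic hc) 0 rfl
    · rw [norm_ne_zero_iff, Finset.prod_ne_zero_iff]
      intro m hm
      simpa [orb] using hx m (Finset.mem_filter.1 hm).1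
  rw [h2, h3]
  ring




/-! ### Symmetric functions of multipliers are polynomial in the parameter -/

noncomputable def itpL (d : ℕ) : ℕ → ℂ[X][X]
  | 0 => X
  | (m + 1) => (itpL d m) ^ d + C X

lemma itpL_map (d : ℕ) (lam : ℂ) (m : ℕ) : (itpL d m).map (evalRingHom lam) = itp d lam m := by
  induction m with
  | zero => simp [itpL, itp]
  | succ m ih => simp [itpL, itp, ih]

lemma exists_sym (d n : ℕ) (Φ : ℂ[X][X]) (N : ℕ) (hm : ∀ lam : ℂ, (Φ.map (evalRingHom lam)).Monic)
    (hN : ∀ lam : ℂ, (Φ.map (evalRingHom lam)).natDegree = N) (r : ℂ) (s : ℕ) :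
    ∃ q : ℂ[X][X], ∀ lam : ℂ, q.map (evalRingHom lam) =
      ((Φ.map (evalRingHom lam)).roots.map
        (fun z => (X : ℂ[X]) - C ((deriv ((fc d lam)^[n]) z / r) ^ s))).prod := by
  set W : ℂ[X][X] := C (C r⁻¹) * derivative (itpL d n) with hW
  set g : (ℂ[X][X])[X] := C X - (W.map C) ^ s with hg
  refine ⟨resultant (Φ.map C) g N g.natDegree, fun lam => ?_⟩
  set p := Φ.map (evalRingHom lam) with hp
  set ψ : ℂ[X][X] →+* ℂ[X] := mapRingHom (evalRingHom lam) with hψ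
  have h1 : (resultant (Φ.map C) g N g.natDegree).map (evalRingHom lam) =
      resultant (p.map C) (g.map ψ) N g.natDegree := by
    have : (Φ.map C).map ψ = p.map C := by
      rw [hp, Polynomial.map_map, Polynomial.map_map]
      congr 1
      ext <;> simp [hψ]
    rw [← this, resultant_map_map]
    rfl
  have h2 : (p.map (C : ℂ →+* ℂ[X])).natDegree = N := by
    rw [natDegree_map_eq_of_injective C_injective, hp, hN]
  have h3 : (p.map (C : ℂ →+* ℂ[X])).Splits := (IsAlgClosed.splits p).map _
  have h4 : (p.map (C : ℂ →+* ℂ[X])).leadingCoeff = 1 := (hm lam).map _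
  have h5 := resultant_eq_prod_eval (p.map (C : ℂ →+* ℂ[X])) (g.map ψ) g.natDegree natDegree_map_le h3
  rw [h2, h4, one_pow, one_mul, Splits.roots_map_of_injective (IsAlgClosed.splits p) C_injective,
    Multiset.map_map] at h5
  rw [h1, h5]
  congr 1
  refine Multiset.map_congr rfl fun z _ => ?_
  have h6 : W.map (evalRingHom lam) = C r⁻¹ * derivative (itp d lam n) := by
    rw [hW, Polynomial.map_mul, ← derivative_map, itpL_map]; simp
  have h7 : (W.map C).map ψ = (C r⁻¹ * derivative (itp d lam n)).map C := by
    rw [← h6, Polynomial.map_map, Polynomial.map_map]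
    congr 1
    ext <;> simp [hψ]
  have h8 : (derivative (itp d lam n)).eval z = deriv ((fc d lam)^[n]) z := by
    rw [← Polynomial.deriv]
    congr 1
    funext x
    exact itp_eval d lam x n
  have h9 : g.map ψ = C X - ((C r⁻¹ * derivative (itp d lam n)).map C) ^ s := by
    rw [hg, Polynomial.map_sub, Polynomial.map_pow, h7, map_C]
    simp [hψ]
  rw [Function.comp_apply, h9, eval_sub, eval_C, eval_pow, eval_map, eval₂_at_apply, eval_mul,
    eval_C, h8, ← C_pow, div_eq_inv_mul]

noncomputable def Bsum (d n : ℕ) (Φ : ℂ[X][X]) (r : ℝ) (lam : ℂ) : ℝ :=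
  ((Φ.map (evalRingHom lam)).roots.map
    (fun z => Real.log (max 1 (‖deriv ((fc d lam)^[n]) z‖ / r)))).sum

lemma mahler_eq (d n : ℕ) (Φ : ℂ[X][X]) {r : ℝ} (hr : 0 < r) (lam : ℂ) (s : ℕ) :
    ((Φ.map (evalRingHom lam)).roots.map
        (fun z => (X : ℂ[X]) - C ((deriv ((fc d lam)^[n]) z / (r : ℂ)) ^ s))).prod.mahlerMeasure =
      Real.exp (s * Bsum d n Φ r lam) := by
  rw [prod_mahlerMeasure_eq_mahlerMeasure_prod, Multiset.map_map, Bsum]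
  simp only [Function.comp_def, mahlerMeasure_X_sub_C]
  generalize (Φ.map (evalRingHom lam)).roots = S
  induction S using Multiset.induction_on with
  | empty => simp
  | cons a S ih =>
    rw [Multiset.map_cons, Multiset.prod_cons, ih, Multiset.map_cons, Multiset.sum_cons, mul_add,
      Real.exp_add]
    congr 1
    have h1 : ‖(deriv ((fc d lam)^[n]) a / (r:ℂ)) ^ s‖ = (‖deriv ((fc d lam)^[n]) a‖ / r) ^ s := by
      rw [norm_pow, norm_div, Complex.norm_real, Real.norm_of_nonneg hr.le]
    rw [h1, Real.exp_nat_mul, Real.exp_log (lt_of_lt_of_le one_pos (le_max_left _ _))]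
    have h2 : 0 ≤ ‖deriv ((fc d lam)^[n]) a‖ / r := by positivity
    generalize ‖deriv ((fc d lam)^[n]) a‖ / r = x at h2
    rcases le_total 1 x with h | h
    · rw [max_eq_right h, max_eq_right (one_le_pow₀ h)]
    · rw [max_eq_left h, max_eq_left (pow_le_one₀ h2 h), one_pow]

/-- The basic two sided estimate between `Bsum` and holomorphic coefficients. -/
lemma exists_coeffs (d n : ℕ) (Φ : ℂ[X][X]) (N : ℕ)
    (hm : ∀ lam : ℂ, (Φ.map (evalRingHom lam)).Monic)
    (hN : ∀ lam : ℂ, (Φ.map (evalRingHom lam)).natDegree = N) {r : ℝ} (hr : 0 < r) (s : ℕ) :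
    ∃ c : ℕ → ℂ[X], ∀ lam : ℂ,
      Real.exp (s * Bsum d n Φ r lam) ≤ ∑ i ∈ Finset.range (N + 1), ‖(c i).eval lam‖ ∧
      ∀ i, ‖(c i).eval lam‖ ≤ N.choose i * Real.exp (s * Bsum d n Φ r lam) := by
  obtain ⟨q, hq⟩ := exists_sym d n Φ N hm hN (r : ℂ) s
  refine ⟨fun i => q.coeff i, fun lam => ?_⟩
  have hM := mahler_eq d n Φ hr lam s
  rw [← hq] at hM
  have hc : ∀ i, (q.coeff i).eval lam = (q.map (evalRingHom lam)).coeff i := by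
    intro i; simp
  have hdeg : (q.map (evalRingHom lam)).natDegree = N := by
    rw [hq, ← hN lam, (IsAlgClosed.splits (Φ.map (evalRingHom lam))).natDegree_eq_card_roots,
      natDegree_multiset_prod_of_monic]
    · rw [Multiset.map_map]
      simp only [Function.comp_def, natDegree_X_sub_C]
      simp
    · intro f hf
      obtain ⟨z, _, rfl⟩ := Multiset.mem_map.1 hf
      exact monic_X_sub_C _
  simp only [hc]
  rw [← hM]
  constructor
  · have := mahlerMeasure_le_sum_norm_coeff (q.map (evalRingHom lam))
    rwa [sum_over_range _ (by simp), hdeg] at this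
  · intro i
    have := norm_coeff_le_choose_mul_mahlerMeasure i (q.map (evalRingHom lam))
    rwa [hdeg] at this

lemma sum_bound {N : ℕ} {x : ℕ → ℝ} {E : ℝ} (h : ∀ i, x i ≤ N.choose i * E) :
    ∑ i ∈ Finset.range (N + 1), x i ≤ 2 ^ N * E := by
  calc _ ≤ ∑ i ∈ Finset.range (N + 1), (N.choose i : ℝ) * E := Finset.sum_le_sum fun i _ => h i
    _ = 2 ^ N * E := by
      rw [← Finset.sum_mul]
      congr 1
      exact_mod_cast Nat.sum_range_choose N

lemma Bsum_continuous (d n : ℕ) (Φ : ℂ[X][X]) (N : ℕ)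
    (hm : ∀ lam : ℂ, (Φ.map (evalRingHom lam)).Monic)
    (hN : ∀ lam : ℂ, (Φ.map (evalRingHom lam)).natDegree = N) {r : ℝ} (hr : 0 < r) :
    Continuous (Bsum d n Φ r) := by
  choose c hc using fun s => exists_coeffs d n Φ N hm hN hr s
  set L : ℕ → ℂ → ℝ := fun s lam => ∑ i ∈ Finset.range (N + 1), ‖(c s i).eval lam‖ with hL
  have hLc : ∀ s, Continuous (L s) := fun s =>
    continuous_finsetSum _ fun i _ => (Polynomial.continuous _).norm
  have hLpos : ∀ s lam, 0 < L s lam := fun s lam => lt_of_lt_of_le (Real.exp_pos _) (hc s lam).1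
  have hlim : TendstoUniformly (fun (s : ℕ) lam => Real.log (L s lam) / s) (Bsum d n Φ r)
      Filter.atTop := by
    rw [Metric.tendstoUniformly_iff]
    intro ε hε
    have h1 : Filter.Tendsto (fun s : ℕ => (N * Real.log 2) / (s : ℝ)) Filter.atTop (nhds 0) :=
      tendsto_const_div_atTop_nhds_zero_nat _
    filter_upwards [h1.eventually (gt_mem_nhds hε), Filter.eventually_gt_atTop 0] with s hs hs0 lam
    have hs' : (0:ℝ) < s := by exact_mod_cast hs0
    have h2 : s * Bsum d n Φ r lam ≤ Real.log (L s lam) := by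
      rw [Real.le_log_iff_exp_le (hLpos s lam)]
      exact (hc s lam).1
    have h3 : Real.log (L s lam) ≤ N * Real.log 2 + s * Bsum d n Φ r lam := by
      rw [Real.log_le_iff_le_exp (hLpos s lam), Real.exp_add, Real.exp_nat_mul,
        Real.exp_log two_pos]
      exact sum_bound (hc s lam).2
    rw [Real.dist_eq, abs_sub_comm, abs_lt]
    constructor
    · have : Bsum d n Φ r lam ≤ Real.log (L s lam) / s := by
        rw [le_div_iff₀ hs']; linarith
      linarith
    · have : Real.log (L s lam) / s ≤ (N * Real.log 2) / s + Bsum d n Φ r lam := by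
        rw [div_add' _ _ _ hs'.ne', div_le_div_iff_of_pos_right hs']; linarith
      linarith
  refine hlim.continuous (Filter.Eventually.frequently (Filter.Eventually.of_forall fun s => ?_))
  exact ((hLc s).log fun lam => (hLpos s lam).ne').div_const _

lemma Bsum_max (d n : ℕ) (Φ : ℂ[X][X]) (N : ℕ)
    (hm : ∀ lam : ℂ, (Φ.map (evalRingHom lam)).Monic)
    (hN : ∀ lam : ℂ, (Φ.map (evalRingHom lam)).natDegree = N) {r : ℝ} (hr : 0 < r)
    {U : Set ℂ} (hU : Bornology.IsBounded U) {M : ℝ}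
    (hM : ∀ lam ∈ frontier U, Bsum d n Φ r lam ≤ M) {l0 : ℂ} (hl : l0 ∈ U) :
    Bsum d n Φ r l0 ≤ M := by
  have key : ∀ s : ℕ, s * Bsum d n Φ r l0 ≤ N * Real.log 2 + s * M := by
    intro s
    obtain ⟨c, hc⟩ := exists_coeffs d n Φ N hm hN hr s
    have h1 : ∀ i, ‖(c i).eval l0‖ ≤ N.choose i * Real.exp (s * M) := by
      intro i
      refine Complex.norm_le_of_forall_mem_frontier_norm_le (f := fun x => (c i).eval x) hU
        (Polynomial.differentiable _).diffContOnCl (fun z hz => ?_) (subset_closure hl)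
      refine ((hc z).2 i).trans ?_
      gcongr
      exact hM z hz
    have h2 := ((hc l0).1).trans (sum_bound h1)
    rw [← Real.exp_le_exp, Real.exp_add, Real.exp_nat_mul _ N, Real.exp_log two_pos]
    exact h2
  by_contra hcon
  push Not at hcon
  obtain ⟨s, hs⟩ := exists_nat_gt (N * Real.log 2 / (Bsum d n Φ r l0 - M))
  rw [div_lt_iff₀ (by linarith)] at hs
  have := key s
  nlinarith

lemma log_max_eq {r x : ℝ} (hr : 0 < r) : Real.log (max r x) = Real.log r + Real.log (max 1 (x / r)) := by
  rw [← Real.log_mul hr.ne' (lt_of_lt_of_le one_pos (le_max_left _ _)).ne', mul_max_of_nonneg _ _ hr.le,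
    mul_one, mul_div_cancel₀ _ hr.ne']

/-- sum of truncated logs in terms of Bsum -/
noncomputable def Asum (d n : ℕ) (Φ : ℂ[X][X]) (r : ℝ) (lam : ℂ) : ℝ :=
  ((Φ.map (evalRingHom lam)).roots.map
    (fun z => Real.log (max r ‖deriv ((fc d lam)^[n]) z‖))).sum

lemma Asum_eq (d n : ℕ) (Φ : ℂ[X][X]) (N : ℕ)
    (hN : ∀ lam : ℂ, (Φ.map (evalRingHom lam)).natDegree = N) {r : ℝ} (hr : 0 < r) (lam : ℂ) :
    Asum d n Φ r lam = N * Real.log r + Bsum d n Φ r lam := by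
  rw [← hN lam, (IsAlgClosed.splits (Φ.map (evalRingHom lam))).natDegree_eq_card_roots, Asum, Bsum]
  simp only [log_max_eq hr, Multiset.sum_map_add]
  simp

lemma Asum_continuous (d n : ℕ) (Φ : ℂ[X][X]) (N : ℕ)
    (hm : ∀ lam : ℂ, (Φ.map (evalRingHom lam)).Monic)
    (hN : ∀ lam : ℂ, (Φ.map (evalRingHom lam)).natDegree = N) {r : ℝ} (hr : 0 < r) :
    Continuous (Asum d n Φ r) := by
  have : Asum d n Φ r = fun lam => N * Real.log r + Bsum d n Φ r lam :=
    funext fun lam => Asum_eq d n Φ N hN hr lam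
  rw [this]
  exact continuous_const.add (Bsum_continuous d n Φ N hm hN hr)

lemma Asum_max (d n : ℕ) (Φ : ℂ[X][X]) (N : ℕ)
    (hm : ∀ lam : ℂ, (Φ.map (evalRingHom lam)).Monic)
    (hN : ∀ lam : ℂ, (Φ.map (evalRingHom lam)).natDegree = N) {r : ℝ} (hr : 0 < r)
    {U : Set ℂ} (hU : Bornology.IsBounded U) {M : ℝ}
    (hM : ∀ lam ∈ frontier U, Asum d n Φ r lam ≤ M) {l0 : ℂ} (hl : l0 ∈ U) :
    Asum d n Φ r l0 ≤ M := by
  rw [Asum_eq d n Φ N hN hr]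
  have := Bsum_max d n Φ N hm hN hr hU (M := M - N * Real.log r) (fun lam h => ?_) hl
  · linarith
  · have := hM lam h
    rw [Asum_eq d n Φ N hN hr] at this
    linarith



/-! ### The function `X = A - ν log d - ν (d-1)/d g` -/

structure DynFam (d n : ℕ) (Φ : ℂ[X][X]) : Prop where
  isDyn : ∀ lam : ℂ, IsDyn d n lam (Φ.map (evalRingHom lam))

lemma DynFam.monic {d n : ℕ} {Φ : ℂ[X][X]} (H : DynFam d n Φ) (lam : ℂ) :
    (Φ.map (evalRingHom lam)).Monic := (H.isDyn lam).monic

lemma DynFam.natDegree {d n : ℕ} {Φ : ℂ[X][X]} (H : DynFam d n Φ) (lam : ℂ) :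
    (Φ.map (evalRingHom lam)).natDegree = (nu d n).toNat := by
  have := (H.isDyn lam).deg
  omega

lemma DynFam.nu_nonneg {d n : ℕ} {Φ : ℂ[X][X]} (H : DynFam d n Φ) : (0:ℝ) ≤ nu d n := by
  have := (H.isDyn 0).card_roots
  rw [← this]; positivity

noncomputable def uu (d : ℕ) (gI : ℂ → ℝ) (lam : ℂ) (m : ℕ) : ℝ :=
  Real.log ‖orb d lam m‖ - d ^ (m - 1) * gI lam

noncomputable def Xf (d n : ℕ) (gI : ℂ → ℝ) (Φ : ℂ[X][X]) (r : ℝ) (lam : ℂ) : ℝ :=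
  1 / n * Asum d n Φ r lam - nu d n * Real.log d - nu d n * (((d:ℝ) - 1) / d * gI lam)

lemma sum_uu {d n : ℕ} (hd : 1 < d) (gI : ℂ → ℝ) (lam : ℂ) :
    ∑ m ∈ n.divisors, (ArithmeticFunction.moebius (n / m) : ℝ) * uu d gI lam m =
    ∑ m ∈ n.divisors, (ArithmeticFunction.moebius (n / m) : ℝ) * Real.log ‖orb d lam m‖ -
      nu d n / d * gI lam := by
  have hd0 : (d:ℝ) ≠ 0 := by positivity
  have h1 : (nu d n : ℝ) / d = ∑ m ∈ n.divisors, (ArithmeticFunction.moebius (n / m) : ℝ) * d ^ (m - 1) := by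
    rw [nu]
    push_cast
    rw [Finset.sum_div]
    refine Finset.sum_congr rfl fun m hm => ?_
    have := Nat.pos_of_mem_divisors hm
    obtain ⟨k, rfl⟩ : ∃ k, m = k + 1 := ⟨m - 1, by omega⟩
    rw [Nat.add_sub_cancel, pow_succ]
    field_simp
  rw [h1, Finset.sum_mul, ← Finset.sum_sub_distrib]
  refine Finset.sum_congr rfl fun m hm => ?_
  rw [uu]; ring

lemma Xf_ge {d n : ℕ} (hd : 1 < d) (hn : 1 ≤ n) {Φ : ℂ[X][X]} (H : DynFam d n Φ) (gI : ℂ → ℝ)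
    {r : ℝ} {lam : ℂ} (h0 : orb d lam n ≠ 0) :
    ((d:ℝ) - 1) * ∑ m ∈ n.divisors, (ArithmeticFunction.moebius (n / m) : ℝ) * uu d gI lam m ≤
      Xf d n gI Φ r lam := by
  have hn0 : (0:ℝ) < n := by exact_mod_cast hn
  have hd0 : (d:ℝ) ≠ 0 := by positivity
  have h1 := (H.isDyn lam).formula hd hn h0
  have h2 : ((Φ.map (evalRingHom lam)).roots.map
      (fun z => Real.log ‖deriv ((fc d lam)^[n]) z‖)).sum ≤ Asum d n Φ r lam := by
    apply Multiset.sum_map_le_sum_map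
    intro z hz
    apply Real.log_le_log _ (le_max_right _ _)
    rw [norm_pos_iff, deriv_fc_iter, Finset.prod_ne_zero_iff]
    intro k _
    have := periodic_ne_zero h0 ((H.isDyn lam).periodic ((mem_roots (H.monic lam).ne_zero).1 hz)) k
    exact mul_ne_zero (by exact_mod_cast (by omega : d ≠ 0)) (pow_ne_zero _ this)
  rw [h1] at h2
  rw [sum_uu hd, Xf]
  have h3 : (nu d n : ℝ) * Real.log d + ((d:ℝ) - 1) *
        ∑ m ∈ n.divisors, (ArithmeticFunction.moebius (n / m) : ℝ) * Real.log ‖orb d lam m‖ ≤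
      1 / n * Asum d n Φ r lam := by
    rw [one_div, ← div_eq_inv_mul, le_div_iff₀ hn0]; linarith
  have h4 : ((d:ℝ) - 1) * (nu d n / d * gI lam) = nu d n * (((d:ℝ) - 1) / d * gI lam) := by
    field_simp
  linarith

lemma orb_ne_zero_of_green {d n : ℕ} (hd : 1 < d) (hn : 1 ≤ n) {gI : ℂ → ℝ} (hg : IsGreen d gI)
    {lam : ℂ} (h : gI lam ≠ 0) : orb d lam n ≠ 0 := by
  intro h0
  have h1 : ∀ k, orb d lam (k % n) = orb d lam k := by
    intro k
    conv_rhs => rw [← Nat.mod_add_div k n, orb_add]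
    rw [orb_zero_of_dvd (Dvd.intro _ rfl) h0]; rfl
  obtain ⟨k, hk⟩ := hg.unbounded hd h (∑ j ∈ Finset.range n, ‖orb d lam j‖)
  rw [← h1 k] at hk
  have := Finset.single_le_sum (f := fun j => ‖orb d lam j‖) (fun j _ => norm_nonneg _)
    (Finset.mem_range.2 (Nat.mod_lt k hn))
  linarith

lemma Xf_eq {d n : ℕ} (hd : 1 < d) (hn : 1 ≤ n) {Φ : ℂ[X][X]} (H : DynFam d n Φ) {gI : ℂ → ℝ}
    (hg : IsGreen d gI) {r : ℝ} (hr1 : r ≤ 1) {lam : ℂ} (h : gI lam ≠ 0) :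
    Xf d n gI Φ r lam =
    ((d:ℝ) - 1) * ∑ m ∈ n.divisors, (ArithmeticFunction.moebius (n / m) : ℝ) * uu d gI lam m := by
  have hn0 : (0:ℝ) < n := by exact_mod_cast hn
  have hd0 : (d:ℝ) ≠ 0 := by positivity
  have h1 := (H.isDyn lam).formula hd hn (orb_ne_zero_of_green hd hn hg h)
  have h2 : Asum d n Φ r lam = ((Φ.map (evalRingHom lam)).roots.map
      (fun z => Real.log ‖deriv ((fc d lam)^[n]) z‖)).sum := by
    rw [Asum]
    congr 1
    refine Multiset.map_congr rfl fun z hz => ?_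
    rw [max_eq_right]
    exact hr1.trans (fatou hd hn ((H.isDyn lam).periodic ((mem_roots (H.monic lam).ne_zero).1 hz))
      (hg.unbounded hd h))
  rw [sum_uu hd, Xf, h2, h1]
  field_simp
  ring

lemma Xf_le_of_zero {d n : ℕ} (hd : 1 < d) (hn : 1 ≤ n) {Φ : ℂ[X][X]} (H : DynFam d n Φ) {gI : ℂ → ℝ}
    (hg : IsGreen d gI) {r : ℝ} (hr : 0 < r) {E : ℝ}
    (hE : ∀ lam, gI lam ≠ 0 → Xf d n gI Φ r lam ≤ E) {l0 : ℂ} (h0 : gI l0 = 0) :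
    Xf d n gI Φ r l0 ≤ E := by
  have hn0 : (0:ℝ) < n := by exact_mod_cast hn
  have hd1 : (1:ℝ) < d := by exact_mod_cast hd
  have hgc := hg.continuous hd
  set b : ℝ := nu d n * (((d:ℝ) - 1) / d) with hb
  have hb0 : 0 ≤ b := mul_nonneg H.nu_nonneg (div_nonneg (by linarith) (by linarith))
  have key : ∀ η : ℝ, 0 < η → Asum d n Φ r l0 ≤ n * (E + nu d n * Real.log d + b * η) := by
    intro η hη
    refine Asum_max d n Φ _ H.monic H.natDegree hr (U := {lam | gI lam < η}) ?_ ?_ ?_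
    · rw [isBounded_iff_forall_norm_le]
      refine ⟨Real.exp (η + C0 d), fun lam hl => ?_⟩
      have h1 := hg.ge hd lam
      have h2 : gI lam < η := hl
      have h3 : Real.log (1 + ‖lam‖ ^ 2) ≤ 2 * (η + C0 d) := by linarith
      rw [Real.log_le_iff_le_exp (by positivity)] at h3
      have h4 : Real.exp (2 * (η + C0 d)) = Real.exp (η + C0 d) ^ 2 := by
        rw [← Real.exp_nat_mul]; norm_num
      rw [h4] at h3
      exact le_of_sq_le_sq (by linarith) (Real.exp_pos _).le
    · intro lam hl
      have h1 : gI lam = η := frontier_lt_subset_eq hgc continuous_const hl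
      have h2 := hE lam (by rw [h1]; exact hη.ne')
      rw [Xf, h1] at h2
      have h3 : 1 / (n:ℝ) * Asum d n Φ r lam ≤ E + nu d n * Real.log d + b * η := by
        rw [hb]; linarith
      rw [one_div, ← div_eq_inv_mul, div_le_iff₀ hn0] at h3
      linarith
    · simp [h0, hη]
  rw [Xf, h0]
  have h5 : ∀ η : ℝ, 0 < η → 1 / (n:ℝ) * Asum d n Φ r l0 ≤ E + nu d n * Real.log d + b * η := by
    intro η hη
    rw [one_div, ← div_eq_inv_mul, div_le_iff₀ hn0]
    linarith [key η hη]
  have h6 : 1 / (n:ℝ) * Asum d n Φ r l0 ≤ E + nu d n * Real.log d := by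
    apply le_of_forall_pos_le_add
    intro ε hε
    refine (h5 (ε / (b + 1)) (by positivity)).trans ?_
    have : b * (ε / (b + 1)) ≤ ε := by
      rw [mul_div_assoc', div_le_iff₀ (by positivity)]
      nlinarith
    linarith
  linarith



/-! ### Plane integrals in polar coordinates -/

lemma lintegral_polar {f : ℂ → ENNReal} (hf : Measurable f) :
    ∫⁻ x, f x = ∫⁻ r in Set.Ioi (0:ℝ), ∫⁻ t in Set.Ioo (-π) π,
      ENNReal.ofReal r * f (circleMap 0 r t) := by
  rw [← Complex.lintegral_comp_polarCoord_symm]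
  have h1 : polarCoord.target = Set.Ioi (0:ℝ) ×ˢ Set.Ioo (-π) π := rfl
  have h2 : ∀ p : ℝ × ℝ, Complex.polarCoord.symm p = circleMap 0 p.1 p.2 := by
    intro p
    rw [Complex.polarCoord_symm_apply, circleMap, Complex.exp_mul_I]
    simp
  have h3 : Measurable (fun p : ℝ × ℝ => circleMap 0 p.1 p.2) := by
    unfold circleMap
    fun_prop
  simp only [h2, smul_eq_mul]
  rw [h1, Measure.volume_eq_prod, setLIntegral_prod]
  refine AEMeasurable.mul ?_ (hf.comp h3).aemeasurable
  fun_prop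

lemma lintegral_ball_polar {f : ℂ → ENNReal} (hf : Measurable f) (c : ℂ) (ρ : ℝ) :
    ∫⁻ x in Metric.ball c ρ, f x = ∫⁻ r in Set.Ioo (0:ℝ) ρ, ∫⁻ t in Set.Ioo (-π) π,
      ENNReal.ofReal r * f (circleMap c r t) := by
  rw [← lintegral_indicator Metric.isOpen_ball.measurableSet,
    ← lintegral_add_right_eq_self _ c, lintegral_polar]
  · rw [← lintegral_indicator measurableSet_Ioi, ← lintegral_indicator measurableSet_Ioo]
    refine lintegral_congr fun r => ?_
    by_cases h0 : 0 < r
    · by_cases h1 : r < ρ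
      · rw [Set.indicator_of_mem (by exact h0), Set.indicator_of_mem (by exact ⟨h0, h1⟩)]
        refine lintegral_congr fun t => ?_
        have : circleMap 0 r t + c = circleMap c r t := by simp [circleMap, add_comm]
        rw [this, Set.indicator_of_mem]
        rw [Metric.mem_ball, dist_eq_norm]
        simp [circleMap, abs_of_pos h0, h1]
      · rw [Set.indicator_of_mem (by exact h0), Set.indicator_of_notMem (by simp [h1])]
        have : ∀ t, circleMap 0 r t + c ∉ Metric.ball c ρ := by
          intro t
          rw [Metric.mem_ball, dist_eq_norm]
          simp [circleMap, abs_of_pos h0, not_lt.1 h1]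
        simp [Set.indicator_of_notMem (this _)]
    · rw [Set.indicator_of_notMem (by exact h0), Set.indicator_of_notMem (by simp [h0])]
  · exact (hf.indicator Metric.isOpen_ball.measurableSet).comp (measurable_add_const c)

lemma lintegral_ball_rpow (c : ℂ) {ρ a : ℝ} (hρ : 0 < ρ) (ha : -2 < a) :
    ∫⁻ x in Metric.ball c ρ, ENNReal.ofReal (‖x - c‖ ^ a) =
      ENNReal.ofReal (2 * π * (ρ ^ (a + 2) / (a + 2))) := by
  rw [lintegral_ball_polar (by fun_prop)]
  have h1 : ∀ r ∈ Set.Ioo 0 ρ, ∫⁻ t in Set.Ioo (-π) π,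
      ENNReal.ofReal r * ENNReal.ofReal (‖circleMap c r t - c‖ ^ a) =
      ENNReal.ofReal (r ^ (a + 1) * (2 * π)) := by
    intro r hr
    have h2 : ∀ t, ‖circleMap c r t - c‖ = r := by
      intro t; simp [circleMap, abs_of_pos hr.1]
    simp only [h2]
    rw [lintegral_const, ← ENNReal.ofReal_mul hr.1.le, Measure.restrict_apply_univ, Real.volume_Ioo,
      ← ENNReal.ofReal_mul (by have := hr.1; positivity), Real.rpow_add_one hr.1.ne']
    congr 1
    ring
  rw [setLIntegral_congr_fun measurableSet_Ioo h1]
  have h3 : IntegrableOn (fun r : ℝ => r ^ (a + 1) * (2 * π)) (Set.Ioo 0 ρ) := by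
    have := (intervalIntegral.intervalIntegrable_rpow' (a := 0) (b := ρ) (r := a + 1)
      (by linarith)).mul_const (2 * π)
    rw [intervalIntegrable_iff_integrableOn_Ioo_of_le hρ.le] at this
    exact this
  rw [← ofReal_integral_eq_lintegral_ofReal h3]
  · congr 1
    rw [← integral_Ioc_eq_integral_Ioo, ← intervalIntegral.integral_of_le hρ.le,
      intervalIntegral.integral_mul_const, integral_rpow (Or.inl (by linarith))]
    rw [Real.zero_rpow (by linarith)]
    rw [show a + 1 + 1 = a + 2 by ring]
    ring
  · filter_upwards [ae_restrict_mem measurableSet_Ioo] with r hr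
    have := hr.1
    simp only [Pi.zero_apply]
    positivity

lemma volume_ball_real (p : ℂ) {ρ : ℝ} (hρ : 0 < ρ) :
    volume (Metric.ball p ρ) = ENNReal.ofReal (π * ρ ^ 2) := by
  rw [Complex.volume_ball, mul_comm, ENNReal.ofReal_mul Real.pi_pos.le, ← ENNReal.ofReal_pow hρ.le]
  congr 1
  rw [← NNReal.coe_real_pi, ENNReal.ofReal_coe_nnreal]

lemma lintegral_ball_rpow_le (p c : ℂ) {ρ a : ℝ} (hρ : 0 < ρ) (ha : -2 < a) (ha0 : a ≤ 0) :
    ∫⁻ x in Metric.ball p ρ, ENNReal.ofReal (‖x - c‖ ^ a) ≤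
      ENNReal.ofReal (2 * π * (ρ ^ (a + 2) / (a + 2)) + π * ρ ^ (a + 2)) := by
  have hsub : Metric.ball p ρ ⊆ Metric.ball c ρ ∪ (Metric.ball p ρ \ Metric.ball c ρ) := by
    intro x hx
    by_cases h : x ∈ Metric.ball c ρ
    · exact Or.inl h
    · exact Or.inr ⟨hx, h⟩
  have h2 : (0:ℝ) < a + 2 := by linarith
  refine (lintegral_mono_set hsub).trans ((lintegral_union_le _ _ _).trans ?_)
  rw [lintegral_ball_rpow c hρ ha, ENNReal.ofReal_add (by positivity) (by positivity)]
  gcongr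
  calc ∫⁻ x in Metric.ball p ρ \ Metric.ball c ρ, ENNReal.ofReal (‖x - c‖ ^ a)
      ≤ ∫⁻ x in Metric.ball p ρ \ Metric.ball c ρ, ENNReal.ofReal (ρ ^ a) := by
        refine setLIntegral_mono' (measurableSet_ball.diff measurableSet_ball) fun x hx => ?_
        apply ENNReal.ofReal_le_ofReal
        have : ρ ≤ ‖x - c‖ := by
          have := hx.2
          rw [Metric.mem_ball, dist_eq_norm] at this
          exact not_lt.1 this
        exact Real.rpow_le_rpow_of_nonpos hρ this ha0
    _ ≤ ∫⁻ x in Metric.ball p ρ, ENNReal.ofReal (ρ ^ a) := lintegral_mono_set Set.sdiff_subset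
    _ = ENNReal.ofReal (π * ρ ^ (a + 2)) := by
        rw [lintegral_const, Measure.restrict_apply_univ, volume_ball_real p hρ,
          ← ENNReal.ofReal_mul (by positivity), Real.rpow_add hρ]
        congr 1
        norm_num
        ring

lemma lintegral_ball_inv_le (p c : ℂ) {ρ : ℝ} (hρ : 0 < ρ) :
    ∫⁻ x in Metric.ball p ρ, ‖(x - c)⁻¹‖ₑ ≤ ENNReal.ofReal (3 * π * ρ) := by
  have h := lintegral_ball_rpow_le p c hρ (a := -1) (by norm_num) (by norm_num)
  have h1 : ∀ x : ℂ, ‖(x - c)⁻¹‖ₑ = ENNReal.ofReal (‖x - c‖ ^ (-1:ℝ)) := by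
    intro x
    rw [Real.rpow_neg_one, ← norm_inv, ofReal_norm]
  simp only [h1]
  refine h.trans (ENNReal.ofReal_le_ofReal ?_)
  norm_num
  linarith

/-- sub mean value inequality -/
lemma submean {g : ℂ → ℂ} {c : ℂ} {ρ : ℝ} (hρ : 0 < ρ) (hm : Measurable g)
    (hg : DifferentiableOn ℂ g (Metric.ball c ρ)) :
    ENNReal.ofReal (π * ρ ^ 2) * ‖g c‖ₑ ≤ ∫⁻ x in Metric.ball c ρ, ‖g x‖ₑ := by
  rw [lintegral_ball_polar hm.enorm]
  have h1 : ∀ r ∈ Set.Ioo 0 ρ, ENNReal.ofReal (2 * π * r) * ‖g c‖ₑ ≤ ∫⁻ t in Set.Ioo (-π) π,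
      ENNReal.ofReal r * ‖g (circleMap c r t)‖ₑ := by
    intro r hr
    have hd : DiffContOnCl ℂ g (Metric.ball c |r|) := by
      rw [abs_of_pos hr.1]
      apply DifferentiableOn.diffContOnCl
      rw [closure_ball c hr.1.ne']
      exact hg.mono (Metric.closedBall_subset_ball hr.2)
    have h2 := hd.circleAverage
    rw [circleAverage_eq_integral_add (-π)] at h2
    have h3 : ∫ t in (-π)..π, g (circleMap c r t) = (2 * π) * g c := by
      have h4 := intervalIntegral.integral_comp_add_right (fun t => g (circleMap c r t)) (-π)
        (a := 0) (b := 2 * π)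
      rw [h4] at h2
      rw [← h2]
      simp only [zero_add, Complex.real_smul]
      rw [show 2 * π + -π = π by ring]
      push_cast
      field_simp
    rw [lintegral_const_mul _ (by fun_prop), mul_comm (2 * π), ENNReal.ofReal_mul hr.1.le, mul_assoc]
    gcongr
    rw [intervalIntegral.integral_of_le (by linarith [Real.pi_pos]), integral_Ioc_eq_integral_Ioo] at h3
    have h5 := enorm_integral_le_lintegral_enorm (μ := volume.restrict (Set.Ioo (-π) π))
      (fun t => g (circleMap c r t))
    rw [h3, enorm_mul] at h5
    refine le_trans (le_of_eq ?_) h5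
    congr 1
    rw [← ofReal_norm]
    congr 1
    simp [abs_of_pos Real.pi_pos]
  calc ENNReal.ofReal (π * ρ ^ 2) * ‖g c‖ₑ
      = ∫⁻ r in Set.Ioo 0 ρ, ENNReal.ofReal (2 * π * r) * ‖g c‖ₑ := by
        rw [lintegral_mul_const _ (by fun_prop)]
        congr 1
        rw [← ofReal_integral_eq_lintegral_ofReal]
        · congr 1
          rw [← integral_Ioc_eq_integral_Ioo, ← intervalIntegral.integral_of_le hρ.le,
            intervalIntegral.integral_const_mul, integral_id]
          ring
        · exact (Continuous.integrableOn_Icc (by fun_prop)).mono_set Set.Ioo_subset_Icc_self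
        · filter_upwards [ae_restrict_mem measurableSet_Ioo] with r hr
          have := hr.1
          simp only [Pi.zero_apply]
          positivity
    _ ≤ _ := setLIntegral_mono' measurableSet_Ioo h1



/-! ### Change of variables and the transfer inequality -/

lemma lintegral_image_holo {s : Set ℂ} (hs : MeasurableSet s) {f f' : ℂ → ℂ}
    (hf' : ∀ x ∈ s, HasDerivAt f (f' x) x) (hf : Set.InjOn f s) (g : ℂ → ENNReal) :
    ∫⁻ x in f '' s, g x = ∫⁻ x in s, ‖f' x ^ 2‖ₑ * g (f x) := by
  rw [lintegral_image_eq_lintegral_abs_det_fderiv_mul volume hs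
    (f' := fun x => (f' x) • (1 : ℂ →L[ℝ] ℂ))
    (fun x hx => (hf' x hx).complexToReal_fderiv.hasFDerivWithinAt) hf]
  refine setLIntegral_congr_fun hs fun x _ => ?_
  congr 1
  have h1 : (f' x • (1 : ℂ →L[ℝ] ℂ)) =
      (ContinuousLinearMap.restrictScalars ℝ (f' x • (1 : ℂ →L[ℂ] ℂ))) := by
    ext <;> simp
  have h2 : (f' x • (1 : ℂ →L[ℝ] ℂ)).det = ‖f' x‖ ^ 2 := by
    have h3 : (f' x • (1 : ℂ →L[ℝ] ℂ)).det =
        LinearMap.det ((f' x • (1 : ℂ →ₗ[ℂ] ℂ)).restrictScalars ℝ) := by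
      rw [h1]; rfl
    rw [h3, LinearMap.det_restrictScalars]
    simp [Algebra.norm_complex_eq, Complex.normSq_eq_norm_sq]
  rw [h2, abs_of_nonneg (by positivity), ← norm_pow, ofReal_norm]

lemma prim_sum {d : ℕ} (hd : 1 < d) {w : ℂ} (hw : IsPrimitiveRoot w d) (i : ℕ) (hi : i < d) :
    ∑ j ∈ Finset.range d, (w ^ j) ^ (i + 2) = if i + 2 = d then (d : ℂ) else 0 := by
  have h1 : ∀ j, (w ^ j) ^ (i + 2) = (w ^ (i + 2)) ^ j := fun j => by
    rw [← pow_mul, ← pow_mul, mul_comm]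
  simp only [h1]
  split_ifs with h
  · rw [h, hw.pow_eq_one]; simp
  · have h2 : w ^ (i + 2) ≠ 1 := by
      intro hc
      have h3 := (hw.pow_eq_one_iff_dvd _).1 hc
      obtain ⟨k, hk⟩ := h3
      have : k ≠ 0 := by rintro rfl; omega
      have : k ≠ 1 := by rintro rfl; omega
      have : 2 ≤ k := by omega
      nlinarith
    have h3 := mul_geom_sum (w ^ (i + 2)) d
    rw [← pow_mul, mul_comm (i + 2) d, pow_mul, hw.pow_eq_one, one_pow, sub_self] at h3
    exact (mul_eq_zero.1 h3).resolve_left (sub_ne_zero.2 h2)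

lemma root_identity {d : ℕ} (hd : 1 < d) {w : ℂ} (hw : IsPrimitiveRoot w d) {y a : ℂ}
    (h : y ^ d ≠ a ^ d) :
    ∑ j ∈ Finset.range d, (w ^ j) ^ 2 / (w ^ j * y - a) = d * a * y ^ (d - 2) / (y ^ d - a ^ d) := by
  have h0 : y ^ d - a ^ d ≠ 0 := sub_ne_zero.2 h
  have h1 : ∀ j, (w ^ j) ^ 2 / (w ^ j * y - a) =
      ∑ i ∈ Finset.range d, (w ^ j) ^ (i + 2) * (y ^ i * a ^ (d - 1 - i)) / (y ^ d - a ^ d) := by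
    intro j
    have h2 : (w ^ j * y) ^ d = y ^ d := by
      rw [mul_pow, ← pow_mul, mul_comm j, pow_mul, hw.pow_eq_one, one_pow, one_mul]
    have h3 := (Commute.all (w ^ j * y) a).geom_sum₂_mul (n := d)
    rw [h2] at h3
    have h4 : w ^ j * y - a ≠ 0 := by
      intro hc
      rw [hc, mul_zero] at h3
      exact h0 h3.symm
    rw [← Finset.sum_div, div_eq_div_iff h4 h0, ← h3, ← mul_assoc, Finset.mul_sum]
    congr 1
    refine Finset.sum_congr rfl fun i _ => ?_
    rw [mul_pow]; ring
  simp only [h1]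
  rw [Finset.sum_comm]
  have h5 : ∀ i ∈ Finset.range d, ∑ j ∈ Finset.range d,
      (w ^ j) ^ (i + 2) * (y ^ i * a ^ (d - 1 - i)) / (y ^ d - a ^ d) =
      if i = d - 2 then (d : ℂ) * (y ^ i * a ^ (d - 1 - i)) / (y ^ d - a ^ d) else 0 := by
    intro i hi
    rw [← Finset.sum_div, ← Finset.sum_mul, prim_sum hd hw i (Finset.mem_range.1 hi)]
    by_cases h : i + 2 = d
    · rw [if_pos h, if_pos (by omega)]
    · rw [if_neg h, if_neg (by omega)]; simp
  rw [Finset.sum_congr rfl h5, Finset.sum_ite_eq', if_pos (Finset.mem_range.2 (by omega)),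
    show d - 1 - (d - 2) = 1 by omega, pow_one]
  ring

lemma transfer {d : ℕ} (hd : 1 < d) {w : ℂ} (hw : IsPrimitiveRoot w d) (lam : ℂ) {q Q : ℂ → ℂ}
    (hq : Measurable q)
    (h : ∀ᵐ y : ℂ, ‖((d : ℂ) * y ^ (d - 1)) ^ 2 * Q (fc d lam y)‖ ≤
      ∑ j ∈ Finset.range d, ‖q (w ^ j * y)‖) {V : Set ℂ} (hV : MeasurableSet V) :
    ∫⁻ x in V, ‖Q x‖ₑ ≤ ∫⁻ x in (fc d lam) ⁻¹' V, ‖q x‖ₑ := by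
  have hd0 : d ≠ 0 := by omega
  have hfc : Measurable (fc d lam) := by unfold fc; fun_prop
  have hw0 : w ≠ 0 := hw.ne_zero hd0
  set S : Set ℂ := {y | y ≠ 0 ∧ (y ^ d) ^ ((d : ℂ)⁻¹) = y} with hS
  have hSm : MeasurableSet S := by
    have h1 : Measurable (fun y : ℂ => (y ^ d) ^ ((d : ℂ)⁻¹)) := by fun_prop
    exact (measurableSet_singleton (0:ℂ)).compl.inter (measurableSet_eq_fun h1 measurable_id)
  have hSinj : ∀ y ∈ S, ∀ y' ∈ S, y ^ d = y' ^ d → y = y' := by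
    intro y hy y' hy' he
    rw [← hy.2, ← hy'.2, he]
  set T := S ∩ (fc d lam) ⁻¹' V with hT
  have hTm : MeasurableSet T := hSm.inter (hfc hV)
  have himg : (fc d lam) '' T = V \ {lam} := by
    ext x
    constructor
    · rintro ⟨y, hy, rfl⟩
      refine ⟨hy.2, ?_⟩
      simp only [fc, Set.mem_singleton_iff, add_eq_right]
      exact pow_ne_zero _ hy.1.1
    · rintro ⟨hx, hx'⟩
      have hx0 : x - lam ≠ 0 := sub_ne_zero.2 hx'
      have h1 : ((x - lam) ^ ((d : ℂ)⁻¹)) ^ d = x - lam := Complex.cpow_nat_inv_pow _ hd0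
      have h2 : fc d lam ((x - lam) ^ ((d : ℂ)⁻¹)) = x := by simp [fc, h1]
      refine ⟨(x - lam) ^ ((d : ℂ)⁻¹), ⟨⟨?_, ?_⟩, ?_⟩, h2⟩
      · intro hc
        rw [hc, zero_pow hd0] at h1
        exact hx0 h1.symm
      · rw [h1]
      · rw [Set.mem_preimage, h2]; exact hx
  have hae : ∫⁻ x in V, ‖Q x‖ₑ = ∫⁻ x in V \ {lam}, ‖Q x‖ₑ := by
    apply setLIntegral_congr
    exact (sdiff_null_ae_eq_self (measure_singleton lam)).symm
  have hder : ∀ y, HasDerivAt (fc d lam) ((d : ℂ) * y ^ (d - 1)) y := by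
    intro y
    unfold fc
    exact (hasDerivAt_pow d y).add_const lam
  rw [hae, ← himg, lintegral_image_holo hTm (fun y _ => hder y)]
  · have hrot : ∀ j, ∫⁻ y in T, ‖q (w ^ j * y)‖ₑ = ∫⁻ x in (fun y => w ^ j * y) '' T, ‖q x‖ₑ := by
      intro j
      rw [lintegral_image_holo hTm (f' := fun _ => w ^ j)]
      · refine lintegral_congr fun y => ?_
        have : ‖(w ^ j) ^ 2‖ₑ = 1 := by
          rw [← ofReal_norm, norm_pow, norm_pow, hw.norm'_eq_one hd0]; simp
        rw [this, one_mul]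
      · intro y _
        simpa using (hasDerivAt_id y).const_mul (w ^ j)
      · intro a _ b _ hab
        exact mul_left_cancel₀ (pow_ne_zero _ hw0) hab
    calc ∫⁻ y in T, ‖((d : ℂ) * y ^ (d - 1)) ^ 2‖ₑ * ‖Q (fc d lam y)‖ₑ
        ≤ ∫⁻ y in T, ∑ j ∈ Finset.range d, ‖q (w ^ j * y)‖ₑ := by
          refine lintegral_mono_ae (ae_restrict_of_ae ?_)
          filter_upwards [h] with y hy
          rw [← enorm_mul, ← ofReal_norm]
          refine (ENNReal.ofReal_le_ofReal hy).trans ?_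
          rw [ENNReal.ofReal_sum_of_nonneg (fun _ _ => norm_nonneg _)]
          simp only [ofReal_norm, le_refl]
      _ = ∑ j ∈ Finset.range d, ∫⁻ y in T, ‖q (w ^ j * y)‖ₑ := by
          rw [lintegral_finsetSum]
          intro j _
          fun_prop
      _ = ∑ j ∈ Finset.range d, ∫⁻ x in (fun y => w ^ j * y) '' T, ‖q x‖ₑ :=
          Finset.sum_congr rfl fun j _ => hrot j
      _ = ∫⁻ x in ⋃ j ∈ Finset.range d, (fun y => w ^ j * y) '' T, ‖q x‖ₑ := by
          rw [lintegral_biUnion_finset]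
          · intro i hi j hj hij
            rw [Function.onFun, Set.disjoint_left]
            rintro x ⟨y, hy, rfl⟩ ⟨y', hy', he⟩
            simp only at he
            have hpow : ∀ k, ∀ u : ℂ, (w ^ k * u) ^ d = u ^ d := by
              intro k u
              rw [mul_pow, ← pow_mul, mul_comm k, pow_mul, hw.pow_eq_one, one_pow, one_mul]
            have h1 : y ^ d = y' ^ d := by rw [← hpow i y, ← hpow j y', he]
            have h2 := hSinj y hy.1 y' hy'.1 h1
            rw [← h2] at he
            have h3 := mul_right_cancel₀ hy.1.1 he
            exact hij (hw.pow_inj (Finset.mem_range.1 hi) (Finset.mem_range.1 hj) h3.symm)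
          · intro j _
            have : (fun y => w ^ j * y) '' T = (fun y => (w ^ j)⁻¹ * y) ⁻¹' T := by
              ext x
              constructor
              · rintro ⟨y, hy, rfl⟩
                simpa [inv_mul_cancel_left₀ (pow_ne_zero j hw0)] using hy
              · intro hx
                exact ⟨_, hx, by simp [mul_inv_cancel_left₀ (pow_ne_zero j hw0)]⟩
            rw [this]
            exact (measurable_const_mul _) hTm
      _ ≤ ∫⁻ x in (fc d lam) ⁻¹' V, ‖q x‖ₑ := by
          apply lintegral_mono_set
          refine Set.iUnion₂_subset fun j _ => ?_
          rintro x ⟨y, hy, rfl⟩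
          have h1 := hy.2
          simp only [Set.mem_preimage, fc] at h1 ⊢
          rwa [mul_pow, ← pow_mul, mul_comm j, pow_mul, hw.pow_eq_one, one_pow, one_mul]
  · intro y hy y' hy' he
    exact hSinj y hy.1 y' hy'.1 (by simpa [fc] using he)



/-! ### Attracting cycles -/

lemma norm_pow_sub_pow_le_aux {d : ℕ} {a b : ℂ} {R : ℝ} (ha : ‖a‖ ≤ R) (hb : ‖b‖ ≤ R) :
    ‖a ^ d - b ^ d‖ ≤ d * R ^ (d - 1) * ‖a - b‖ := by
  have hR : 0 ≤ R := (norm_nonneg a).trans ha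
  rw [← (Commute.all a b).geom_sum₂_mul (n := d), norm_mul]
  gcongr
  calc ‖∑ i ∈ Finset.range d, a ^ i * b ^ (d - 1 - i)‖
      ≤ ∑ i ∈ Finset.range d, R ^ (d - 1) := by
        refine norm_sum_le_of_le _ fun i hi => ?_
        rw [norm_mul, norm_pow, norm_pow]
        have : R ^ (d - 1) = R ^ i * R ^ (d - 1 - i) := by
          rw [← pow_add]; congr 1; have := Finset.mem_range.1 hi; omega
        rw [this]
        gcongr
    _ = d * R ^ (d - 1) := by simp

lemma attr_dist {d : ℕ} (hd : 1 < d) {lam : ℂ} {m : ℕ} (hm : 1 ≤ m)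
    (hb : ∀ j ≤ m, ‖orb d lam j‖ ^ (d - 1) < 2) {δ : ℝ} (hδ : 0 < δ) (hδ1 : δ ≤ 1)
    (h : 12 * d * m * (2 * d) ^ m * δ ^ (d - 1) ≤ 1) {z : ℂ} (hz : ‖z‖ ≤ δ) {k : ℕ} (hk1 : 1 ≤ k)
    (hk : k ≤ m) : ‖(fc d lam)^[k] z - orb d lam k‖ ≤ δ / 4 := by
  have hd1 : (1:ℝ) < d := by exact_mod_cast hd
  have hm1 : (1:ℝ) ≤ m := by exact_mod_cast hm
  have hδd : δ ^ d = δ ^ (d - 1) * δ := by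
    rw [← pow_succ]; congr 1; omega
  set η : ℝ := 1 / (d * m) with hη
  have hη0 : 0 < η := by positivity
  set A : ℝ := (1 + η) ^ (d - 1) with hA
  have hA1 : 1 ≤ A := one_le_pow₀ (by linarith)
  have hAm : A ^ m ≤ 3 := by
    have h1 : A ≤ Real.exp ((d - 1 : ℕ) * η) := by
      rw [hA, Real.exp_nat_mul]
      gcongr
      linarith [Real.add_one_le_exp η]
    have h2 : A ^ m ≤ Real.exp (m * ((d - 1 : ℕ) * η)) := by
      rw [Real.exp_nat_mul]
      gcongr
    have h3 : (m:ℝ) * ((d - 1 : ℕ) * η) ≤ 1 := by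
      have : ((d - 1 : ℕ) : ℝ) ≤ d := by exact_mod_cast Nat.sub_le d 1
      calc (m:ℝ) * ((d - 1 : ℕ) * η) ≤ m * (d * η) := by gcongr
        _ = 1 := by rw [hη]; field_simp
    have h4 := Real.exp_le_exp.2 h3
    have h5 := Real.exp_one_lt_d9
    linarith
  have hfin : ∀ k : ℕ, k + 1 ≤ m → (2 * d) ^ k * A ^ k * δ ^ d ≤ δ / (4 * d * m) := by
    intro k hk
    have h1 : A ^ k ≤ 3 := (pow_le_pow_right₀ hA1 (by omega)).trans hAm
    have h2 : (2 * (d:ℝ)) ^ k ≤ (2 * d) ^ m := pow_le_pow_right₀ (by linarith) (by omega)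
    calc (2 * (d:ℝ)) ^ k * A ^ k * δ ^ d ≤ (2 * d) ^ m * 3 * δ ^ d := by gcongr
      _ = (12 * d * m * (2 * d) ^ m * δ ^ (d - 1)) * (δ / (4 * d * m)) := by
        rw [hδd]; field_simp; ring
      _ ≤ 1 * (δ / (4 * d * m)) := by gcongr
      _ = _ := one_mul _
  have key : ∀ k : ℕ, k + 1 ≤ m → ‖(fc d lam)^[k + 1] z - orb d lam (k + 1)‖ ≤
      (2 * d) ^ k * A ^ k * δ ^ d := by
    intro k
    induction k with
    | zero =>
      intro _
      simp only [zero_add, Function.iterate_one, pow_zero, one_mul, orb_one hd]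
      simp only [fc, add_sub_cancel_right, norm_pow]
      gcongr
    | succ k ih =>
      intro hk
      have h1 := ih (by omega)
      have h2 := h1.trans (hfin k (by omega))
      set y := (fc d lam)^[k + 1] z with hy
      set c := orb d lam (k + 1) with hc
      have h3 : ‖y - c‖ ≤ η := by
        refine h2.trans ?_
        rw [hη, div_le_div_iff₀ (by positivity) (by positivity)]
        nlinarith [mul_pos (lt_trans one_pos hd1) (lt_of_lt_of_le one_pos hm1)]
      have h4 : (‖c‖ + η) ^ (d - 1) ≤ 2 * A := by
        have hcb := hb (k + 1) (by omega)
        rcases le_total 1 ‖c‖ with h | h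
        · calc (‖c‖ + η) ^ (d - 1) ≤ (‖c‖ * (1 + η)) ^ (d - 1) := by
                gcongr; nlinarith
            _ = ‖c‖ ^ (d - 1) * A := by rw [mul_pow]
            _ ≤ 2 * A := by gcongr
        · calc (‖c‖ + η) ^ (d - 1) ≤ A := by rw [hA]; gcongr
            _ ≤ 2 * A := by linarith
      rw [Function.iterate_succ_apply', orb_succ, ← hy, ← hc]
      have h5 : fc d lam y - (c ^ d + lam) = y ^ d - c ^ d := by simp [fc]
      rw [h5]
      have h6 : ‖y‖ ≤ ‖c‖ + η := by
        have := norm_add_le (y - c) c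
        rw [sub_add_cancel] at this
        linarith
      calc ‖y ^ d - c ^ d‖ ≤ d * (‖c‖ + η) ^ (d - 1) * ‖y - c‖ :=
            norm_pow_sub_pow_le_aux h6 (by linarith)
        _ ≤ d * (2 * A) * ((2 * d) ^ k * A ^ k * δ ^ d) := by gcongr
        _ = _ := by ring
  obtain ⟨j, rfl⟩ : ∃ j, k = j + 1 := ⟨k - 1, by omega⟩
  refine (key j hk).trans ((hfin j hk).trans ?_)
  rw [div_le_div_iff₀ (by positivity) (by norm_num)]
  nlinarith [mul_le_mul hd1.le hm1 zero_le_one (by linarith)]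

lemma attr_bounded {d : ℕ} (hd : 1 < d) {lam : ℂ} {m : ℕ} (hm : 1 ≤ m) {δ : ℝ} (hδ : 0 < δ)
    (hδ1 : δ ≤ 1) (h : 12 * d * m * (2 * d) ^ m * δ ^ (d - 1) ≤ 1)
    (hF : ‖orb d lam m‖ ≤ δ / 4) (k : ℕ) : ‖orb d lam k‖ ≤ 3 := by
  have hb := (orb_bound hd hm (by linarith : ‖orb d lam m‖ < 1)).2
  have h1 : ∀ j : ℕ, ‖orb d lam (m * j)‖ ≤ δ := by
    intro j
    induction j with
    | zero => simpa [orb_zero] using hδ.le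
    | succ j ih =>
      have h2 := attr_dist hd hm hb hδ hδ1 h ih hm le_rfl
      rw [← orb_add] at h2
      have h3 := norm_add_le (orb d lam (m + m * j) - orb d lam m) (orb d lam m)
      rw [sub_add_cancel] at h3
      rw [mul_add, mul_one, add_comm]
      linarith
  rcases Nat.eq_zero_or_pos (k % m) with h0 | h0
  · have : k = m * (k / m) := by have := Nat.mod_add_div k m; omega
    rw [this]
    linarith [h1 (k / m)]
  · have hlt := Nat.mod_lt k hm
    have h2 := attr_dist hd hm hb hδ hδ1 h (h1 (k / m)) h0 hlt.le
    rw [← orb_add, Nat.mod_add_div] at h2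
    have h3 := norm_add_le (orb d lam k - orb d lam (k % m)) (orb d lam (k % m))
    rw [sub_add_cancel] at h3
    have h4 := norm_le_two_of_pow_lt hd (norm_nonneg _) (hb (k % m) hlt.le)
    linarith

/-- choice of scales -/
lemma exists_scales {d : ℕ} (hd : 1 < d) {M : ℝ} (hM : 1 ≤ M) :
    ∃ (δ ε : ℕ → ℝ) (B : ℝ), ∀ m : ℕ, 1 ≤ m →
      0 < δ m ∧ δ m ≤ 1 ∧ 0 < ε m ∧ M * ε m ≤ δ m ∧ M * m * (2 * d) ^ m * δ m ^ (d - 1) ≤ 1 ∧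
      M * (ε m) ^ ((24:ℝ) / 25) ≤ δ m ∧
      ((d:ℝ) - 1) * Real.log (1 / ε m) ≤ 2.2 * Real.log d * m + B := by
  have hd1 : (1:ℝ) < d := by exact_mod_cast hd
  have hd2 : (2:ℝ) ≤ d := by exact_mod_cast hd
  set D : ℝ := (d:ℝ) - 1 with hD
  have hD0 : 0 < D := by linarith
  have hDn : ((d - 1 : ℕ) : ℝ) = D := by
    rw [Nat.cast_sub hd.le]; simp [hD]
  set L : ℝ := Real.log (2 * d) with hL
  have hL1 : Real.log 2 < L := Real.log_lt_log (by norm_num) (by linarith)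
  have hL0 : 0.69 < L := by
    have := Real.log_two_gt_d9
    linarith
  have hLd : L ≤ 2 * Real.log d := by
    rw [hL, ← Real.log_rpow (by linarith)]
    apply Real.log_le_log (by linarith)
    norm_num
    nlinarith
  set P : ℝ := Real.log M with hP
  have hP0 : 0 ≤ P := Real.log_nonneg hM
  have hMe : M = Real.exp P := by rw [hP, Real.exp_log (by linarith)]
  -- δ = exp (-(1.05 L m + K1)/D), ε = exp(-(1.1 L m + K2)/D)
  set K1 : ℝ := P + 30 * D + 30 with hK1
  have hK10 : 0 < K1 := by positivity
  set K2 : ℝ := 2 * K1 + 2 * P * D with hK2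
  have hK20 : 0 < K2 := by positivity
  refine ⟨fun m => Real.exp (-(1.05 * L * m + K1) / D), fun m => Real.exp (-(1.1 * L * m + K2) / D),
    K2, fun m hm => ?_⟩
  have hm1 : (1:ℝ) ≤ m := by exact_mod_cast hm
  have hLm : 0 < L * m := by positivity
  refine ⟨Real.exp_pos _, ?_, Real.exp_pos _, ?_, ?_, ?_, ?_⟩
  · rw [Real.exp_le_one_iff, div_nonpos_iff]
    right
    constructor <;> nlinarith
  · rw [hMe, ← Real.exp_add, Real.exp_le_exp]
    rw [← sub_nonneg]
    have : -(1.05 * L * m + K1) / D - (P + -(1.1 * L * m + K2) / D) =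
      (0.05 * (L * m) + K2 - K1 - P * D) / D := by field_simp; ring
    rw [this]
    apply div_nonneg _ hD0.le
    have : 0 ≤ P * D := by positivity
    linarith
  · have h1 : Real.exp (-(1.05 * L * m + K1) / D) ^ (d - 1) = Real.exp (-(1.05 * L * m + K1)) := by
      rw [← Real.exp_nat_mul, hDn]
      congr 1
      field_simp
    have h2 : (2 * (d:ℝ)) ^ m = Real.exp (L * m) := by
      rw [mul_comm L, Real.exp_nat_mul, hL, Real.exp_log (by linarith)]
    have h3 : (m:ℝ) ≤ Real.exp (0.05 * L * m + 30) := by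
      have h4 := Real.add_one_le_exp (0.03 * (m:ℝ))
      have h5 : (34:ℝ) ≤ Real.exp 30 := by
        have := Real.quadratic_le_exp_of_nonneg (x := 30) (by norm_num)
        linarith
      have h6 : Real.exp (0.03 * (m:ℝ)) ≤ Real.exp (0.05 * L * m) := by
        rw [Real.exp_le_exp]; nlinarith
      rw [Real.exp_add]
      nlinarith [Real.exp_pos (0.05 * L * m)]
    rw [h1, h2, hMe]
    calc Real.exp P * m * Real.exp (L * m) * Real.exp (-(1.05 * L * m + K1))
        ≤ Real.exp P * Real.exp (0.05 * L * m + 30) * Real.exp (L * m)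
          * Real.exp (-(1.05 * L * m + K1)) := by gcongr
      _ = Real.exp (P + 30 - K1) := by
        rw [← Real.exp_add, ← Real.exp_add, ← Real.exp_add]
        congr 1; ring
      _ ≤ 1 := by
        rw [Real.exp_le_one_iff]; linarith
  · rw [hMe, ← Real.exp_mul, ← Real.exp_add, Real.exp_le_exp, ← sub_nonneg]
    have : -(1.05 * L * m + K1) / D - (P + -(1.1 * L * m + K2) / D * (24 / 25)) =
      (0.006 * (L * m) + K2 * (24 / 25) - K1 - P * D) / D := by field_simp; ring
    rw [this]
    apply div_nonneg _ hD0.le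
    have : 0 ≤ P * D := by positivity
    rw [hK2]
    linarith
  · rw [one_div, ← Real.exp_neg, Real.log_exp]
    have : D * -(-(1.1 * L * m + K2) / D) = 1.1 * L * m + K2 := by field_simp
    rw [this]
    nlinarith



/-! ### Transversality -/

/-- derivative coefficients -/
noncomputable def ac (d : ℕ) (lam : ℂ) (m k : ℕ) : ℂ :=
  ∏ i ∈ Finset.Ico k m, ((d : ℂ) * orb d lam i ^ (d - 1))

lemma ac_self (d : ℕ) (lam : ℂ) (m : ℕ) : ac d lam m m = 1 := by simp [ac]

lemma ac_rec (d : ℕ) (lam : ℂ) {m k : ℕ} (h : k < m) :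
    ac d lam m k = (d : ℂ) * orb d lam k ^ (d - 1) * ac d lam m (k + 1) := by
  rw [ac, ac, Finset.prod_eq_prod_Ico_succ_bot h]

lemma ac_succ (d : ℕ) (lam : ℂ) {m k : ℕ} (h : k ≤ m) :
    ac d lam (m + 1) k = ac d lam m k * ((d : ℂ) * orb d lam m ^ (d - 1)) := by
  rw [ac, ac, Finset.prod_Ico_succ_top h]

lemma ac_norm {d : ℕ} {lam : ℂ} {m : ℕ} (hd : 1 < d)
    (hb : ∀ j ≤ m, ‖orb d lam j‖ ^ (d - 1) < 2) (k : ℕ) : ‖ac d lam m k‖ ≤ (2 * d) ^ m := by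
  have hd1 : (1:ℝ) < d := by exact_mod_cast hd
  rw [ac, norm_prod]
  calc ∏ i ∈ Finset.Ico k m, ‖(d : ℂ) * orb d lam i ^ (d - 1)‖
      ≤ ∏ i ∈ Finset.Ico k m, (2 * (d:ℝ)) := by
        refine Finset.prod_le_prod (fun i _ => norm_nonneg _) fun i hi => ?_
        have := hb i (Finset.mem_Ico.1 hi).2.le
        rw [norm_mul, norm_pow, Complex.norm_natCast]
        nlinarith
    _ = (2 * (d:ℝ)) ^ (m - k) := by simp
    _ ≤ _ := pow_le_pow_right₀ (by linarith) (by omega)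

lemma orb_hasDerivAt (d : ℕ) (lam : ℂ) (m : ℕ) :
    HasDerivAt (fun l => orb d l m) (∑ k ∈ Finset.Ico 1 (m + 1), ac d lam m k) lam := by
  induction m with
  | zero => simpa [orb_zero] using hasDerivAt_const lam (0:ℂ)
  | succ m ih =>
    have h1 : (fun l => orb d l (m + 1)) = fun l => orb d l m ^ d + l := by
      funext l; rw [orb_succ]
    rw [h1]
    refine ((ih.pow d).add (hasDerivAt_id lam)).congr_deriv ?_
    symm
    rw [Finset.sum_Ico_succ_top (by omega), ac_self, Finset.mul_sum]
    congr 1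
    refine Finset.sum_congr rfl fun k hk => ?_
    rw [ac_succ d lam (by have := Finset.mem_Ico.1 hk; omega)]
    ring

/-- the rational function with poles along the orbit -/
noncomputable def qf (d : ℕ) (lam : ℂ) (m : ℕ) (x : ℂ) : ℂ :=
  ∑ k ∈ Finset.Ico 1 (m + 1), ac d lam m k / (x - orb d lam k)

noncomputable def ef (d : ℕ) (lam : ℂ) (m : ℕ) (x : ℂ) : ℂ :=
  orb d lam m / d / ((x - lam) * (x - orb d lam (m + 1)))

lemma qf_identity {d : ℕ} (hd : 1 < d) {w : ℂ} (hw : IsPrimitiveRoot w d) {lam : ℂ} {m : ℕ}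
    (hm : 1 ≤ m) (hs : ∑ k ∈ Finset.Ico 1 (m + 1), ac d lam m k = 0) {y : ℂ} (hy : y ≠ 0)
    (hyk : ∀ k ∈ Finset.Ico 1 (m + 1), y ^ d ≠ orb d lam k ^ d) :
    ((d : ℂ) * y ^ (d - 1)) ^ 2 * (qf d lam m (fc d lam y) + ef d lam m (fc d lam y)) =
      ∑ j ∈ Finset.range d, (w ^ j) ^ 2 * qf d lam m (w ^ j * y) := by
  have hd0 : (d : ℂ) ≠ 0 := by exact_mod_cast (by omega : d ≠ 0)
  have hR : ∑ j ∈ Finset.range d, (w ^ j) ^ 2 * qf d lam m (w ^ j * y) =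
      ∑ k ∈ Finset.Ico 1 (m + 1),
        ac d lam m k * (d * orb d lam k * y ^ (d - 2) / (y ^ d - orb d lam k ^ d)) := by
    simp only [qf, Finset.mul_sum]
    rw [Finset.sum_comm]
    refine Finset.sum_congr rfl fun k hk => ?_
    rw [← root_identity hd hw (hyk k hk), Finset.mul_sum]
    refine Finset.sum_congr rfl fun j _ => ?_
    ring
  rw [hR]
  have hp1 : y ^ (d - 1) = y ^ (d - 2) * y := by rw [← pow_succ]; congr 1; omega
  have hp2 : y ^ d = y ^ (d - 2) * y * y := by rw [← pow_succ, ← pow_succ]; congr 1; omega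
  have hu : y ^ d ≠ 0 := pow_ne_zero _ hy
  -- split sums
  have hm' : m ∈ Finset.Ico 1 (m + 1) := by simp [hm]
  rw [Finset.sum_Ico_succ_top hm, ac_self]
  have hmid : ∀ k ∈ Finset.Ico 1 m,
      ac d lam m k * (d * orb d lam k * y ^ (d - 2) / (y ^ d - orb d lam k ^ d)) =
      (d * y ^ (d - 1)) ^ 2 * (ac d lam m (k + 1) / (fc d lam y - orb d lam (k + 1)))
        - d ^ 2 * y ^ (d - 2) * ac d lam m (k + 1) := by
    intro k hk
    have hk' := Finset.mem_Ico.1 hk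
    have h0 : y ^ d - orb d lam k ^ d ≠ 0 :=
      sub_ne_zero.2 (hyk k (Finset.mem_Ico.2 ⟨hk'.1, by omega⟩))
    have h1 : fc d lam y - orb d lam (k + 1) = y ^ d - orb d lam k ^ d := by
      rw [orb_succ, fc]; ring
    have h2 : orb d lam k ^ d = orb d lam k ^ (d - 1) * orb d lam k := by
      rw [← pow_succ]; congr 1; omega
    rw [h1, ac_rec d lam hk'.2]
    have h3 : (d * y ^ (d - 1)) ^ 2 = d ^ 2 * y ^ (d - 2) * y ^ d := by
      rw [hp1, hp2]; ring
    rw [h3]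
    field_simp
    rw [h2]
    ring
  rw [Finset.sum_congr rfl hmid, Finset.sum_sub_distrib, ← Finset.mul_sum, ← Finset.mul_sum]
  rw [Finset.sum_Ico_add' (fun k => ac d lam m k / (fc d lam y - orb d lam k)) 1 m 1,
    Finset.sum_Ico_add' (fun k => ac d lam m k) 1 m 1]
  have hs1 : ∑ k ∈ Finset.Ico (1 + 1) (m + 1), ac d lam m k = - ac d lam m 1 := by
    rw [Finset.sum_eq_sum_Ico_succ_bot (by omega)] at hs
    linear_combination hs
  have hq1 : qf d lam m (fc d lam y) = ac d lam m 1 / (y ^ d) +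
      ∑ k ∈ Finset.Ico (1 + 1) (m + 1), ac d lam m k / (fc d lam y - orb d lam k) := by
    rw [qf, Finset.sum_eq_sum_Ico_succ_bot (by omega), orb_one hd]
    congr 2
    simp [fc]
  rw [hs1, hq1, ef]
  have h1 : fc d lam y - orb d lam (m + 1) = y ^ d - orb d lam m ^ d := by
    rw [orb_succ, fc]; ring
  have h2 : fc d lam y - lam = y ^ d := by simp [fc]
  have h0 : y ^ d - orb d lam m ^ d ≠ 0 := sub_ne_zero.2 (hyk m hm')
  rw [h1, h2]
  have h3 : (d * y ^ (d - 1)) ^ 2 = d ^ 2 * y ^ (d - 2) * y ^ d := by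
    rw [hp1, hp2]; ring
  rw [h3]
  field_simp
  ring

lemma finite_pow_eq {d : ℕ} (hd : 1 < d) (b : ℂ) : {y : ℂ | y ^ d = b}.Finite := by
  have h : (X ^ d - C b : ℂ[X]) ≠ 0 := X_pow_sub_C_ne_zero (by omega) b
  refine (Polynomial.finite_setOfPred_isRoot h).subset fun y hy => ?_
  simp only [Set.mem_ofPred_eq] at hy
  simp [IsRoot, hy]

lemma ae_pow_ne {d : ℕ} (hd : 1 < d) (b : ℂ) : ∀ᵐ y : ℂ, y ^ d ≠ b := by
  rw [ae_iff]
  simpa using (finite_pow_eq hd b).measure_zero volume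

lemma qf_measurable (d : ℕ) (lam : ℂ) (m : ℕ) : Measurable (qf d lam m) := by
  unfold qf; fun_prop

lemma ef_measurable (d : ℕ) (lam : ℂ) (m : ℕ) : Measurable (ef d lam m) := by
  unfold ef; fun_prop

lemma qf_transfer {d : ℕ} (hd : 1 < d) {lam : ℂ} {m : ℕ}
    (hm : 1 ≤ m) (hs : ∑ k ∈ Finset.Ico 1 (m + 1), ac d lam m k = 0) {V : Set ℂ}
    (hV : MeasurableSet V) :
    ∫⁻ x in V, ‖qf d lam m x + ef d lam m x‖ₑ ≤ ∫⁻ x in (fc d lam) ⁻¹' V, ‖qf d lam m x‖ₑ := by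
  have hw := Complex.isPrimitiveRoot_exp d (by omega)
  set w := Complex.exp (2 * π * Complex.I / d) with hwdef
  refine transfer hd hw lam (q := qf d lam m) (Q := fun x => qf d lam m x + ef d lam m x)
    (qf_measurable d lam m) ?_ hV
  have h1 : ∀ᵐ y : ℂ, ∀ k ∈ Finset.Ico 1 (m + 1), y ^ d ≠ orb d lam k ^ d := by
    rw [Filter.eventually_all_finset]
    exact fun k _ => ae_pow_ne hd _
  filter_upwards [h1, ae_pow_ne hd 0] with y hy hy0
  have hy0' : y ≠ 0 := by
    rintro rfl
    exact hy0 (zero_pow (by omega))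
  rw [qf_identity hd hw hm hs hy0' hy]
  refine (norm_sum_le _ _).trans_eq ?_
  refine Finset.sum_congr rfl fun j _ => ?_
  rw [norm_mul, norm_pow, norm_pow, hw.norm'_eq_one (by omega)]
  simp

/-- constant for the error term -/
noncomputable def Ce (d : ℕ) : ℝ :=
  2 ^ (1 / (25 * (d:ℝ))) * (2 * (2 * π * (3 ^ (1 / (25 * (d:ℝ))) / (1 / (25 * (d:ℝ)))) +
    π * 3 ^ (1 / (25 * (d:ℝ)))))

lemma Ce_pos {d : ℕ} (hd : 1 < d) : 0 < Ce d := by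
  have : (0:ℝ) < d := by exact_mod_cast (by omega)
  unfold Ce; positivity

lemma two_pole_aux {A B D s : ℝ} (hA : 0 < A) (hAB : A ≤ B) (hD : 0 < D) (h : D ≤ A + B)
    (hs : 0 < s) (hs1 : s < 1) : 1 / (A * B) ≤ (D / 2) ^ (-s) * A ^ (s - 2) := by
  have hB : 0 < B := hA.trans_le hAB
  have h1 : B⁻¹ = B ^ (-s) * B ^ (s - 1) := by
    rw [← Real.rpow_add hB, ← Real.rpow_neg_one]; congr 1; ring
  have h2 : B ^ (-s) ≤ (D / 2) ^ (-s) :=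
    Real.rpow_le_rpow_of_nonpos (by positivity) (by linarith) (by linarith)
  have h3 : B ^ (s - 1) ≤ A ^ (s - 1) :=
    Real.rpow_le_rpow_of_nonpos hA hAB (by linarith)
  have h4 : A ^ (s - 2) = A⁻¹ * A ^ (s - 1) := by
    rw [← Real.rpow_neg_one, ← Real.rpow_add hA]; congr 1; ring
  rw [h4, one_div, mul_inv, h1]
  calc A⁻¹ * (B ^ (-s) * B ^ (s - 1)) ≤ A⁻¹ * ((D / 2) ^ (-s) * A ^ (s - 1)) := by gcongr
    _ = _ := by ring

lemma ef_integral {d : ℕ} (hd : 1 < d) (lam : ℂ) (m : ℕ) :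
    ∫⁻ x in Metric.ball (0:ℂ) 3, ‖ef d lam m x‖ₑ ≤
      ENNReal.ofReal (Ce d * ‖orb d lam m‖ ^ ((24:ℝ) / 25)) := by
  have hd1 : (1:ℝ) < d := by exact_mod_cast hd
  set c := orb d lam m with hc
  by_cases h0 : c = 0
  · have : ∀ x, ef d lam m x = 0 := fun x => by simp [ef, ← hc, h0]
    simp [this]
  have hc0 : 0 < ‖c‖ := norm_pos_iff.2 h0
  set s : ℝ := 1 / (25 * (d:ℝ)) with hs
  have hs0 : 0 < s := by positivity
  have hs1 : s < 1 := by
    rw [hs, div_lt_one (by positivity)]; linarith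
  set b := orb d lam (m + 1) with hb
  have hbl : b - lam = c ^ d := by rw [hb, orb_succ]; ring
  set D := ‖c‖ ^ d with hD
  have hD0 : 0 < D := by positivity
  have hDab : ∀ x : ℂ, D ≤ ‖x - lam‖ + ‖x - b‖ := by
    intro x
    rw [hD, ← norm_pow, ← hbl]
    have : b - lam = (x - lam) - (x - b) := by ring
    rw [this]
    exact norm_sub_le _ _
  set P : ℝ := ‖c‖ / d * (D / 2) ^ (-s) with hP
  have hP0 : 0 ≤ P := by positivity
  have hpt : ∀ x : ℂ, ‖ef d lam m x‖ ≤ P * (‖x - lam‖ ^ (s - 2) + ‖x - b‖ ^ (s - 2)) := by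
    intro x
    have hnn : 0 ≤ P * (‖x - lam‖ ^ (s - 2) + ‖x - b‖ ^ (s - 2)) := by positivity
    rw [ef, ← hc, ← hb, norm_div, norm_div, norm_mul, Complex.norm_natCast]
    by_cases h1 : x - lam = 0
    · simpa [h1] using hnn
    by_cases h2 : x - b = 0
    · simpa [h2] using hnn
    have h1' : 0 < ‖x - lam‖ := norm_pos_iff.2 h1
    have h2' : 0 < ‖x - b‖ := norm_pos_iff.2 h2
    have key : 1 / (‖x - lam‖ * ‖x - b‖) ≤
        (D / 2) ^ (-s) * (‖x - lam‖ ^ (s - 2) + ‖x - b‖ ^ (s - 2)) := by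
      have p1 : 0 ≤ (D / 2) ^ (-s) * ‖x - lam‖ ^ (s - 2) := by positivity
      have p2 : 0 ≤ (D / 2) ^ (-s) * ‖x - b‖ ^ (s - 2) := by positivity
      rcases le_total ‖x - lam‖ ‖x - b‖ with h | h
      · have := two_pole_aux h1' h hD0 (hDab x) hs0 hs1
        linarith
      · have := two_pole_aux h2' h hD0 (by linarith [hDab x]) hs0 hs1
        rw [mul_comm ‖x - b‖] at this
        linarith
    calc ‖c‖ / d / (‖x - lam‖ * ‖x - b‖) = ‖c‖ / d * (1 / (‖x - lam‖ * ‖x - b‖)) := by ring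
      _ ≤ ‖c‖ / d * ((D / 2) ^ (-s) * (‖x - lam‖ ^ (s - 2) + ‖x - b‖ ^ (s - 2))) := by gcongr
      _ = _ := by rw [hP]; ring
  have hmeas : ∀ a : ℂ, Measurable fun x : ℂ => ENNReal.ofReal (‖x - a‖ ^ (s - 2)) := by
    intro a; fun_prop
  set I : ℝ := 2 * π * (3 ^ s / s) + π * 3 ^ s with hI
  have hI0 : 0 ≤ I := by positivity
  have hIntg : ∀ a : ℂ, ∫⁻ x in Metric.ball (0:ℂ) 3, ENNReal.ofReal (‖x - a‖ ^ (s - 2)) ≤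
      ENNReal.ofReal I := by
    intro a
    have := lintegral_ball_rpow_le 0 a (ρ := 3) (a := s - 2) (by norm_num) (by linarith)
      (by linarith)
    rwa [sub_add_cancel] at this
  calc ∫⁻ x in Metric.ball (0:ℂ) 3, ‖ef d lam m x‖ₑ
      ≤ ∫⁻ x in Metric.ball (0:ℂ) 3, ENNReal.ofReal P * (ENNReal.ofReal (‖x - lam‖ ^ (s - 2)) +
          ENNReal.ofReal (‖x - b‖ ^ (s - 2))) := by
        refine lintegral_mono fun x => ?_
        rw [← ofReal_norm, ← ENNReal.ofReal_add (by positivity) (by positivity),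
          ← ENNReal.ofReal_mul hP0]
        exact ENNReal.ofReal_le_ofReal (hpt x)
    _ = ENNReal.ofReal P * ((∫⁻ x in Metric.ball (0:ℂ) 3, ENNReal.ofReal (‖x - lam‖ ^ (s - 2))) +
          (∫⁻ x in Metric.ball (0:ℂ) 3, ENNReal.ofReal (‖x - b‖ ^ (s - 2)))) := by
        rw [lintegral_const_mul _ (by fun_prop), lintegral_add_left (hmeas lam)]
    _ ≤ ENNReal.ofReal P * (ENNReal.ofReal I + ENNReal.ofReal I) := by
        gcongr <;> exact hIntg _
    _ = ENNReal.ofReal (P * (2 * I)) := by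
        rw [← ENNReal.ofReal_add hI0 hI0, ← ENNReal.ofReal_mul hP0, two_mul]
    _ ≤ _ := by
        apply ENNReal.ofReal_le_ofReal
        have e1 : (D / 2) ^ (-s) = 2 ^ s * ‖c‖ ^ (-(1:ℝ) / 25) := by
          rw [Real.div_rpow hD0.le (by norm_num), Real.rpow_neg (by norm_num : (0:ℝ) ≤ 2), hD,
            ← Real.rpow_natCast, ← Real.rpow_mul hc0.le, div_inv_eq_mul, mul_comm]
          congr 2
          rw [hs]; field_simp
        have e2 : ‖c‖ * ‖c‖ ^ (-(1:ℝ) / 25) = ‖c‖ ^ ((24:ℝ) / 25) := by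
          nth_rewrite 1 [← Real.rpow_one ‖c‖]
          rw [← Real.rpow_add hc0]; norm_num
        have e3 : P * (2 * I) = (1 / d) * (Ce d * ‖c‖ ^ ((24:ℝ) / 25)) := by
          rw [hP, e1, ← e2, Ce, ← hs, ← hI]; ring
        rw [e3]
        have : 0 ≤ Ce d * ‖c‖ ^ ((24:ℝ) / 25) := mul_nonneg (Ce_pos hd).le (by positivity)
        have h1d : 1 / (d:ℝ) ≤ 1 := by rw [div_le_one (by linarith)]; exact hd1.le
        nlinarith

lemma lintegral_poles_le {ι : Type*} (S : Finset ι) (a c : ι → ℂ) (p : ℂ) {ρ A : ℝ} (hρ : 0 < ρ)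
    (hA : 0 ≤ A) (h : ∀ k ∈ S, ‖a k‖ ≤ A) :
    ∫⁻ x in Metric.ball p ρ, ‖∑ k ∈ S, a k / (x - c k)‖ₑ ≤
      ENNReal.ofReal (S.card * (A * (3 * π * ρ))) := by
  calc ∫⁻ x in Metric.ball p ρ, ‖∑ k ∈ S, a k / (x - c k)‖ₑ
      ≤ ∫⁻ x in Metric.ball p ρ, ∑ k ∈ S, ENNReal.ofReal A * ‖(x - c k)⁻¹‖ₑ := by
        refine lintegral_mono fun x => (enorm_sum_le _ _).trans ?_
        refine Finset.sum_le_sum fun k hk => ?_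
        rw [div_eq_mul_inv, enorm_mul]
        gcongr
        rw [← ofReal_norm]
        exact ENNReal.ofReal_le_ofReal (h k hk)
    _ = ∑ k ∈ S, ENNReal.ofReal A * ∫⁻ x in Metric.ball p ρ, ‖(x - c k)⁻¹‖ₑ := by
        rw [lintegral_finsetSum _ (fun k _ => by fun_prop)]
        refine Finset.sum_congr rfl fun k _ => ?_
        rw [lintegral_const_mul _ (by fun_prop)]
    _ ≤ ∑ k ∈ S, ENNReal.ofReal A * ENNReal.ofReal (3 * π * ρ) := by
        gcongr
        exact lintegral_ball_inv_le p _ hρ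
    _ = _ := by
        rw [Finset.sum_const, nsmul_eq_mul, ← ENNReal.ofReal_mul hA, ← ENNReal.ofReal_natCast,
          ← ENNReal.ofReal_mul (by positivity)]

lemma qf_lower {d : ℕ} (hd : 1 < d) {lam : ℂ} {m : ℕ} (hm : 1 ≤ m)
    (hb : ∀ j ≤ m, ‖orb d lam j‖ ^ (d - 1) < 2) {δ : ℝ} (hδ : 0 < δ)
    (hF : ‖orb d lam m‖ < δ / 2) :
    ENNReal.ofReal (π * δ / 2) ≤ (∫⁻ x in Metric.ball (0:ℂ) δ, ‖qf d lam m x‖ₑ) +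
      ENNReal.ofReal (m * (d * (2 * δ) ^ (d - 1) * (2 * d) ^ m * (3 * π * δ))) := by
  classical
  have hd1 : (1:ℝ) < d := by exact_mod_cast hd
  set c := orb d lam m with hc
  set near := (Finset.Ico 1 m).filter (fun k => ‖orb d lam k‖ < 2 * δ) with hnear
  set far := (Finset.Ico 1 m).filter (fun k => ¬ ‖orb d lam k‖ < 2 * δ) with hfar
  set q2 : ℂ → ℂ := fun x => ∑ k ∈ near, ac d lam m k / (x - orb d lam k) with hq2
  set S : ℂ → ℂ := fun x => ∑ k ∈ far, ac d lam m k / (x - orb d lam k) with hS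
  have hsplit : ∀ x, qf d lam m x = q2 x + S x + 1 / (x - c) := by
    intro x
    rw [qf, Finset.sum_Ico_succ_top hm, ac_self, hq2, hS, hnear, hfar,
      Finset.sum_filter_add_sum_filter_not]
  have hsub : Metric.ball c (δ / 2) ⊆ Metric.ball 0 δ := by
    intro x hx
    rw [mem_ball_iff_norm] at hx
    rw [mem_ball_zero_iff]
    have := norm_add_le (x - c) c
    rw [sub_add_cancel] at this
    linarith
  have hq2m : Measurable q2 := by rw [hq2]; fun_prop
  have hSm : Measurable S := by rw [hS]; fun_prop
  have hqm := qf_measurable d lam m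
  set h : ℂ → ℂ := fun x => 1 + (x - c) * S x with hh
  have hhm : Measurable h := by rw [hh]; fun_prop
  have hhd : DifferentiableOn ℂ h (Metric.ball c (δ / 2)) := by
    rw [hh, hS]
    refine (differentiableOn_const 1).add
      ((differentiableOn_id.sub (differentiableOn_const c)).mul
        (DifferentiableOn.fun_sum fun k hk => ?_))
    refine (differentiableOn_const _).div
      (differentiableOn_id.sub (differentiableOn_const _)) fun x hx => ?_
    have h1 := hsub hx
    rw [mem_ball_zero_iff] at h1
    have h2 := (Finset.mem_filter.1 hk).2
    push Not at h2
    intro h3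
    have h4 : x = orb d lam k := sub_eq_zero.1 h3
    rw [h4] at h1
    linarith
  have h1 := submean (half_pos hδ) hhm hhd
  have h2 : h c = 1 := by simp [hh]
  rw [h2] at h1
  have hne : ∀ᵐ x : ℂ, x ≠ c := by
    rw [ae_iff]; simp
  have h3 : ∫⁻ x in Metric.ball c (δ / 2), ‖h x‖ₑ ≤
      ENNReal.ofReal (δ / 2) * ((∫⁻ x in Metric.ball (0:ℂ) δ, ‖qf d lam m x‖ₑ) +
        ∫⁻ x in Metric.ball (0:ℂ) δ, ‖q2 x‖ₑ) := by
    rw [← lintegral_add_left hqm.enorm, ← lintegral_const_mul _ (by fun_prop)]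
    refine le_trans ?_ (lintegral_mono_set hsub)
    refine setLIntegral_mono_ae (by fun_prop) ?_
    filter_upwards [hne] with x hx hxb
    have h4 : h x = (x - c) * (qf d lam m x - q2 x) := by
      rw [hsplit, hh]
      have : x - c ≠ 0 := sub_ne_zero.2 hx
      field_simp
      ring
    rw [h4, enorm_mul]
    rw [mem_ball_iff_norm] at hxb
    gcongr
    · rw [← ofReal_norm]
      exact ENNReal.ofReal_le_ofReal hxb.le
    · exact enorm_sub_le
  have h5 : ∫⁻ x in Metric.ball (0:ℂ) δ, ‖q2 x‖ₑ ≤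
      ENNReal.ofReal (m * (d * (2 * δ) ^ (d - 1) * (2 * d) ^ m * (3 * π * δ))) := by
    refine (lintegral_poles_le near (fun k => ac d lam m k) (fun k => orb d lam k) 0 hδ
      (A := d * (2 * δ) ^ (d - 1) * (2 * d) ^ m) (by positivity) fun k hk => ?_).trans ?_
    · have hk1 := Finset.mem_filter.1 hk
      rw [ac_rec d lam (Finset.mem_Ico.1 hk1.1).2, norm_mul, norm_mul, norm_pow,
        Complex.norm_natCast]
      gcongr
      · exact hk1.2.le
      · exact ac_norm hd hb _
    · apply ENNReal.ofReal_le_ofReal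
      gcongr
      refine (Finset.card_filter_le _ _).trans ?_
      simp
  have h6 : ENNReal.ofReal (δ / 2) * ENNReal.ofReal (π * δ / 2) ≤
      ENNReal.ofReal (δ / 2) * ((∫⁻ x in Metric.ball (0:ℂ) δ, ‖qf d lam m x‖ₑ) +
        ENNReal.ofReal (m * (d * (2 * δ) ^ (d - 1) * (2 * d) ^ m * (3 * π * δ)))) := by
    refine le_trans ?_ ((h1.trans h3).trans ?_)
    · rw [← ENNReal.ofReal_mul (by positivity)]
      simp only [enorm_one, mul_one]
      apply le_of_eq
      congr 1
      ring
    · gcongr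
  rwa [ENNReal.mul_le_mul_iff_right (by simpa using hδ) (by simp)] at h6

lemma transversality {d : ℕ} (hd : 1 < d) {lam : ℂ} {m : ℕ} (hm : 1 ≤ m) {δ ε M : ℝ}
    (hM1 : 100 * d * 2 ^ d ≤ M) (hM2 : 100 * Ce d ≤ M) (hδ : 0 < δ) (hδ1 : δ ≤ 1) 
    (hε : 0 < ε) (h1 : M * ε ≤ δ) (h2 : M * m * (2 * d) ^ m * δ ^ (d - 1) ≤ 1)
    (h3 : M * ε ^ ((24:ℝ) / 25) ≤ δ) (hF : ‖orb d lam m‖ < ε) :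
    ∑ k ∈ Finset.Ico 1 (m + 1), ac d lam m k ≠ 0 := by
  intro hs
  have hd1 : (1:ℝ) < d := by exact_mod_cast hd
  have h2d : (4:ℝ) ≤ 2 ^ d := by
    calc (4:ℝ) = 2 ^ 2 := by norm_num
      _ ≤ 2 ^ d := pow_le_pow_right₀ (by norm_num) (by omega)
  have hM100 : 400 ≤ M := by nlinarith
  have hM0 : 0 < M := by linarith
  have hFδ : ‖orb d lam m‖ < δ / 2 := by nlinarith
  obtain ⟨hlam, hb⟩ := orb_bound hd hm (by linarith : ‖orb d lam m‖ < 1)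
  have hlam2 := norm_le_two_of_pow_lt hd (norm_nonneg _) hlam
  have hlow := qf_lower hd hm hb hδ hFδ
  set q := qf d lam m with hq
  set e := ef d lam m with he
  have hqm : Measurable q := qf_measurable d lam m
  have hem : Measurable e := ef_measurable d lam m
  set B3 := Metric.ball (0:ℂ) 3 with hB3
  set Bl := Metric.ball lam (δ ^ d) with hBl
  set B0 := Metric.ball (0:ℂ) δ with hB0
  have hδd : δ ^ d = δ ^ (d - 1) * δ := by rw [← pow_succ]; congr 1; omega
  have hqball : ∀ (p : ℂ) (ρ : ℝ), 0 < ρ → ∫⁻ x in Metric.ball p ρ, ‖q x‖ₑ ≤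
      ENNReal.ofReal (m * ((2 * d) ^ m * (3 * π * ρ))) := by
    intro p ρ hρ
    have := lintegral_poles_le (Finset.Ico 1 (m + 1)) (fun k => ac d lam m k)
      (fun k => orb d lam k) p hρ (A := (2 * d) ^ m) (by positivity)
      (fun k _ => ac_norm hd hb k)
    simpa [hq, qf] using this
  have hV : MeasurableSet (B3 \ Bl) := Metric.isOpen_ball.measurableSet.diff
    Metric.isOpen_ball.measurableSet
  have ht := qf_transfer hd hm hs hV
  have hpre : (fc d lam) ⁻¹' (B3 \ Bl) ⊆ B3 \ B0 := by
    intro y hy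
    simp only [Set.mem_preimage, Set.mem_sdiff, hB3, hBl, hB0, sub_zero,
      mem_ball_iff_norm] at hy ⊢
    have e1 : fc d lam y - lam = y ^ d := by simp [fc]
    rw [e1, norm_pow] at hy
    constructor
    · by_contra h
      push Not at h
      have e2 := norm_sub_le (fc d lam y) lam
      rw [e1, norm_pow] at e2
      have e3 : (3:ℝ) ^ 2 ≤ ‖y‖ ^ d :=
        (pow_le_pow_right₀ (by norm_num) (by omega)).trans (pow_le_pow_left₀ (by norm_num) h d)
      linarith [hy.1]
    · intro h
      exact hy.2 (pow_lt_pow_left₀ h (norm_nonneg _) (by omega))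
  have hB0sub : B0 ⊆ B3 := Metric.ball_subset_ball (by linarith)
  set T := ∫⁻ x in B3 \ Bl, ‖q x + e x‖ₑ with hT
  have hT1 : T + ∫⁻ x in B0, ‖q x‖ₑ ≤ ∫⁻ x in B3, ‖q x‖ₑ := by
    have := lintegral_inter_add_sdiff (μ := volume) (fun x => ‖q x‖ₑ) B3
      (B := B0) Metric.isOpen_ball.measurableSet
    rw [← this, Set.inter_eq_self_of_subset_right hB0sub, add_comm]
    gcongr
    exact ht.trans (lintegral_mono_set hpre)
  have hTfin : T ≠ ⊤ := by
    refine ne_top_of_le_ne_top ?_ (le_self_add.trans hT1)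
    exact ne_top_of_le_ne_top ENNReal.ofReal_ne_top (hqball 0 3 (by norm_num))
  have hT2 : ∫⁻ x in B3, ‖q x‖ₑ ≤ T + ((∫⁻ x in B3, ‖e x‖ₑ) + ∫⁻ x in Bl, ‖q x‖ₑ) := by
    have h4 : ∫⁻ x in B3 \ Bl, ‖q x‖ₑ ≤ T + ∫⁻ x in B3, ‖e x‖ₑ := by
      calc ∫⁻ x in B3 \ Bl, ‖q x‖ₑ ≤ ∫⁻ x in B3 \ Bl, (‖q x + e x‖ₑ + ‖e x‖ₑ) := by
            refine lintegral_mono fun x => ?_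
            have : q x = (q x + e x) - e x := by ring
            nth_rewrite 1 [this]
            exact enorm_sub_le
        _ = T + ∫⁻ x in B3 \ Bl, ‖e x‖ₑ := by
            rw [lintegral_add_left (by fun_prop)]
        _ ≤ _ := by
            gcongr
            exact Set.sdiff_subset
    have := lintegral_inter_add_sdiff (μ := volume) (fun x => ‖q x‖ₑ) B3
      (B := Bl) Metric.isOpen_ball.measurableSet
    rw [← this, ← add_assoc, add_comm]
    gcongr
    exact Set.inter_subset_right
  have hfin := (ENNReal.add_le_add_iff_left hTfin).1 (hT1.trans hT2)
  have hR : ENNReal.ofReal (π * δ / 2) ≤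
      ENNReal.ofReal (Ce d * ε ^ ((24:ℝ) / 25) + m * ((2 * d) ^ m * (3 * π * δ ^ d))
        + m * (d * (2 * δ) ^ (d - 1) * (2 * d) ^ m * (3 * π * δ))) := by
    refine hlow.trans ?_
    have := Ce_pos hd
    rw [ENNReal.ofReal_add (by positivity) (by positivity),
      ENNReal.ofReal_add (by positivity) (by positivity)]
    gcongr
    refine hfin.trans ?_
    gcongr
    · refine (ef_integral hd lam m).trans ?_
      apply ENNReal.ofReal_le_ofReal
      gcongr
    · exact hqball lam (δ ^ d) (by positivity)
  rw [ENNReal.ofReal_le_ofReal_iff (by have := Ce_pos hd; positivity)] at hR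
  set Z : ℝ := m * (2 * d) ^ m * δ ^ (d - 1) with hZ
  have hZ0 : 0 ≤ Z := by positivity
  have hMZ : M * Z ≤ 1 := by rw [hZ]; linarith
  have t1 : Ce d * ε ^ ((24:ℝ) / 25) ≤ δ / 100 := by
    have : 0 ≤ ε ^ ((24:ℝ) / 25) := by positivity
    nlinarith
  have t2 : m * ((2 * d) ^ m * (3 * π * δ ^ d)) = 3 * π * δ * Z := by rw [hδd, hZ]; ring
  have e2 : (2:ℝ) ^ d = 2 ^ (d - 1) * 2 := by rw [← pow_succ]; congr 1; omega
  have t3 : m * (d * (2 * δ) ^ (d - 1) * (2 * d) ^ m * (3 * π * δ)) =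
      3 * π * δ * (d * 2 ^ (d - 1) * Z) := by rw [mul_pow, hZ]; ring
  have t4 : Z ≤ 1 / 400 := by nlinarith
  have t5 : d * 2 ^ (d - 1) * Z ≤ 1 / 200 := by
    rw [e2] at hM1
    nlinarith
  rw [t2, t3] at hR
  have hpd : 0 < π * δ := by positivity
  have t6 : δ ≤ π * δ := by nlinarith [Real.pi_gt_three]
  nlinarith



/-! ### Area estimate -/

lemma disc_log {k : ℂ → ℂ} (hk : Measurable k) {ε : ℝ} (hε : 0 < ε)
    (hd : DifferentiableOn ℂ k (Metric.ball 0 ε)) :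
    ∫⁻ w in Metric.ball (0:ℂ) ε, ‖k w‖ₑ * ENNReal.ofReal (Real.log (ε / ‖w‖)) ≤
      7 * ∫⁻ w in Metric.ball (0:ℂ) ε, ‖k w‖ₑ := by
  set I := ∫⁻ w in Metric.ball (0:ℂ) ε, ‖k w‖ₑ with hI
  have hsub : Metric.ball (0:ℂ) (ε / 2) ⊆ Metric.ball 0 ε := Metric.ball_subset_ball (by linarith)
  have h1 : ∀ w ∈ Metric.ball (0:ℂ) (ε / 2), ‖k w‖ₑ ≤ ENNReal.ofReal (4 / (π * ε ^ 2)) * I := by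
    intro w hw
    have hs : Metric.ball w (ε / 2) ⊆ Metric.ball 0 ε := by
      apply Metric.ball_subset_ball'
      rw [Metric.mem_ball] at hw
      linarith
    have h2 := (submean (half_pos hε) hk (hd.mono hs)).trans (lintegral_mono_set hs)
    rw [← hI] at h2
    calc ‖k w‖ₑ = ENNReal.ofReal (4 / (π * ε ^ 2)) *
          (ENNReal.ofReal (π * (ε / 2) ^ 2) * ‖k w‖ₑ) := by
          rw [← mul_assoc, ← ENNReal.ofReal_mul (by positivity)]
          have : 4 / (π * ε ^ 2) * (π * (ε / 2) ^ 2) = 1 := by field_simp; norm_num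
          rw [this]; simp
      _ ≤ _ := by gcongr
  have hinner : ∫⁻ w in Metric.ball (0:ℂ) (ε / 2),
      ‖k w‖ₑ * ENNReal.ofReal (Real.log (ε / ‖w‖)) ≤ 6 * I := by
    calc ∫⁻ w in Metric.ball (0:ℂ) (ε / 2), ‖k w‖ₑ * ENNReal.ofReal (Real.log (ε / ‖w‖))
        ≤ ∫⁻ w in Metric.ball (0:ℂ) (ε / 2), (ENNReal.ofReal (4 / (π * ε ^ 2)) * I *
            ENNReal.ofReal ε) * ‖(w - 0)⁻¹‖ₑ := by
          refine setLIntegral_mono (by fun_prop) fun w hw => ?_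
          rw [mul_assoc]
          gcongr
          · exact h1 w hw
          · rw [sub_zero, ← ofReal_norm, ← ENNReal.ofReal_mul hε.le, norm_inv]
            apply ENNReal.ofReal_le_ofReal
            rw [← div_eq_mul_inv]
            exact Real.log_le_self (by positivity)
      _ ≤ (ENNReal.ofReal (4 / (π * ε ^ 2)) * I * ENNReal.ofReal ε) *
            ENNReal.ofReal (3 * π * (ε / 2)) := by
          rw [lintegral_const_mul _ (by fun_prop)]
          gcongr
          exact lintegral_ball_inv_le 0 0 (half_pos hε)
      _ = ENNReal.ofReal (4 / (π * ε ^ 2) * ε * (3 * π * (ε / 2))) * I := by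
          rw [ENNReal.ofReal_mul (p := 4 / (π * ε ^ 2) * ε) (by positivity),
            ENNReal.ofReal_mul (p := 4 / (π * ε ^ 2)) (by positivity)]
          ring
      _ = 6 * I := by
          have : 4 / (π * ε ^ 2) * ε * (3 * π * (ε / 2)) = 6 := by field_simp; norm_num
          rw [this]; simp
  have houter : ∫⁻ w in Metric.ball (0:ℂ) ε \ Metric.ball 0 (ε / 2),
      ‖k w‖ₑ * ENNReal.ofReal (Real.log (ε / ‖w‖)) ≤ I := by
    refine le_trans ?_ (lintegral_mono_set (Set.sdiff_subset (t := Metric.ball 0 (ε / 2))))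
    refine setLIntegral_mono hk.enorm fun w hw => ?_
    have hw2 : ε / 2 ≤ ‖w‖ := by
      have := hw.2
      rw [mem_ball_zero_iff] at this
      linarith
    have hle : Real.log (ε / ‖w‖) ≤ 1 := by
      have h3 : ε / ‖w‖ ≤ 2 := by
        rw [div_le_iff₀ (by linarith)]; linarith
      have h4 := Real.log_le_sub_one_of_pos (x := ε / ‖w‖) (by
        have : 0 < ‖w‖ := by linarith
        positivity)
      linarith
    calc ‖k w‖ₑ * ENNReal.ofReal (Real.log (ε / ‖w‖)) ≤ ‖k w‖ₑ * 1 := by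
          gcongr
          simpa using hle
      _ = _ := mul_one _
  rw [← lintegral_inter_add_sdiff _ (Metric.ball (0:ℂ) ε)
    (B := Metric.ball 0 (ε / 2)) Metric.isOpen_ball.measurableSet,
    Set.inter_eq_self_of_subset_right hsub]
  calc _ ≤ 6 * I + I := add_le_add hinner houter
    _ = 7 * I := by ring

lemma poly_sections {P : ℂ[X]} {ε : ℝ} (hε : 0 < ε)
    (hW : ∀ x, ‖P.eval x‖ < ε → P.derivative.eval x ≠ 0) {x₀ : ℂ} (hx₀ : ‖P.eval x₀‖ < ε) :
    ∃ h : ℂ → ℂ, ContinuousOn h (Metric.ball 0 ε) ∧ (∀ w ∈ Metric.ball 0 ε, P.eval (h w) = w) ∧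
      h (P.eval x₀) = x₀ ∧ ∀ g : ℂ → ℂ, ContinuousOn g (Metric.ball 0 ε) →
        (∀ w ∈ Metric.ball 0 ε, P.eval (g w) = w) → g (P.eval x₀) = x₀ →
        ∀ w ∈ Metric.ball 0 ε, g w = h w := by
  classical
  set D := Metric.ball (0:ℂ) ε with hD
  have hcov := P.isCoveringMapOn_eval
  have : ContractibleSpace D := (convex_ball (0:ℂ) ε).contractibleSpace ⟨0, by simp [hε]⟩
  have : LocallyPathConnectedSpace D := Metric.isOpen_ball.locallyPathConnectedSpace
  let f : C(D, ℂ) := ⟨Subtype.val, by fun_prop⟩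
  have hxD : P.eval x₀ ∈ D := by rw [hD, mem_ball_zero_iff]; exact hx₀
  obtain ⟨F, ⟨hF1, hF2⟩, hF3⟩ := hcov.existsUnique_continuousMap_lifts f
    (a₀ := ⟨P.eval x₀, hxD⟩) (e₀ := x₀) rfl (by
      rintro ⟨a, ha⟩ ⟨k, hk, hk2⟩
      have hk2' : P.eval k = a := hk2
      rw [hD, mem_ball_zero_iff, ← hk2'] at ha
      exact hW k ha hk)
  refine ⟨fun w => if hw : w ∈ D then F ⟨w, hw⟩ else 0, ?_, ?_, ?_, ?_⟩
  · rw [continuousOn_iff_continuous_domRestrict]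
    convert F.continuous using 1
    ext ⟨w, hw⟩
    simp [hw]
  · intro w hw
    simp only [hw, dif_pos]
    exact congrFun hF2 ⟨w, hw⟩
  · simp only [hxD, dif_pos]
    exact hF1
  · intro g hg hg2 hg3 w hw
    have := hF3 ⟨D.domRestrict g, continuousOn_iff_continuous_domRestrict.1 hg⟩ ⟨hg3, by
      funext ⟨a, ha⟩
      exact hg2 a ha⟩
    simp only [hw, dif_pos, ← this]
    rfl

lemma area_bound {P : ℂ[X]} {ε : ℝ} (hε : 0 < ε)
    (hW : ∀ x, ‖P.eval x‖ < ε → P.derivative.eval x ≠ 0) :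
    ∫⁻ x in {x | ‖P.eval x‖ < ε}, ENNReal.ofReal (Real.log (ε / ‖P.eval x‖)) ≤
      7 * volume {x | ‖P.eval x‖ < ε} := by
  classical
  set D := Metric.ball (0:ℂ) ε with hD
  set W := {x : ℂ | ‖P.eval x‖ < ε} with hWd
  have h0D : (0:ℂ) ∈ D := by simp [hD, hε]
  have hP0 : P ≠ 0 := by
    rintro rfl
    exact hW 0 (by simpa using hε) (by simp)
  have hroot : ∀ a ∈ P.roots.toFinset, P.eval a = 0 := fun a ha => by
    simpa [hP0] using ha
  have hex : ∀ a : ℂ, ∃ h : ℂ → ℂ, a ∈ P.roots.toFinset → ContinuousOn h D ∧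
      (∀ w ∈ D, P.eval (h w) = w) ∧ h 0 = a ∧ ∀ g : ℂ → ℂ, ContinuousOn g D →
        (∀ w ∈ D, P.eval (g w) = w) → g 0 = a → ∀ w ∈ D, g w = h w := by
    intro a
    by_cases ha : a ∈ P.roots.toFinset
    · obtain ⟨h, h1, h2, h3, h4⟩ := poly_sections hε hW (x₀ := a) (by rw [hroot a ha]; simpa)
      rw [hroot a ha] at h3 h4
      exact ⟨h, fun _ => ⟨h1, h2, h3, h4⟩⟩
    · exact ⟨0, fun h => absurd h ha⟩
  choose h hh using hex
  have hWeq : W = ⋃ a ∈ P.roots.toFinset, h a '' D := by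
    ext x
    simp only [Set.mem_iUnion]
    constructor
    · intro hx
      obtain ⟨g, g1, g2, g3, -⟩ := poly_sections hε hW (x₀ := x) hx
      have hxD : P.eval x ∈ D := by rw [hD, mem_ball_zero_iff]; exact hx
      have hg0 : g 0 ∈ P.roots.toFinset := by
        simp [hP0, g2 0 h0D]
      refine ⟨g 0, hg0, P.eval x, hxD, ?_⟩
      rw [← (hh _ hg0).2.2.2 g g1 g2 rfl _ hxD, g3]
    · rintro ⟨a, ha, w, hw, rfl⟩
      simp only [hWd, Set.mem_ofPred_eq]
      rw [(hh a ha).2.1 w hw]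
      simpa [hD] using hw
  have hder : ∀ a ∈ P.roots.toFinset, ∀ w ∈ D, DifferentiableAt ℂ (h a) w := by
    intro a ha w hw
    have hnh : D ∈ nhds w := Metric.isOpen_ball.mem_nhds hw
    have hne : P.derivative.eval (h a w) ≠ 0 := by
      apply hW
      rw [(hh a ha).2.1 w hw]
      simpa [hD] using hw
    refine (HasDerivAt.of_local_left_inverse (f := fun x => P.eval x)
      ((hh a ha).1.continuousAt hnh) (P.hasDerivAt _) hne ?_).differentiableAt
    filter_upwards [hnh] with y hy using (hh a ha).2.1 y hy
  have hinj : ∀ a ∈ P.roots.toFinset, Set.InjOn (h a) D := by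
    intro a ha w hw w' hw' he
    rw [← (hh a ha).2.1 w hw, he, (hh a ha).2.1 w' hw']
  have hDm : MeasurableSet D := Metric.isOpen_ball.measurableSet
  have hdisj : Set.PairwiseDisjoint (P.roots.toFinset : Set ℂ) (fun a => h a '' D) := by
    intro a ha b hb hab
    rw [Function.onFun, Set.disjoint_left]
    rintro x ⟨w, hw, rfl⟩ ⟨w', hw', he⟩
    have ha' : a ∈ P.roots.toFinset := by simpa using ha
    have hb' : b ∈ P.roots.toFinset := by simpa using hb
    have e1 : w' = w := by
      rw [← (hh b hb').2.1 w' hw', he, (hh a ha').2.1 w hw]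
    subst e1
    obtain ⟨g, -, -, -, g4⟩ := poly_sections hε hW (x₀ := h a w') (by
      rw [(hh a ha').2.1 w' hw]; simpa [hD] using hw)
    rw [(hh a ha').2.1 w' hw] at g4
    have e2 := g4 (h a) (hh a ha').1 (hh a ha').2.1 rfl 0 h0D
    have e3 := g4 (h b) (hh b hb').1 (hh b hb').2.1 he 0 h0D
    rw [(hh a ha').2.2.1] at e2
    rw [(hh b hb').2.2.1] at e3
    exact hab (e2.trans e3.symm)
  have himm : ∀ a ∈ P.roots.toFinset, MeasurableSet (h a '' D) := fun a ha =>
    hDm.image_of_continuousOn_injOn (hh a ha).1 (hinj a ha)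
  have key : ∀ G : ℂ → ENNReal, ∫⁻ x in W, G x = ∑ a ∈ P.roots.toFinset,
      ∫⁻ w in D, ‖deriv (h a) w ^ 2‖ₑ * G (h a w) := by
    intro G
    rw [hWeq, lintegral_biUnion_finset hdisj himm]
    exact Finset.sum_congr rfl fun a ha =>
      lintegral_image_holo hDm (fun w hw => (hder a ha w hw).hasDerivAt) (hinj a ha) G
  have hvol : volume W = ∑ a ∈ P.roots.toFinset, ∫⁻ w in D, ‖deriv (h a) w ^ 2‖ₑ := by
    have := key (fun _ => 1)
    simpa using this
  rw [key, hvol, Finset.mul_sum]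
  refine Finset.sum_le_sum fun a ha => ?_
  refine le_trans (le_of_eq ?_) (disc_log (k := fun w => deriv (h a) w ^ 2)
    ((measurable_deriv _).pow_const 2) hε ?_)
  · refine setLIntegral_congr_fun hDm fun w hw => ?_
    rw [(hh a ha).2.1 w hw]
  · have : DifferentiableOn ℂ (h a) D := fun w hw => (hder a ha w hw).differentiableWithinAt
    exact (this.deriv Metric.isOpen_ball).pow 2

/-- orbit polynomial -/
noncomputable def orbP (d : ℕ) : ℕ → ℂ[X]
  | 0 => 0
  | k + 1 => orbP d k ^ d + X

lemma orbP_eval (d : ℕ) (lam : ℂ) (k : ℕ) : (orbP d k).eval lam = orb d lam k := by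
  induction k with
  | zero => simp [orbP, orb_zero]
  | succ k ih => simp [orbP, orb_succ, ih]

lemma orbP_derivative (d : ℕ) (lam : ℂ) (m : ℕ) :
    (orbP d m).derivative.eval lam = ∑ k ∈ Finset.Ico 1 (m + 1), ac d lam m k := by
  have h1 := (orbP d m).hasDerivAt lam
  have h2 := orb_hasDerivAt d lam m
  have h3 : (fun x => (orbP d m).eval x) = fun l => orb d l m := by
    funext l; exact orbP_eval d l m
  rw [h3] at h1
  exact h1.unique h2

lemma orb_area {d : ℕ} (hd : 1 < d) {m : ℕ} (hm : 1 ≤ m) {δ ε M : ℝ}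
    (hM1 : 100 * d * 2 ^ d ≤ M) (hM2 : 100 * Ce d ≤ M) (hδ : 0 < δ) (hδ1 : δ ≤ 1) 
    (hε : 0 < ε) (h1 : M * ε ≤ δ) (h2 : M * m * (2 * d) ^ m * δ ^ (d - 1) ≤ 1)
    (h3 : M * ε ^ ((24:ℝ) / 25) ≤ δ) :
    ∫⁻ x in {x | ‖orb d x m‖ < ε}, ENNReal.ofReal (Real.log (ε / ‖orb d x m‖)) ≤
      ENNReal.ofReal (63 * π) := by
  have hb := area_bound (P := orbP d m) hε (fun x hx => by
    rw [orbP_derivative]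
    rw [orbP_eval] at hx
    exact transversality hd hm hM1 hM2 hδ hδ1 hε h1 h2 h3 hx)
  simp only [orbP_eval] at hb
  refine hb.trans ?_
  have hd1 : (1:ℝ) < d := by exact_mod_cast hd
  have h2d : (4:ℝ) ≤ 2 ^ d := by
    calc (4:ℝ) = 2 ^ 2 := by norm_num
      _ ≤ 2 ^ d := pow_le_pow_right₀ (by norm_num) (by omega)
  have hM100 : 400 ≤ M := by nlinarith
  have hε1 : ε ≤ 1 := by nlinarith
  have hsub : {x | ‖orb d x m‖ < ε} ⊆ Metric.ball (0:ℂ) 3 := by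
    intro x hx
    have hx' : ‖orb d x m‖ < ε := hx
    rw [mem_ball_zero_iff]
    have := norm_le_two_of_pow_lt hd (norm_nonneg _) (orb_bound hd hm (hx'.trans_le hε1)).1
    linarith
  calc 7 * volume {x | ‖orb d x m‖ < ε} ≤ 7 * volume (Metric.ball (0:ℂ) 3) := by
        gcongr
    _ = ENNReal.ofReal (63 * π) := by
        rw [volume_ball_real _ (by norm_num)]
        have : (7:ENNReal) = ENNReal.ofReal 7 := by simp
        rw [this, ← ENNReal.ofReal_mul (by norm_num)]
        congr 1; ring



/-! ### Pointwise bounds -/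

/-- data of scales -/
structure Scales (d : ℕ) (M : ℝ) (δ ε : ℕ → ℝ) (B : ℝ) : Prop where
  big1 : 100 * d * 2 ^ d ≤ M
  big2 : 100 * Ce d ≤ M
  all : ∀ m : ℕ, 1 ≤ m →
      0 < δ m ∧ δ m ≤ 1 ∧ 0 < ε m ∧ M * ε m ≤ δ m ∧ M * m * (2 * d) ^ m * δ m ^ (d - 1) ≤ 1 ∧
      M * (ε m) ^ ((24:ℝ) / 25) ≤ δ m ∧
      ((d:ℝ) - 1) * Real.log (1 / ε m) ≤ 2.2 * Real.log d * m + B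

lemma exists_Scales {d : ℕ} (hd : 1 < d) : ∃ M δ ε B, Scales d M δ ε B := by
  have h1 := Ce_pos hd
  have h2 : (0:ℝ) ≤ 100 * d * 2 ^ d := by positivity
  obtain ⟨δ, ε, B, h⟩ := exists_scales hd (M := 1 + 100 * d * 2 ^ d + 100 * Ce d) (by linarith)
  exact ⟨_, δ, ε, B, by linarith, by linarith, h⟩

lemma Scales.M_ge {d : ℕ} (hd : 1 < d) {M B : ℝ} {δ ε : ℕ → ℝ} (S : Scales d M δ ε B) :
    400 * d ≤ M := by
  have hd1 : (1:ℝ) < d := by exact_mod_cast hd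
  have h2d : (4:ℝ) ≤ 2 ^ d := by
    calc (4:ℝ) = 2 ^ 2 := by norm_num
      _ ≤ 2 ^ d := pow_le_pow_right₀ (by norm_num) (by omega)
  have := S.big1
  nlinarith

noncomputable def Yf (d : ℕ) (ε : ℕ → ℝ) (m : ℕ) (lam : ℂ) : ℝ :=
  if ‖orb d lam m‖ < ε m then Real.log (ε m / ‖orb d lam m‖) else 0

lemma Yf_nonneg {d : ℕ} {ε : ℕ → ℝ} {m : ℕ} (lam : ℂ) : 0 ≤ Yf d ε m lam := by
  unfold Yf
  split_ifs with h
  · rcases eq_or_lt_of_le (norm_nonneg (orb d lam m)) with h0 | h0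
    · rw [← h0]; simp
    · exact Real.log_nonneg (by rw [le_div_iff₀ h0]; linarith)
  · exact le_rfl

lemma Scales.Yf_eq_zero {d : ℕ} (hd : 1 < d) {M B : ℝ} {δ ε : ℕ → ℝ} (S : Scales d M δ ε B)
    {gI : ℂ → ℝ} (hg : IsGreen d gI) {m : ℕ} (hm : 1 ≤ m) {lam : ℂ} (h : gI lam ≠ 0) :
    Yf d ε m lam = 0 := by
  unfold Yf
  rw [if_neg]
  intro hlt
  obtain ⟨h1, h2, h3, h4, h5, -, -⟩ := S.all m hm
  have hM := S.M_ge hd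
  have hd1 : (1:ℝ) < d := by exact_mod_cast hd
  refine h (hg.eq_zero hd (R := 3) fun k => attr_bounded hd hm h1 h2 ?_ ?_ k)
  · refine le_trans ?_ h5
    gcongr
    linarith
  · nlinarith

noncomputable def chi (lam : ℂ) : ℝ := if ‖lam‖ < 3 then 1 else 0

lemma log_le_ell {d : ℕ} {lam : ℂ} {m : ℕ} (h0 : orb d lam m ≠ 0) :
    Real.log ‖orb d lam m‖ ≤ ell d lam m := by
  have h1 : 0 < ‖orb d lam m‖ := norm_pos_iff.2 h0
  have h2 : Real.log (‖orb d lam m‖ ^ 2) ≤ Real.log (1 + ‖orb d lam m‖ ^ 2) :=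
    Real.log_le_log (by positivity) (by linarith)
  rw [Real.log_pow] at h2
  unfold ell
  push_cast at h2
  linarith

lemma ell_le_max {d : ℕ} {lam : ℂ} {m : ℕ} {x : ℝ} (hx : 1 ≤ x) (h : ‖orb d lam m‖ ≤ x) :
    ell d lam m ≤ Real.log x + 1 := by
  have h2 : Real.log (1 + ‖orb d lam m‖ ^ 2) ≤ Real.log (2 * x ^ 2) :=
    Real.log_le_log (by positivity) (by nlinarith [norm_nonneg (orb d lam m)])
  rw [Real.log_mul (by norm_num) (by positivity), Real.log_pow] at h2
  have := Real.log_two_lt_d9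
  unfold ell
  push_cast at h2
  linarith

lemma Scales.uu_bound {d : ℕ} (hd : 1 < d) {M B : ℝ} {δ ε : ℕ → ℝ} (S : Scales d M δ ε B)
    {gI : ℂ → ℝ} (hg : IsGreen d gI) {m : ℕ} (hm : 1 ≤ m) {lam : ℂ} (h0 : orb d lam m ≠ 0) :
    |uu d gI lam m| ≤ C0 d + 1 + chi lam * Real.log (1 / ε m) + Yf d ε m lam := by
  obtain ⟨h1, h2, h3, h4, h5, -, -⟩ := S.all m hm
  have hM := S.M_ge hd
  have hd1 : (1:ℝ) < d := by exact_mod_cast hd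
  have hε1 : ε m ≤ 1 := by nlinarith
  have hlogε : 0 ≤ Real.log (1 / ε m) := Real.log_nonneg (by
    rw [le_div_iff₀ h3]; linarith)
  have hY := Yf_nonneg (d := d) (ε := ε) (m := m) lam
  have hell := abs_le.1 (hg.ell_sub hd lam hm)
  have hle := log_le_ell h0
  have hpos : 0 < ‖orb d lam m‖ := norm_pos_iff.2 h0
  have hchi : 0 ≤ chi lam * Real.log (1 / ε m) := by
    unfold chi
    split_ifs
    · rw [one_mul]; exact hlogε
    · rw [zero_mul]
  rw [abs_le, uu]
  constructor
  swap
  · linarith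
  by_cases hbig : 1 ≤ ‖orb d lam m‖
  · have := ell_le_max hbig le_rfl
    linarith
  · push Not at hbig
    have hl := ell_le_max le_rfl hbig.le
    simp only [Real.log_one, zero_add] at hl
    have hl3 : chi lam = 1 := by
      unfold chi
      rw [if_pos]
      by_contra hc
      push Not at hc
      have := big_orb hd hc (m - 1)
      rw [Nat.sub_add_cancel hm] at this
      have h5 : (1:ℝ) ≤ 2 ^ (m - 1) := one_le_pow₀ (by norm_num)
      nlinarith
    rw [hl3]
    have key : -Real.log (1 / ε m) - Yf d ε m lam ≤ Real.log ‖orb d lam m‖ := by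
      rw [one_div, Real.log_inv, neg_neg]
      unfold Yf
      split_ifs with hlt
      · rw [Real.log_div h3.ne' hpos.ne']
        linarith
      · rw [sub_zero]
        exact Real.log_le_log h3 (by linarith)
    linarith

/-- constant part of the bound -/
noncomputable def C2 (d : ℕ) (B : ℝ) : ℝ := ((d:ℝ) - 1) * (C0 d + 1) + |B|

noncomputable def s1 (n : ℕ) : ℝ := ∑ m ∈ n.divisors, (m:ℝ)

noncomputable def Gf (d n : ℕ) (ε : ℕ → ℝ) (B : ℝ) (lam : ℂ) : ℝ :=
  chi lam * (2.2 * Real.log d * s1 n) + C2 d B * n.divisors.card +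
    ((d:ℝ) - 1) * ∑ m ∈ n.divisors, Yf d ε m lam

lemma Scales.sum_uu_bound {d n : ℕ} (hd : 1 < d) {M B : ℝ} {δ ε : ℕ → ℝ} (S : Scales d M δ ε B)
    {gI : ℂ → ℝ} (hg : IsGreen d gI) {lam : ℂ} (h0 : orb d lam n ≠ 0) :
    |((d:ℝ) - 1) * ∑ m ∈ n.divisors, (ArithmeticFunction.moebius (n / m) : ℝ) * uu d gI lam m| ≤
      Gf d n ε B lam := by
  have hd1 : (1:ℝ) < d := by exact_mod_cast hd
  have hchi : chi lam = 0 ∨ chi lam = 1 := by unfold chi; split_ifs <;> simp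
  rw [abs_mul, abs_of_pos (by linarith : (0:ℝ) < d - 1)]
  have e1 : Gf d n ε B lam = ∑ m ∈ n.divisors, (chi lam * (2.2 * Real.log d * m) + C2 d B +
      ((d:ℝ) - 1) * Yf d ε m lam) := by
    rw [Finset.sum_add_distrib, Finset.sum_add_distrib, Gf, s1, Finset.mul_sum, Finset.mul_sum,
      Finset.mul_sum, Finset.sum_const, nsmul_eq_mul, mul_comm (C2 d B)]
  rw [e1]
  calc ((d:ℝ) - 1) * |∑ m ∈ n.divisors, (ArithmeticFunction.moebius (n / m) : ℝ) * uu d gI lam m|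
      ≤ ((d:ℝ) - 1) * ∑ m ∈ n.divisors, |uu d gI lam m| := by
        gcongr
        refine (Finset.abs_sum_le_sum_abs _ _).trans (Finset.sum_le_sum fun m _ => ?_)
        rw [abs_mul]
        have : |(ArithmeticFunction.moebius (n / m) : ℝ)| ≤ 1 := by
          exact_mod_cast ArithmeticFunction.abs_moebius_le_one
        have := abs_nonneg (uu d gI lam m)
        nlinarith
    _ = ∑ m ∈ n.divisors, ((d:ℝ) - 1) * |uu d gI lam m| := Finset.mul_sum _ _ _
    _ ≤ _ := by
        refine Finset.sum_le_sum fun m hm => ?_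
        have hm1 : 1 ≤ m := Nat.pos_of_mem_divisors hm
        have hm0 : orb d lam m ≠ 0 :=
          fun hc => h0 (orb_zero_of_dvd (Nat.dvd_of_mem_divisors hm) hc)
        have h1 := S.uu_bound hd hg hm1 hm0
        have h2 := (S.all m hm1).2.2.2.2.2.2
        have h3 := mul_le_mul_of_nonneg_left h1 (by linarith : (0:ℝ) ≤ d - 1)
        refine h3.trans ?_
        have h4 := le_abs_self B
        have h5 := abs_nonneg B
        unfold C2
        rcases hchi with h | h <;> rw [h]
        · linarith
        · linarith

lemma green_ne_zero_of_big {d : ℕ} (hd : 1 < d) {gI : ℂ → ℝ} (hg : IsGreen d gI) {lam : ℂ}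
    (h : 3 ≤ ‖lam‖) : gI lam ≠ 0 := by
  intro h0
  obtain ⟨k, hk⟩ := pow_unbounded_of_one_lt (Real.exp (C0 d)) (by norm_num : (1:ℝ) < 2)
  have h1 := big_orb hd h k
  have h2 : Real.exp (C0 d) < ‖orb d lam (k + 1)‖ := by nlinarith [Real.exp_pos (C0 d)]
  have h3 : orb d lam (k + 1) ≠ 0 := by
    intro hc
    rw [hc, norm_zero] at h2
    linarith [Real.exp_pos (C0 d)]
  have h4 := log_le_ell h3
  have h5 := (abs_le.1 (hg.ell_sub hd lam (k := k + 1) (by omega))).2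
  rw [h0, mul_zero, sub_zero] at h5
  have h6 := (Real.lt_log_iff_exp_lt (norm_pos_iff.2 h3)).2 h2
  linarith

lemma Scales.Xf_bound {d n : ℕ} (hd : 1 < d) (hn : 1 ≤ n) {M B : ℝ} {δ ε : ℕ → ℝ}
    (S : Scales d M δ ε B) {Φ : ℂ[X][X]} (H : DynFam d n Φ)
    {gI : ℂ → ℝ} (hg : IsGreen d gI) {r : ℝ} (hr : 0 < r) (hr1 : r ≤ 1) {lam : ℂ}
    (h0 : orb d lam n ≠ 0) :
    |Xf d n gI Φ r lam| ≤ Gf d n ε B lam := by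
  have hd1 : (1:ℝ) < d := by exact_mod_cast hd
  have hlog : 0 ≤ Real.log d := Real.log_nonneg hd1.le
  have hs1 : 0 ≤ s1 n := by unfold s1; positivity
  rw [abs_le]
  constructor
  · have h1 := (abs_le.1 (S.sum_uu_bound hd hg h0)).1
    exact h1.trans (Xf_ge hd hn H gI h0)
  · by_cases hgl : gI lam = 0
    · have hchi : chi lam = 1 := by
        unfold chi
        rw [if_pos]
        by_contra hc
        exact green_ne_zero_of_big hd hg (by linarith) hgl
      have hE : ∀ l, gI l ≠ 0 → Xf d n gI Φ r l ≤
          2.2 * Real.log d * s1 n + C2 d B * n.divisors.card := by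
        intro l hl
        rw [Xf_eq hd hn H hg hr1 hl]
        refine (le_abs_self _).trans
          ((S.sum_uu_bound hd hg (orb_ne_zero_of_green hd hn hg hl)).trans ?_)
        unfold Gf
        rw [Finset.sum_eq_zero fun m hm => S.Yf_eq_zero hd hg (Nat.pos_of_mem_divisors hm) hl]
        have : chi l ≤ 1 := by unfold chi; split_ifs <;> norm_num
        have : 0 ≤ 2.2 * Real.log d * s1 n := by positivity
        nlinarith
      refine (Xf_le_of_zero hd hn H hg hr hE hgl).trans ?_
      unfold Gf
      rw [hchi]
      have : 0 ≤ ((d:ℝ) - 1) * ∑ m ∈ n.divisors, Yf d ε m lam :=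
        mul_nonneg (by linarith) (Finset.sum_nonneg fun m _ => Yf_nonneg lam)
      linarith
    · rw [Xf_eq hd hn H hg hr1 hgl]
      exact (le_abs_self _).trans (S.sum_uu_bound hd hg h0)



noncomputable def ww (lam : ℂ) : ℝ := 1 / π * ((1 + ‖lam‖ ^ 2) ^ 2)⁻¹

lemma ww_nonneg (lam : ℂ) : 0 ≤ ww lam := by unfold ww; positivity

lemma ww_le (lam : ℂ) : ww lam ≤ 1 / π := by
  unfold ww
  have h : ((1 + ‖lam‖ ^ 2) ^ 2)⁻¹ ≤ (1:ℝ) := inv_le_one_of_one_le₀ (one_le_pow₀ (by nlinarith [sq_nonneg ‖lam‖]))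
  have : 0 < 1 / π := by positivity
  nlinarith

lemma ww_continuous : Continuous ww := by
  unfold ww
  refine continuous_const.mul (Continuous.inv₀ (by fun_prop) fun x => ?_)
  positivity

lemma ww_integrable : Integrable ww := by
  have h := (integrable_rpow_neg_one_add_norm_sq (E := ℂ) (μ := volume) (r := 4)
    (by simp; norm_num)).const_mul (1 / π)
  refine h.congr (Filter.Eventually.of_forall fun x => ?_)
  simp only [ww]
  congr 1
  rw [show (-4 / 2 : ℝ) = -((2:ℕ):ℝ) by norm_num, Real.rpow_neg (by positivity), Real.rpow_natCast]

lemma chi_ww_integral : ∫ lam, chi lam * ww lam = 0.9 := by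
  have h := integral_fun_norm_addHaar (E := ℂ) volume
    (fun y : ℝ => (if y < 3 then (1:ℝ) else 0) * (1 / π * ((1 + y ^ 2) ^ 2)⁻¹))
  have e : ∫ lam, chi lam * ww lam = ∫ x : ℂ, (if ‖x‖ < 3 then (1:ℝ) else 0) *
    (1 / π * ((1 + ‖x‖ ^ 2) ^ 2)⁻¹) := rfl
  rw [e, h]
  have e2 : ∫ y in Set.Ioi (0:ℝ), y ^ (Module.finrank ℝ ℂ - 1) •
      ((if y < 3 then (1:ℝ) else 0) * (1 / π * ((1 + y ^ 2) ^ 2)⁻¹)) =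
      ∫ y in (0:ℝ)..3, y * (1 / π * ((1 + y ^ 2) ^ 2)⁻¹) := by
    rw [intervalIntegral.integral_of_le (by norm_num), ← setIntegral_congr_set Ioo_ae_eq_Ioc,
      ← integral_indicator measurableSet_Ioi, ← integral_indicator measurableSet_Ioo]
    congr 1
    funext y
    simp only [Set.indicator, Set.mem_Ioi, Set.mem_Ioo, Complex.finrank_real_complex, smul_eq_mul]
    by_cases h1 : 0 < y <;> by_cases h2 : y < 3 <;> simp [h1, h2]
  have e3 : ∫ y in (0:ℝ)..3, y * (1 / π * ((1 + y ^ 2) ^ 2)⁻¹) = 0.45 / π := by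
    have hder : ∀ x ∈ Set.uIcc (0:ℝ) 3, HasDerivAt (fun y : ℝ => -(1 / (2 * π)) * (1 + y ^ 2)⁻¹)
        (x * (1 / π * ((1 + x ^ 2) ^ 2)⁻¹)) x := by
      intro x _
      have hx : (1 + x ^ 2) ≠ 0 := by positivity
      have h1 : HasDerivAt (fun y : ℝ => 1 + y ^ 2) (2 * x) x := by
        simpa using (hasDerivAt_pow 2 x).const_add 1
      have h2 := (h1.inv hx).const_mul (-(1 / (2 * π)))
      refine HasDerivAt.congr_deriv (f' := -(1 / (2 * π)) * (-(2 * x) / (1 + x ^ 2) ^ 2)) h2 ?_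
      have := Real.pi_ne_zero
      field_simp
    rw [intervalIntegral.integral_eq_sub_of_hasDerivAt hder]
    · have := Real.pi_ne_zero
      field_simp
      norm_num
    · apply Continuous.intervalIntegrable
      refine continuous_id.mul (continuous_const.mul (Continuous.inv₀ (by fun_prop) fun x => ?_))
      positivity
  rw [e2, e3]
  have hv : (volume : Measure ℂ).real (Metric.ball 0 1) = π := by
    simp [Measure.real, Complex.volume_ball]
  rw [hv, Complex.finrank_real_complex]
  have := Real.pi_ne_zero
  simp only [smul_eq_mul, nsmul_eq_mul]
  field_simp
  norm_num

lemma chi_measurable : Measurable chi := by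
  unfold chi
  refine Measurable.ite ?_ measurable_const measurable_const
  exact (isOpen_lt continuous_norm continuous_const).measurableSet

lemma chi_ww_integrable : Integrable fun lam => chi lam * ww lam := by
  refine ww_integrable.mono' (chi_measurable.mul ww_continuous.measurable).aestronglyMeasurable
    (Filter.Eventually.of_forall fun x => ?_)
  rw [norm_mul, Real.norm_eq_abs, Real.norm_eq_abs, abs_of_nonneg (ww_nonneg x)]
  have := ww_nonneg x
  unfold chi
  split_ifs <;> simp [this]

lemma Yf_measurable (d : ℕ) (ε : ℕ → ℝ) (m : ℕ) : Measurable (Yf d ε m) := by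
  have h := (orb_continuous d m).norm
  unfold Yf
  refine Measurable.ite ?_ ?_ measurable_const
  · exact (isOpen_lt h continuous_const).measurableSet
  · exact Real.measurable_log.comp (measurable_const.div h.measurable)

lemma Scales.Yf_lintegral {d : ℕ} (hd : 1 < d) {M B : ℝ} {δ ε : ℕ → ℝ} (S : Scales d M δ ε B)
    {m : ℕ} (hm : 1 ≤ m) : ∫⁻ x, ENNReal.ofReal (Yf d ε m x) ≤ ENNReal.ofReal (63 * π) := by
  obtain ⟨h1, h2, h3, h4, h5, h6, -⟩ := S.all m hm
  have h := orb_area hd hm S.big1 S.big2 h1 h2 h3 h4 h5 h6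
  have hme : MeasurableSet {x | ‖orb d x m‖ < ε m} :=
    (isOpen_lt (orb_continuous d m).norm continuous_const).measurableSet
  rw [← lintegral_indicator hme] at h
  refine le_trans (le_of_eq ?_) h
  congr 1
  funext x
  by_cases hx : ‖orb d x m‖ < ε m <;> simp [Yf, Set.indicator, hx]

lemma Scales.Yf_integrable {d : ℕ} (hd : 1 < d) {M B : ℝ} {δ ε : ℕ → ℝ} (S : Scales d M δ ε B)
    {m : ℕ} (hm : 1 ≤ m) : Integrable (Yf d ε m) := by
  refine ⟨(Yf_measurable d ε m).aestronglyMeasurable, ?_⟩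
  rw [hasFiniteIntegral_iff_ofReal (Filter.Eventually.of_forall fun x => Yf_nonneg x)]
  exact (S.Yf_lintegral hd hm).trans_lt ENNReal.ofReal_lt_top

lemma Scales.Yf_integral {d : ℕ} (hd : 1 < d) {M B : ℝ} {δ ε : ℕ → ℝ} (S : Scales d M δ ε B)
    {m : ℕ} (hm : 1 ≤ m) : ∫ x, Yf d ε m x ≤ 63 * π := by
  rw [integral_eq_lintegral_of_nonneg_ae (Filter.Eventually.of_forall fun x => Yf_nonneg x)
    (Yf_measurable d ε m).aestronglyMeasurable]
  exact ENNReal.toReal_le_of_le_ofReal (by positivity) (S.Yf_lintegral hd hm)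

lemma Scales.Yf_ww_integrable {d : ℕ} (hd : 1 < d) {M B : ℝ} {δ ε : ℕ → ℝ} (S : Scales d M δ ε B)
    {m : ℕ} (hm : 1 ≤ m) : Integrable fun x => Yf d ε m x * ww x := by
  refine ((S.Yf_integrable hd hm).mul_const (1 / π)).mono'
    ((Yf_measurable d ε m).mul ww_continuous.measurable).aestronglyMeasurable
    (Filter.Eventually.of_forall fun x => ?_)
  rw [norm_mul, Real.norm_eq_abs, Real.norm_eq_abs, abs_of_nonneg (ww_nonneg x),
    abs_of_nonneg (Yf_nonneg x)]
  exact mul_le_mul_of_nonneg_left (ww_le x) (Yf_nonneg x)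

lemma Scales.Yf_ww_integral {d : ℕ} (hd : 1 < d) {M B : ℝ} {δ ε : ℕ → ℝ} (S : Scales d M δ ε B)
    {m : ℕ} (hm : 1 ≤ m) : ∫ x, Yf d ε m x * ww x ≤ 63 := by
  have h1 : ∫ x, Yf d ε m x * ww x ≤ ∫ x, Yf d ε m x * (1 / π) :=
    integral_mono (S.Yf_ww_integrable hd hm) ((S.Yf_integrable hd hm).mul_const _)
      fun x => mul_le_mul_of_nonneg_left (ww_le x) (Yf_nonneg x)
  rw [integral_mul_const] at h1
  have h2 := S.Yf_integral hd hm
  have hp := Real.pi_pos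
  calc _ ≤ _ := h1
    _ ≤ (63 * π) * (1 / π) := mul_le_mul_of_nonneg_right h2 (by positivity)
    _ = 63 := by field_simp

lemma orb_ae_ne_zero {d : ℕ} (hd : 1 < d) {n : ℕ} (hn : 1 ≤ n) :
    ∀ᵐ lam : ℂ, orb d lam n ≠ 0 := by
  have hP : orbP d n ≠ 0 := by
    intro h
    obtain ⟨k, rfl⟩ := Nat.exists_eq_add_of_le' hn
    have h1 := big_orb hd (lam := 3) (by simp) k
    rw [← orbP_eval, h] at h1
    simp at h1
    have : (0:ℝ) < 2 ^ k := by positivity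
    linarith
  have hf : {lam : ℂ | orb d lam n = 0}.Finite := by
    have h2 := Polynomial.finite_setOfPred_isRoot hP
    refine h2.subset fun x hx => ?_
    have : (orbP d n).eval x = 0 := by rw [orbP_eval]; exact hx
    exact this
  have := hf.measure_zero (volume : Measure ℂ)
  rw [ae_iff]
  simpa using this

lemma Gf_ww (d n : ℕ) (ε : ℕ → ℝ) (B : ℝ) : (fun x => Gf d n ε B x * ww x) = fun x =>
    (2.2 * Real.log d * s1 n) * (chi x * ww x) + (C2 d B * n.divisors.card) * ww x +
    ((d:ℝ) - 1) * ∑ m ∈ n.divisors, Yf d ε m x * ww x := by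
  funext x
  unfold Gf
  rw [← Finset.sum_mul]
  ring

lemma Scales.Gf_ww_integrable {d : ℕ} (hd : 1 < d) {M B : ℝ} {δ ε : ℕ → ℝ} (S : Scales d M δ ε B)
    (n : ℕ) : Integrable fun x => Gf d n ε B x * ww x := by
  rw [Gf_ww]
  refine ((chi_ww_integrable.const_mul _).add (ww_integrable.const_mul _)).add
    (Integrable.const_mul ?_ _)
  exact integrable_finsetSum _ fun m hm => S.Yf_ww_integrable hd (Nat.pos_of_mem_divisors hm)

lemma Scales.Gf_ww_integral {d : ℕ} (hd : 1 < d) {M B : ℝ} {δ ε : ℕ → ℝ} (S : Scales d M δ ε B)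
    (n : ℕ) : ∫ x, Gf d n ε B x * ww x ≤ 2 * Real.log d * s1 n +
      (C2 d B * (∫ x, ww x) + 63 * ((d:ℝ) - 1) + 1) * n.divisors.card := by
  have hY : ∀ m ∈ n.divisors, Integrable fun x => Yf d ε m x * ww x :=
    fun m hm => S.Yf_ww_integrable hd (Nat.pos_of_mem_divisors hm)
  have hd1 : (1:ℝ) < d := by exact_mod_cast hd
  have hlog : 0 ≤ Real.log d := Real.log_nonneg hd1.le
  have hs1 : 0 ≤ s1 n := by unfold s1; positivity
  rw [Gf_ww, integral_add, integral_add, integral_const_mul, integral_const_mul,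
    integral_const_mul, chi_ww_integral, integral_finsetSum _ hY]
  · have h1 : ∑ m ∈ n.divisors, ∫ x, Yf d ε m x * ww x ≤ ∑ m ∈ n.divisors, (63:ℝ) :=
      Finset.sum_le_sum fun m hm => S.Yf_ww_integral hd (Nat.pos_of_mem_divisors hm)
    rw [Finset.sum_const, nsmul_eq_mul] at h1
    have h2 := mul_le_mul_of_nonneg_left h1 (by linarith : (0:ℝ) ≤ d - 1)
    have h3 : 0 ≤ Real.log d * s1 n := by positivity
    have h4 : (0:ℝ) ≤ n.divisors.card := by positivity
    nlinarith
  · exact chi_ww_integrable.const_mul _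
  · exact ww_integrable.const_mul _
  · exact (chi_ww_integrable.const_mul _).add (ww_integrable.const_mul _)
  · exact (integrable_finsetSum _ hY).const_mul _

lemma green_ww_integrable {d : ℕ} (hd : 1 < d) {gI : ℂ → ℝ} (hg : IsGreen d gI) :
    Integrable fun x => gI x * ww x := by
  have h := (integrable_rpow_neg_one_add_norm_sq (E := ℂ) (μ := volume) (r := 3)
    (by simp; norm_num)).const_mul ((1 + C0 d) * (1 / π))
  refine h.mono' ((hg.continuous hd).mul ww_continuous).aestronglyMeasurable
    (Filter.Eventually.of_forall fun x => ?_)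
  rw [norm_mul, Real.norm_eq_abs, Real.norm_eq_abs, abs_of_nonneg (ww_nonneg x),
    abs_of_nonneg (hg.nonneg x)]
  have h1 := hg.le hd x
  set y : ℝ := 1 + ‖x‖ ^ 2 with hy
  have hy1 : 1 ≤ y := by nlinarith [sq_nonneg ‖x‖]
  have hy0 : 0 < y := by linarith
  have h2 := Real.log_le_rpow_div hy0.le (ε := 1 / 2) (by norm_num)
  have h3 : (1:ℝ) ≤ y ^ ((1:ℝ) / 2) := Real.one_le_rpow hy1 (by norm_num)
  have h4 := C0_pos d
  have h5 : gI x ≤ (1 + C0 d) * y ^ ((1:ℝ) / 2) := by nlinarith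
  have h6 : y ^ (-3 / 2 : ℝ) = y ^ ((1:ℝ) / 2) * (y ^ 2)⁻¹ := by
    rw [← Real.rpow_natCast y 2, ← Real.rpow_neg hy0.le, ← Real.rpow_add hy0]
    norm_num
  rw [h6]
  have h7 : ww x = 1 / π * (y ^ 2)⁻¹ := rfl
  have h8 := mul_le_mul_of_nonneg_right h5 (ww_nonneg x)
  rw [h7] at h8 ⊢
  linarith

lemma lap_bound {φ : ℂ → ℝ} {K : ℝ}
    (hK : ∀ lam : ℂ, |(1 + ‖lam‖ ^ 2) ^ 2 * lap φ lam / 2| ≤ K) (x : ℂ) :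
    |lap φ x / (2 * π)| ≤ K * ww x := by
  have h := hK x
  have hp := Real.pi_pos
  have e : lap φ x / (2 * π) = ((1 + ‖x‖ ^ 2) ^ 2 * lap φ x / 2) * ww x := by
    unfold ww
    have : (1 + ‖x‖ ^ 2) ≠ 0 := by positivity
    field_simp
  rw [e, abs_mul, abs_of_nonneg (ww_nonneg x)]
  exact mul_le_mul_of_nonneg_right h (ww_nonneg x)

theorem statement19 (d : ℕ) (hd : 1 < d) (gI : ℂ → ℝ)
    (hgI : ∀ lam : ℂ, Filter.Tendsto
      (fun k : ℕ => (1 / 2) * Real.log (1 + ‖(fc d lam)^[k] 0‖ ^ 2) / (d : ℝ) ^ (k - 1))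
      Filter.atTop (nhds (gI lam))) :
    ∃ C : ℝ, 0 < C ∧ ∀ n : ℕ, 1 < n →
      ∀ Φ : Polynomial (Polynomial ℂ),
      (∀ lam z : ℂ,
        (∏ m ∈ n.divisors.filter fun m => ArithmeticFunction.moebius (n / m) = 1,
            ((fc d lam)^[m] z - z)) =
          (Φ.map (evalRingHom lam)).eval z *
            ∏ m ∈ n.divisors.filter fun m => ArithmeticFunction.moebius (n / m) = -1,
              ((fc d lam)^[m] z - z)) →
      (∀ lam : ℂ, (Φ.map (evalRingHom lam)).Monic) →
      (∀ lam : ℂ, ((Φ.map (evalRingHom lam)).natDegree : ℤ) = nu d n) →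
      ∀ r : ℝ, 0 < r → r ≤ 1 →
      ∀ φ : ℂ → ℝ, ∀ φinf : ℝ,
      ContDiff ℝ 2 φ →
      ContDiffAt ℝ 2 (fun w : ℂ => if w = 0 then φinf else φ w⁻¹) 0 →
      ∀ K : ℝ, (∀ lam : ℂ, |(1 + ‖lam‖ ^ 2) ^ 2 * lap φ lam / 2| ≤ K) →
      |(∫ lam : ℂ,
            ((1 / (n : ℝ)) *
                (((Φ.map (evalRingHom lam)).roots).map
                  (fun z => Real.log (max r ‖deriv ((fc d lam)^[n]) z‖))).sum)
              * lap φ lam / (2 * π))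
          + ((d : ℝ) - 1) * (nu d n : ℝ) / d * φinf
          - (nu d n : ℝ) * (((d : ℝ) - 1) / d *
              (φinf + ∫ lam : ℂ, gI lam * lap φ lam / (2 * π)))|
        ≤ K * ((2 * Real.log d) * (∑ m ∈ n.divisors, (m : ℝ)) + C * n.divisors.card) := by
  have hg : IsGreen d gI := hgI
  obtain ⟨M, δ, ε, B, S⟩ := exists_Scales hd
  have hd1 : (1:ℝ) < d := by exact_mod_cast hd
  refine ⟨C2 d B * (∫ x, ww x) + 63 * ((d:ℝ) - 1) + 1, ?_, ?_⟩
  · have h1 : 0 ≤ ∫ x, ww x := integral_nonneg ww_nonneg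
    have h2 : 0 ≤ C2 d B := by
      unfold C2
      have := C0_pos d
      have := abs_nonneg B
      have : 0 ≤ ((d:ℝ) - 1) * (C0 d + 1) := mul_nonneg (by linarith) (by linarith)
      linarith
    have := mul_nonneg h2 h1
    linarith
  intro n hn Φ hprod hmonic hdeg r hr hr1 φ φinf hφ hinf K hK
  have H : DynFam d n Φ := ⟨fun lam => ⟨hprod lam, hmonic lam, hdeg lam⟩⟩
  have hn1 : 1 ≤ n := hn.le
  have hK0 : 0 ≤ K := (abs_nonneg _).trans (hK 0)
  have hlapc := lap_continuous φ hφ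
  set ψ : ℂ → ℝ := fun x => lap φ x / (2 * π) with hψ
  have hψc : Continuous ψ := hlapc.div_const _
  have hψb : ∀ x, |ψ x| ≤ K * ww x := lap_bound hK
  have hψi : Integrable ψ := (ww_integrable.const_mul K).mono' hψc.aestronglyMeasurable
    (Filter.Eventually.of_forall hψb)
  have hlapi : Integrable (lap φ) := by
    refine (hψi.mul_const (2 * π)).congr (Filter.Eventually.of_forall fun x => ?_)
    have := Real.pi_ne_zero
    simp only [hψ]
    field_simp
  have hψ0 : ∫ x, ψ x = 0 := by
    simp only [hψ]
    rw [integral_div, integral_lap_zero φ φinf hφ (tendsto_inf_of_contDiffAt φ φinf hinf) hlapi,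
      zero_div]
  have hgi : Integrable fun x => gI x * ψ x := by
    refine ((green_ww_integrable hd hg).const_mul K).mono'
      ((hg.continuous hd).mul hψc).aestronglyMeasurable (Filter.Eventually.of_forall fun x => ?_)
    rw [norm_mul, Real.norm_eq_abs, Real.norm_eq_abs, abs_of_nonneg (hg.nonneg x)]
    have := mul_le_mul_of_nonneg_left (hψb x) (hg.nonneg x)
    linarith
  have hAc := Asum_continuous d n Φ _ H.monic H.natDegree hr
  have hXc : Continuous (Xf d n gI Φ r) := by
    unfold Xf
    exact ((continuous_const.mul hAc).sub continuous_const).sub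
      (continuous_const.mul (continuous_const.mul (hg.continuous hd)))
  have hXb : ∀ᵐ x, ‖Xf d n gI Φ r x * ψ x‖ ≤ K * (Gf d n ε B x * ww x) := by
    filter_upwards [orb_ae_ne_zero hd hn1] with x hx
    have h1 := S.Xf_bound hd hn1 H hg hr hr1 hx
    rw [norm_mul, Real.norm_eq_abs, Real.norm_eq_abs]
    have h2 := mul_le_mul h1 (hψb x) (abs_nonneg _) ((abs_nonneg _).trans h1)
    linarith
  have hGi := (S.Gf_ww_integrable hd n).const_mul K
  have hXi : Integrable fun x => Xf d n gI Φ r x * ψ x :=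
    hGi.mono' (hXc.mul hψc).aestronglyMeasurable hXb
  have hXint : |∫ x, Xf d n gI Φ r x * ψ x| ≤ K * ∫ x, Gf d n ε B x * ww x := by
    rw [← integral_const_mul]
    exact norm_integral_le_of_norm_le hGi hXb
  have e1 : (fun lam : ℂ => ((1 / (n : ℝ)) * (((Φ.map (evalRingHom lam)).roots).map
                  (fun z => Real.log (max r ‖deriv ((fc d lam)^[n]) z‖))).sum)
              * lap φ lam / (2 * π)) = fun x => (Xf d n gI Φ r x * ψ x +
        (nu d n * Real.log d) * ψ x) + (nu d n * (((d:ℝ) - 1) / d)) * (gI x * ψ x) := by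
    funext x
    simp only [Xf, Asum, hψ]
    ring
  have e2 : (fun lam : ℂ => gI lam * lap φ lam / (2 * π)) = fun x => gI x * ψ x := by
    funext x
    simp only [hψ]
    ring
  have hsum : Integrable fun x => Xf d n gI Φ r x * ψ x + (nu d n * Real.log d) * ψ x :=
    hXi.add (hψi.const_mul _)
  rw [e1, e2, integral_add hsum (hgi.const_mul _),
    integral_add hXi (hψi.const_mul _), integral_const_mul, integral_const_mul, hψ0]
  have hfin : (∫ x, Xf d n gI Φ r x * ψ x) + nu d n * Real.log d * 0 +
      nu d n * (((d:ℝ) - 1) / d) * (∫ x, gI x * ψ x) + ((d : ℝ) - 1) * (nu d n : ℝ) / d * φinf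
          - (nu d n : ℝ) * (((d : ℝ) - 1) / d * (φinf + ∫ x, gI x * ψ x)) =
      ∫ x, Xf d n gI Φ r x * ψ x := by ring
  rw [hfin]
  refine hXint.trans (mul_le_mul_of_nonneg_left ?_ hK0)
  exact S.Gf_ww_integral hd n
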